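/- arXiv:1607.00053 — 3 statements merged into one kernel-verified Lean document; each statement's English description precedes it below -/
import Mathlib

section
/- Every finite connected 6-regular simple graph with an odd number of vertices admits a rooted decomposition into three odd closed trails, i.e., a rooted 3-odd decomposition. -/
open SimpleGraph

/-- An eulerian subgraph of `G`: a connected (hence vertex-nonempty) subgraph of `G`
in which every vertex has even degree. -/
def IsEulerianSubgraph {V : Type*} (G : SimpleGraph V) (H : G.Subgraph) : Prop :=
  H.Connected ∧ ∀ v ∈ H.verts, Even ((H.neighborSet v).ncard)

/-- A `k`-odd decomposition of `G`: a partition of the edge set of `G` into the edge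
sets of `k` eulerian subgraphs, each having an odd number of edges. -/
def IsKOddDecomposition {V : Type*} (G : SimpleGraph V) (k : ℕ)
    (D : Fin k → G.Subgraph) : Prop :=
  (∀ i, IsEulerianSubgraph G (D i)) ∧
  (∀ i, Odd ((D i).edgeSet.ncard)) ∧
  (∀ i j, i ≠ j → Disjoint ((D i).edgeSet) ((D j).edgeSet)) ∧
  (⋃ i, (D i).edgeSet) = G.edgeSet

/-- A rooted `k`-odd decomposition: a `k`-odd decomposition all of whose constituents
share a common vertex. -/
def IsRootedKOddDecomposition {V : Type*} (G : SimpleGraph V) (k : ℕ)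
    (D : Fin k → G.Subgraph) : Prop :=
  IsKOddDecomposition G k D ∧ ∃ v : V, ∀ i, v ∈ (D i).verts

set_option linter.unusedSectionVars false

namespace OddDec

variable {V : Type*} [DecidableEq V] {G : SimpleGraph V}

structure Arc (G : SimpleGraph V) where
  u : V
  w : V
  q : G.Walk u w

namespace Arc

def E (a : Arc G) : Multiset (Sym2 V) := (a.q.edges : Multiset (Sym2 V))
def n (a : Arc G) : ℕ := Multiset.card a.E
def inc (x : V) (a : Arc G) : Prop := a.u = x ∨ a.w = x
def o (x : V) (a : Arc G) : V := if a.u = x then a.w else a.u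
def cut (Y : Finset V) (a : Arc G) : ℕ := if (a.u ∈ Y ↔ a.w ∈ Y) then 0 else 1
def cost (B : Finset V) (a : Arc G) : ℕ := (a.n + a.cut B) % 2
def deg (x : V) (a : Arc G) : ℕ := (if a.u = x then 1 else 0) + (if a.w = x then 1 else 0)
def rd (R : Finset V) (a : Arc G) : ℕ := (if a.u ∈ R then 1 else 0) + (if a.w ∈ R then 1 else 0)

lemma exists_walk (x : V) (a : Arc G) (h : a.inc x) :
    ∃ q : G.Walk x (a.o x), (q.edges : Multiset (Sym2 V)) = a.E := by
  obtain ⟨u, w, q⟩ := a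
  by_cases hu : u = x
  · subst hu
    have ho : (⟨u, w, q⟩ : Arc G).o u = w := by simp [o]
    rw [ho]
    exact ⟨q, rfl⟩
  · have hw : w = x := by
      rcases h with h | h
      · exact absurd h hu
      · exact h
    subst hw
    have ho : (⟨u, w, q⟩ : Arc G).o w = u := by simp [o, hu]
    rw [ho]
    refine ⟨q.reverse, ?_⟩
    simp [E, Walk.edges_reverse]

lemma comp (x : V) (e f : Arc G) (he : e.inc x) (hf : f.inc x) :
    ∃ g : Arc G, g.E = e.E + f.E ∧ g.u = e.o x ∧ g.w = f.o x := by
  obtain ⟨q, hq⟩ := exists_walk x e he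
  obtain ⟨r, hr⟩ := exists_walk x f hf
  refine ⟨⟨_, _, q.reverse.append r⟩, ?_, rfl, rfl⟩
  rw [← hq, ← hr]
  simp [E, Walk.edges_append, Walk.edges_reverse, ← Multiset.coe_add]

lemma cut_le_one (Y : Finset V) (a : Arc G) : a.cut Y ≤ 1 := by
  unfold cut; split_ifs <;> simp

lemma cost_le_one (Y : Finset V) (a : Arc G) : a.cost Y ≤ 1 := by
  unfold cost; omega

/-- cut of an arc incident with `x`. -/
lemma cut_inc (x : V) (a : Arc G) (h : a.inc x) (Y : Finset V) :
    a.cut Y = if (x ∈ Y ↔ a.o x ∈ Y) then 0 else 1 := by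
  obtain ⟨u, w, q⟩ := a
  simp only [cut, o, inc] at *
  grind

lemma rd_inc (x : V) (a : Arc G) (h : a.inc x) (R : Finset V) (hx : x ∉ R) :
    a.rd R = if a.o x ∈ R then 1 else 0 := by
  obtain ⟨u, w, q⟩ := a
  simp only [rd, o, inc] at *
  grind

lemma deg_inc (x : V) (a : Arc G) (h : a.inc x) (y : V) (hx : x ≠ y) :
    a.deg y = if a.o x = y then 1 else 0 := by
  obtain ⟨u, w, q⟩ := a
  simp only [deg, o, inc] at *
  grind

lemma cut_single (x : V) (a : Arc G) : a.cut {x} = 1 ↔ a.inc x ∧ a.o x ≠ x := by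
  obtain ⟨u, w, q⟩ := a
  simp only [cut, o, inc, Finset.mem_singleton] at *
  grind

/-- parity relation between two labelings. -/
lemma cut_symmDiff (B C : Finset V) (a : Arc G) :
    (a.cut (symmDiff B C) + a.cut B + a.cut C) % 2 = 0 := by
  simp only [cut, Finset.mem_symmDiff]
  by_cases h1 : a.u ∈ B <;> by_cases h2 : a.u ∈ C <;> by_cases h3 : a.w ∈ B <;>
    by_cases h4 : a.w ∈ C <;> simp [h1, h2, h3, h4]

lemma cost_symmDiff (B C : Finset V) (a : Arc G) :
    (a.cost B + a.cost C + a.cut (symmDiff B C)) % 2 = 0 := by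
  have := cut_symmDiff B C a
  unfold cost; omega

lemma cut_union_inter (P Q : Finset V) (a : Arc G) :
    a.cut (P ∪ Q) + a.cut (P ∩ Q) ≤ a.cut P + a.cut Q := by
  simp only [cut, Finset.mem_union, Finset.mem_inter]
  by_cases h1 : a.u ∈ P <;> by_cases h2 : a.u ∈ Q <;> by_cases h3 : a.w ∈ P <;>
    by_cases h4 : a.w ∈ Q <;> simp [h1, h2, h3, h4]

lemma cut_sdiff_sdiff (P Q : Finset V) (a : Arc G) :
    a.cut (P \ Q) + a.cut (Q \ P) ≤ a.cut P + a.cut Q := by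
  simp only [cut, Finset.mem_sdiff]
  by_cases h1 : a.u ∈ P <;> by_cases h2 : a.u ∈ Q <;> by_cases h3 : a.w ∈ P <;>
    by_cases h4 : a.w ∈ Q <;> simp [h1, h2, h3, h4]

/-- Relations satisfied by a composed arc. -/
structure IsComp (x : V) (e f g : Arc G) : Prop where
  E : g.E = e.E + f.E
  u : g.u = e.o x
  w : g.w = f.o x
  he : e.inc x
  hf : f.inc x

namespace IsComp
variable {x : V} {e f g : Arc G}

lemma cut_eq (h : IsComp x e f g) (Y : Finset V) :
    g.cut Y = e.cut Y + f.cut Y - (if e.cut Y = 1 ∧ f.cut Y = 1 then 2 else 0) := by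
  rw [cut_inc x e h.he, cut_inc x f h.hf, cut, h.u, h.w]
  by_cases h1 : x ∈ Y <;> by_cases h2 : e.o x ∈ Y <;> by_cases h3 : f.o x ∈ Y <;>
    simp [h1, h2, h3]

lemma cut_add (h : IsComp x e f g) (Y : Finset V) :
    g.cut Y + (if e.cut Y = 1 ∧ f.cut Y = 1 then 2 else 0) = e.cut Y + f.cut Y := by
  rw [h.cut_eq Y]; split_ifs <;> omega

lemma n_eq (h : IsComp x e f g) : g.n = e.n + f.n := by
  simp [n, h.E]

lemma cost_add (h : IsComp x e f g) (Y : Finset V) :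
    g.cost Y + (if e.cost Y = 1 ∧ f.cost Y = 1 then 2 else 0) = e.cost Y + f.cost Y := by
  have h1 := h.cut_add Y
  have h2 := h.n_eq
  have : (g.cut Y) % 2 = (e.cut Y + f.cut Y) % 2 := by split_ifs at h1 <;> omega
  unfold cost
  split_ifs <;> omega

lemma rd_add (h : IsComp x e f g) (R : Finset V) (hx : x ∉ R) :
    g.rd R = e.rd R + f.rd R := by
  rw [rd_inc x e h.he R hx, rd_inc x f h.hf R hx, rd, h.u, h.w]

lemma deg_add (h : IsComp x e f g) (y : V) (hx : x ≠ y) :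
    g.deg y = e.deg y + f.deg y := by
  rw [deg_inc x e h.he y hx, deg_inc x f h.hf y hx, deg, h.u, h.w]

end IsComp

lemma exists_comp (x : V) (e f : Arc G) (he : e.inc x) (hf : f.inc x) :
    ∃ g : Arc G, IsComp x e f g := by
  obtain ⟨g, h1, h2, h3⟩ := comp x e f he hf
  exact ⟨g, h1, h2, h3, he, hf⟩

end Arc

/-- total of a function over the arcs -/
def tot (φ : Arc G → ℕ) (L : Multiset (Arc G)) : ℕ := (L.map φ).sum

@[simp] lemma tot_cons (φ : Arc G → ℕ) (a : Arc G) (L : Multiset (Arc G)) :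
    tot φ (a ::ₘ L) = φ a + tot φ L := by simp [tot]
@[simp] lemma tot_add' (φ : Arc G → ℕ) (L M : Multiset (Arc G)) :
    tot φ (L + M) = tot φ L + tot φ M := by simp [tot]
@[simp] lemma tot_zero (φ : Arc G → ℕ) : tot φ (0 : Multiset (Arc G)) = 0 := by simp [tot]
lemma tot_fadd (φ ψ : Arc G → ℕ) (L : Multiset (Arc G)) :
    tot (fun a => φ a + ψ a) L = tot φ L + tot ψ L := by simp [tot]
lemma tot_le {φ ψ : Arc G → ℕ} {L : Multiset (Arc G)} (h : ∀ a ∈ L, φ a ≤ ψ a) :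
    tot φ L ≤ tot ψ L := Multiset.sum_map_le_sum_map _ _ h
lemma tot_congr {φ ψ : Arc G → ℕ} {L : Multiset (Arc G)} (h : ∀ a ∈ L, φ a = ψ a) :
    tot φ L = tot ψ L := by
  unfold tot; rw [Multiset.map_congr rfl h]
lemma tot_pos {φ : Arc G → ℕ} {L : Multiset (Arc G)} (h : 0 < tot φ L) : ∃ a ∈ L, 0 < φ a := by
  by_contra hc
  push Not at hc
  have h0 : tot φ L ≤ tot (fun _ => 0) L := tot_le hc
  have h1 : tot (fun _ => 0) L = 0 := by simp [tot]
  omega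

abbrev dl (L : Multiset (Arc G)) (Y : Finset V) : ℕ := tot (Arc.cut Y) L
abbrev ff (L : Multiset (Arc G)) (B : Finset V) : ℕ := tot (Arc.cost B) L

structure Core (R W : Finset V) (d : ℕ) (L : Multiset (Arc G)) : Prop where
  ends : ∀ a ∈ L, (a.u ∈ R ∨ a.u ∈ W) ∧ (a.w ∈ R ∨ a.w ∈ W)
  disj : Disjoint R W
  cutEven : ∀ Y ⊆ W, Even (dl L Y)
  cost_ge : ∀ B ⊆ W, d ≤ ff L B
  cost_par : ∀ B ⊆ W, ff L B % 2 = d % 2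
  root : tot (Arc.rd R) L = 2 * d

structure Red (R : Finset V) (L L' : Multiset (Arc G)) : Prop where
  E : (L.map Arc.E).sum = (L'.map Arc.E).sum
  deg : ∀ x ∈ R, tot (Arc.deg x) L = tot (Arc.deg x) L'

lemma Red.refl (R : Finset V) (L : Multiset (Arc G)) : Red R L L := ⟨rfl, fun _ _ => rfl⟩
lemma Red.trans {R : Finset V} {L M N : Multiset (Arc G)} (h : Red R L M) (h' : Red R M N) :
    Red R L N := ⟨h.E.trans h'.E, fun x hx => (h.deg x hx).trans (h'.deg x hx)⟩

lemma red_comp {R : Finset V} {x : V} {e f g : Arc G} {L : Multiset (Arc G)}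
    (h : Arc.IsComp x e f g) (hx : x ∉ R) : Red R (e ::ₘ f ::ₘ L) (g ::ₘ L) := by
  constructor
  · simp [h.E, add_assoc]
  · intro y hy
    have : x ≠ y := by rintro rfl; exact hx hy
    simp [h.deg_add y this, add_assoc]

lemma core_comp {R W : Finset V} {d : ℕ} {x : V} {e f g : Arc G} {L : Multiset (Arc G)}
    (hc : Core R W d (e ::ₘ f ::ₘ L)) (h : Arc.IsComp x e f g) (hx : x ∉ R)
    (hb : ∀ B ⊆ W, ff (e ::ₘ f ::ₘ L) B = d → e.cost B = 1 → f.cost B = 1 → False) :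
    Core R W d (g ::ₘ L) := by
  refine ⟨?_, hc.disj, ?_, ?_, ?_, ?_⟩
  · intro a ha
    rcases Multiset.mem_cons.1 ha with rfl | ha
    · have he := hc.ends e (by simp)
      have hf := hc.ends f (by simp)
      rw [h.u, h.w]
      unfold Arc.o
      constructor <;> split_ifs <;> tauto
    · exact hc.ends a (by simp [ha])
  · intro Y hY
    have h1 := hc.cutEven Y hY
    have h2 := h.cut_add Y
    simp only [dl, tot_cons] at *
    rw [Nat.even_iff] at *
    split_ifs at h2 <;> omega
  · intro B hB
    have h1 := hc.cost_ge B hB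
    have h2 := h.cost_add B
    have h3 := hc.cost_par B hB
    have h4 := hb B hB
    simp only [ff, tot_cons] at *
    split_ifs at h2 with h5
    · by_contra hlt
      exact h4 (by omega) h5.1 h5.2
    · omega
  · intro B hB
    have h2 := h.cost_add B
    have h3 := hc.cost_par B hB
    simp only [ff, tot_cons] at *
    split_ifs at h2 with h5 <;> omega
  · have h1 := hc.root
    have h2 := h.rd_add R hx
    simp only [tot_cons] at *
    omega

/-- uncrossing of two labelings -/
lemma uncross {B C : Finset V} {e : Arc G} {L : Multiset (Arc G)}
    (he : e ∈ L) (h1 : e.cost B = 1) (h2 : e.cost C = 1) :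
    dl L (symmDiff B C) + 2 ≤ ff L B + ff L C := by
  obtain ⟨L, rfl⟩ := Multiset.exists_cons_of_mem he
  have h3 := Arc.cost_symmDiff B C e
  have h4 := Arc.cut_le_one (symmDiff B C) e
  have h5 : tot (Arc.cut (symmDiff B C)) L ≤ tot (fun a => a.cost B + a.cost C) L := by
    apply tot_le
    intro a _
    have h3 := Arc.cost_symmDiff B C a
    have h4 := Arc.cut_le_one (symmDiff B C) a
    omega
  rw [tot_fadd] at h5
  simp only [dl, ff, tot_cons]
  omega


/-- elimination of one loop at `w` -/
lemma loop_step {R W : Finset V} {d : ℕ} {L : Multiset (Arc G)} (hd : 1 ≤ d)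
    (hc : Core R W d L) (hcut : ∀ Y ⊆ W, Y.Nonempty → 2 * d ≤ dl L Y)
    {w : V} (hw : w ∈ W) {l : Arc G} (hl : l ∈ L) (hu : l.u = w) (hw' : l.w = w) :
    ∃ L' : Multiset (Arc G), Multiset.card L' < Multiset.card L ∧ Core R W d L' ∧
      (∀ Y ⊆ W, Y.Nonempty → 2 * d ≤ dl L' Y) ∧ Red R L L' := by
  obtain ⟨L, rfl⟩ := Multiset.exists_cons_of_mem hl
  have hwR : w ∉ R := fun h => Finset.disjoint_left.1 hc.disj h hw
  have hsub : ({w} : Finset V) ⊆ W := by simpa using hw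
  have hl0 : ∀ Y, l.cut Y = 0 := by intro Y; simp [Arc.cut, hu, hw']
  have hlinc : l.inc w := Or.inl hu
  have key : ∃ f ∈ L, f.cut {w} = 1 ∧
      ∀ B ⊆ W, ff (l ::ₘ L) B = d → l.cost B = 1 → f.cost B = 1 → False := by
    by_contra hcon
    push Not at hcon
    have h1 : 0 < tot (Arc.cut {w}) L := by
      have := hcut {w} hsub (by simp)
      simp only [dl, tot_cons, hl0] at this
      omega
    obtain ⟨f0, hf0, hf0c⟩ := tot_pos h1
    obtain ⟨B, hB, hBd, hBl, hBf⟩ := hcon f0 hf0 (by have := f0.cut_le_one {w}; omega)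
    obtain ⟨f1, hf1, hf1c, hf1B⟩ : ∃ f ∈ L, f.cut {w} = 1 ∧ f.cost B = 0 := by
      by_contra hno
      push Not at hno
      have hB' : symmDiff B {w} ⊆ W := by
        intro y hy
        rcases Finset.mem_symmDiff.1 hy with h | h
        · exact hB h.1
        · exact hsub h.1
      have h2 := hc.cost_ge _ hB'
      have h3 : tot (fun a => a.cost (symmDiff B {w}) + a.cut {w}) (l ::ₘ L)
          ≤ tot (Arc.cost B) (l ::ₘ L) := by
        apply tot_le
        intro a ha
        have e1 := Arc.cost_symmDiff B (symmDiff B {w}) a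
        rw [symmDiff_symmDiff_cancel_left] at e1
        have e2 := a.cost_le_one B
        have e3 := a.cost_le_one (symmDiff B {w})
        have e4 := a.cut_le_one {w}
        rcases Multiset.mem_cons.1 ha with rfl | ha
        · have := hl0 {w}; omega
        · have := hno a ha
          omega
      rw [tot_fadd] at h3
      have h4 := hcut {w} hsub (by simp)
      simp only [dl, ff] at *
      omega
    obtain ⟨C, hC, hCd, hCl, hCf⟩ := hcon f1 hf1 hf1c
    have hne : (symmDiff B C).Nonempty := by
      rw [Finset.nonempty_iff_ne_empty]
      intro h
      have : B = C := by simpa using h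
      subst this
      omega
    have h5 := uncross (L := l ::ₘ L) (e := l) (by simp) hBl hCl
    have h6 := hcut (symmDiff B C) (by
      intro y hy
      rcases Finset.mem_symmDiff.1 hy with h | h
      · exact hB h.1
      · exact hC h.1) hne
    omega
  obtain ⟨f, hf, hfc, hbad⟩ := key
  obtain ⟨L, rfl⟩ := Multiset.exists_cons_of_mem hf
  obtain ⟨g, hg⟩ := Arc.exists_comp w l f hlinc ((Arc.cut_single w f).1 hfc).1
  refine ⟨g ::ₘ L, by simp, core_comp hc hg hwR hbad, ?_, red_comp hg hwR⟩
  intro Y hY hYn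
  have h1 := hcut Y hY hYn
  have h2 := hg.cut_add Y
  have h3 := hl0 Y
  simp only [dl, tot_cons] at *
  rw [if_neg (by omega)] at h2
  omega

lemma loop_elim {R W : Finset V} {d : ℕ} (hd : 1 ≤ d) {w : V} (hw : w ∈ W) (k : ℕ) :
    ∀ L : Multiset (Arc G), Multiset.card L ≤ k →
    Core R W d L → (∀ Y ⊆ W, Y.Nonempty → 2 * d ≤ dl L Y) →
    ∃ L' : Multiset (Arc G), Core R W d L' ∧
      (∀ Y ⊆ W, Y.Nonempty → 2 * d ≤ dl L' Y) ∧ Red R L L' ∧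
      ∀ a ∈ L', ¬ (a.u = w ∧ a.w = w) := by
  induction k with
  | zero =>
    intro L hL hc hcut
    refine ⟨L, hc, hcut, Red.refl _ _, ?_⟩
    have : L = 0 := by simpa using hL
    subst this
    simp
  | succ k ih =>
    intro L hL hc hcut
    by_cases h : ∀ a ∈ L, ¬ (a.u = w ∧ a.w = w)
    · exact ⟨L, hc, hcut, Red.refl _ _, h⟩
    · push Not at h
      obtain ⟨l, hl, hu, hw'⟩ := h
      obtain ⟨L1, h1, h2, h3, h4⟩ := loop_step hd hc hcut hw hl hu hw'
      obtain ⟨L2, g1, g2, g3, g4⟩ := ih L1 (by omega) h2 h3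
      exact ⟨L2, g1, g2, h4.trans g3, g4⟩

set_option maxHeartbeats 4000000 in
/-- splitting off one pair of arcs at `w` -/
lemma split_step {R T : Finset V} {d : ℕ} {w : V} {L : Multiset (Arc G)} (hd : 1 ≤ d) (hwT : w ∉ T)
    (hc : Core R (insert w T) d L)
    (hcut : ∀ Y ⊆ insert w T, Y.Nonempty → Y ≠ {w} → 2 * d ≤ dl L Y)
    (hnl : ∀ a ∈ L, ¬ (a.u = w ∧ a.w = w)) (hex : ∃ a ∈ L, a.inc w) :
    ∃ L' : Multiset (Arc G), Multiset.card L' < Multiset.card L ∧ Core R (insert w T) d L' ∧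
      (∀ Y ⊆ insert w T, Y.Nonempty → Y ≠ {w} → 2 * d ≤ dl L' Y) ∧ Red R L L' ∧
      ∀ a ∈ L', ¬ (a.u = w ∧ a.w = w) := by
  obtain ⟨e, heL, hew⟩ := hex
  have hwR : w ∉ R := fun h => Finset.disjoint_left.1 hc.disj h (by simp)
  have hoth : ∀ a ∈ L, a.inc w → a.o w ∈ R ∪ T ∧ a.o w ≠ w := by
    intro a ha hi
    have h1 := hc.ends a ha
    have h2 := hnl a ha
    have : a.o w ≠ w := by
      unfold Arc.o Arc.inc at *
      split_ifs <;> tauto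
    refine ⟨?_, this⟩
    have : (a.o w ∈ R ∨ a.o w ∈ insert w T) := by
      unfold Arc.o
      split_ifs <;> tauto
    simp only [Finset.mem_insert, Finset.mem_union] at *
    tauto
  have hinc1 : ∀ a ∈ L, a.inc w → a.cut {w} = 1 := fun a ha hi =>
    (Arc.cut_single w a).2 ⟨hi, (hoth a ha hi).2⟩
  -- complement cuts
  set D := R ∪ T with hD
  have hwD : w ∉ D := by simp [hD, hwR, hwT]
  have hcompl : ∀ Q ⊆ D, dl L (insert w (D \ Q)) = dl L Q := by
    intro Q hQ
    apply tot_congr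
    intro a ha
    have h1 := hc.ends a ha
    have hwQ : w ∉ Q := fun h => hwD (hQ h)
    have hmem : ∀ y, (y ∈ R ∨ y ∈ insert w T) → (y ∈ insert w (D \ Q) ↔ y ∉ Q) := by
      intro y hy
      simp only [Finset.mem_insert, Finset.mem_sdiff, hD, Finset.mem_union] at *
      constructor
      · rintro (rfl | h)
        · exact hwQ
        · exact h.2
      · tauto
    simp only [Arc.cut, hmem _ h1.1, hmem _ h1.2, not_iff_not]
  let valid : Finset V → Prop := fun Q =>
    Q ⊆ D ∧ Q.Nonempty ∧ Q ≠ D ∧ (Disjoint Q R ∨ R ⊆ Q)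
  have hval : ∀ Q, valid Q → 2 * d ≤ dl L Q := by
    rintro Q ⟨h1, h2, h3, h4 | h4⟩
    · apply hcut Q _ h2
      · rintro rfl; exact hwD (h1 (by simp))
      · intro y hy
        have := h1 hy
        have h5 := Finset.disjoint_left.1 h4 hy
        simp only [hD, Finset.mem_union, Finset.mem_insert] at *
        tauto
    · rw [← hcompl Q h1]
      apply hcut
      · intro y hy
        simp only [hD, Finset.mem_union, Finset.mem_insert, Finset.mem_sdiff] at *
        rcases hy with h | ⟨h | h, h'⟩
        · tauto
        · exact absurd (h4 h) h'
        · tauto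
      · simp
      · intro h
        apply h3
        apply Finset.Subset.antisymm h1
        intro y hy
        by_contra hyQ
        have : y ∈ insert w (D \ Q) := by simp [hy, hyQ]
        rw [h] at this
        simp only [Finset.mem_singleton] at this
        subst this
        exact hwD hy
  have hcompl_valid : ∀ Q, valid Q → valid (D \ Q) := by
    rintro Q ⟨h1, h2, h3, h4⟩
    refine ⟨Finset.sdiff_subset, ?_, ?_, ?_⟩
    · rw [Finset.sdiff_nonempty]
      exact fun h => h3 (Finset.Subset.antisymm h1 h)
    · intro h
      obtain ⟨y, hy⟩ := h2
      have := h1 hy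
      rw [← h] at this
      exact (Finset.mem_sdiff.1 this).2 hy
    · rcases h4 with h4 | h4
      · right
        intro y hy
        simp only [Finset.mem_sdiff, hD, Finset.mem_union]
        exact ⟨Or.inl hy, fun h => Finset.disjoint_left.1 h4 h hy⟩
      · left
        rw [Finset.disjoint_left]
        intro y hy hyR
        exact (Finset.mem_sdiff.1 hy).2 (h4 hyR)
  -- dangerous objects for `e`
  let dangQ : Finset V → Prop := fun Q => valid Q ∧ dl L Q = 2 * d ∧ e.o w ∈ Q
  let dangB : Finset V → Prop := fun B => B ⊆ insert w T ∧ ff L B = d ∧ e.cost B = 1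
  have hBuniq : ∀ B C, dangB B → dangB C → B = C := by
    rintro B C ⟨hB, hBd, hBe⟩ ⟨hC, hCd, hCe⟩
    by_contra hne
    have h5 := uncross heL hBe hCe
    have h6 := hcut (symmDiff B C) (by
      intro y hy
      rcases Finset.mem_symmDiff.1 hy with h | h
      · exact hB h.1
      · exact hC h.1) (by
      rw [Finset.nonempty_iff_ne_empty]
      intro h
      exact hne (by simpa using h)) (by
      intro h
      have h7 := Arc.cost_symmDiff B C e
      rw [h, hinc1 e heL hew] at h7
      omega)
    omega
  have hQmerge : ∀ P Q, dangQ P → dangQ Q → dangQ (P ∪ Q) := by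
    rintro P Q ⟨⟨p1, p2, p3, p4⟩, p5, p6⟩ ⟨⟨q1, q2, q3, q4⟩, q5, q6⟩
    have hI : valid (P ∩ Q) := by
      refine ⟨Finset.inter_subset_left.trans p1, ⟨_, Finset.mem_inter.2 ⟨p6, q6⟩⟩, ?_, ?_⟩
      · intro h
        exact p3 (Finset.Subset.antisymm p1 (h ▸ Finset.inter_subset_left))
      · rcases p4 with p4 | p4
        · exact Or.inl (p4.mono_left Finset.inter_subset_left)
        · rcases q4 with q4 | q4
          · exact Or.inl (q4.mono_left Finset.inter_subset_right)
          · exact Or.inr (Finset.subset_inter p4 q4)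
    by_cases hUD : P ∪ Q = D
    · exfalso
      have aux : ∀ P Q : Finset V, P ⊆ D → (Disjoint P R ∨ R ⊆ P) → (Disjoint Q R ∨ R ⊆ Q) →
          Q ⊆ D → Q.Nonempty → P ∪ Q = D → Q ≠ D → valid (P \ Q) := by
        intro P Q p1 p4 q4 q1 q2 hU q3
        refine ⟨Finset.sdiff_subset.trans p1, ?_, ?_, ?_⟩
        · rw [Finset.sdiff_nonempty]
          intro h
          rw [Finset.union_eq_right.2 h] at hU
          exact q3 hU
        · intro h
          obtain ⟨y, hy⟩ := q2
          have := q1 hy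
          rw [← h] at this
          exact (Finset.mem_sdiff.1 this).2 hy
        · rcases p4 with p4 | p4
          · exact Or.inl (p4.mono_left Finset.sdiff_subset)
          · rcases q4 with q4 | q4
            · right
              intro y hy
              exact Finset.mem_sdiff.2 ⟨p4 hy, fun h => Finset.disjoint_left.1 q4 h hy⟩
            · left
              rw [Finset.disjoint_left]
              intro y hy hyR
              exact (Finset.mem_sdiff.1 hy).2 (q4 hyR)
      have v1 := hval _ (aux P Q p1 p4 q4 q1 q2 hUD q3)
      have v2 := hval _ (aux Q P q1 q4 p4 p1 p2 (by rw [Finset.union_comm]; exact hUD) p3)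
      obtain ⟨L0, hL0⟩ := Multiset.exists_cons_of_mem heL
      have hle : tot (fun a => a.cut (P \ Q) + a.cut (Q \ P)) L0 ≤
          tot (fun a => a.cut P + a.cut Q) L0 := tot_le fun a _ => Arc.cut_sdiff_sdiff P Q a
      rw [tot_fadd, tot_fadd] at hle
      have hwP : w ∉ P := fun h => hwD (p1 h)
      have hwQ : w ∉ Q := fun h => hwD (q1 h)
      have c1 : e.cut P = 1 := by rw [Arc.cut_inc w e hew]; simp [hwP, p6]
      have c2 : e.cut Q = 1 := by rw [Arc.cut_inc w e hew]; simp [hwQ, q6]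
      have c3 : e.cut (P \ Q) = 0 := by rw [Arc.cut_inc w e hew]; simp [hwP, q6]
      have c4 : e.cut (Q \ P) = 0 := by rw [Arc.cut_inc w e hew]; simp [hwQ, p6]
      rw [hL0] at v1 v2 p5 q5
      simp only [dl, tot_cons] at *
      omega
    · have hU : valid (P ∪ Q) := by
        refine ⟨Finset.union_subset p1 q1, ⟨_, Finset.mem_union_left _ p6⟩, hUD, ?_⟩
        rcases p4 with p4 | p4
        · rcases q4 with q4 | q4
          · left; rw [Finset.disjoint_union_left]; exact ⟨p4, q4⟩
          · exact Or.inr (q4.trans Finset.subset_union_right)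
        · exact Or.inr (p4.trans Finset.subset_union_left)
      have v1 := hval _ hI
      have v2 := hval _ hU
      have hle : tot (fun a => a.cut (P ∪ Q) + a.cut (P ∩ Q)) L ≤
          tot (fun a => a.cut P + a.cut Q) L := tot_le fun a _ => Arc.cut_union_inter P Q a
      rw [tot_fadd, tot_fadd] at hle
      refine ⟨hU, ?_, Finset.mem_union_left _ p6⟩
      simp only [dl] at *
      omega
  -- the maximal dangerous set
  have hmax : ∃ M : Finset V, (M = ∅ ∨ dangQ M) ∧ ∀ Q, dangQ Q → Q ⊆ M := by
    have hcl : ∀ F : Finset (Finset V), (∀ Q ∈ F, dangQ Q) →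
        (F.sup id = ∅ ∨ dangQ (F.sup id)) := by
      intro F
      induction F using Finset.induction_on with
      | empty => intro _; left; rfl
      | insert A F hA ih =>
        intro h
        right
        rw [Finset.sup_insert]
        have hAd := h A (by simp)
        rcases ih (fun Q hQ => h Q (by simp [hQ])) with h0 | h0
        · rw [h0]; simpa using hAd
        · exact hQmerge _ _ hAd h0
    classical
    refine ⟨(D.powerset.filter dangQ).sup id, hcl _ (by simp), ?_⟩
    intro Q hQ
    exact Finset.le_sup (f := id) (by simp [hQ, hQ.1.1])
  obtain ⟨M, hM, hMmax⟩ := hmax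
  obtain ⟨L1, rfl⟩ := Multiset.exists_cons_of_mem heL
  have key : ∃ f ∈ L1, f.inc w ∧
      (∀ B ⊆ insert w T, ff (e ::ₘ L1) B = d → e.cost B = 1 → f.cost B = 1 → False) ∧
      f.o w ∉ M := by
    by_contra hno
    push Not at hno
    have hnoB : ∀ f ∈ L1, f.inc w → f.o w ∈ M ∨ ∃ B, dangB B ∧ f.cost B = 1 := by
      intro f hf hi
      by_cases hm : f.o w ∈ M
      · exact Or.inl hm
      · right
        by_contra hcon
        push Not at hcon
        exact hm (hno f hf hi fun B h1 h2 h3 h4 => hcon B ⟨h1, h2, h3⟩ h4)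
    have pm : M ⊆ D → ∀ a ∈ e ::ₘ L1, (a.inc w → a.cut (D \ M) + a.cut M = 1 ∧
        (a.cut M = 1 ↔ a.o w ∈ M)) ∧ (¬ a.inc w → a.cut (D \ M) = a.cut M) := by
      intro hMD a ha
      have hwM : w ∉ M := fun h => hwD (hMD h)
      constructor
      · intro hi
        have h1 := (hoth a ha hi).1
        rw [Arc.cut_inc w a hi, Arc.cut_inc w a hi]
        by_cases h2 : a.o w ∈ M <;> simp [hwM, hwD, h2, h1]
      · intro hi
        have h1 := hc.ends a ha
        simp only [Arc.inc, not_or] at hi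
        have hu : a.u ∈ D := by
          have := h1.1
          simp only [hD, Finset.mem_union, Finset.mem_insert] at *
          tauto
        have hw : a.w ∈ D := by
          have := h1.2
          simp only [hD, Finset.mem_union, Finset.mem_insert] at *
          tauto
        simp [Arc.cut, hu, hw, not_iff_not]
    have pb : ∀ B, ∀ a ∈ e ::ₘ L1, (a.inc w → a.cost (symmDiff B {w}) + a.cost B = 1) ∧
        (¬ a.inc w → a.cost (symmDiff B {w}) = a.cost B) := by
      intro B a ha
      have e1 := Arc.cost_symmDiff B (symmDiff B {w}) a
      rw [symmDiff_symmDiff_cancel_left] at e1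
      have e2 := a.cost_le_one B
      have e3 := a.cost_le_one (symmDiff B {w})
      have e4 := a.cut_le_one {w}
      constructor
      · intro hi
        have := hinc1 a ha hi
        omega
      · intro hi
        have : a.cut {w} ≠ 1 := fun h => hi ((Arc.cut_single w a).1 h).1
        omega
    have gb : ∀ B, dangB B → ff (e ::ₘ L1) B ≤ ff (e ::ₘ L1) (symmDiff B {w}) := by
      rintro B ⟨h1, h2, -⟩
      rw [h2]
      apply hc.cost_ge
      intro y hy
      rcases Finset.mem_symmDiff.1 hy with h | h
      · exact h1 h.1
      · rw [Finset.mem_singleton.1 h.1]; simp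
    have gm : dangQ M → dl (e ::ₘ L1) M ≤ dl (e ::ₘ L1) (D \ M) := by
      rintro ⟨h1, h2, -⟩
      rw [h2]
      exact hval _ (hcompl_valid _ h1)
    by_cases hB : ∃ B0, dangB B0
    · obtain ⟨B0, hB0⟩ := hB
      have gb0 := gb B0 hB0
      have pbe := (pb B0 e (by simp)).1 hew
      have hBe := hB0.2.2
      rcases hM with hM | hM
      · have : tot (Arc.cost (symmDiff B0 {w})) L1 ≤ tot (Arc.cost B0) L1 := by
          apply tot_le
          intro a ha
          have h1 := pb B0 a (by simp [ha])
          by_cases hi : a.inc w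
          · have h2 := h1.1 hi
            rcases hnoB a ha hi with h | ⟨B, h, h'⟩
            · simp [hM] at h
            · rw [hBuniq B B0 h hB0] at h'
              omega
          · exact (h1.2 hi).le
        simp only [ff, tot_cons] at gb0
        omega
      · have gm0 := gm hM
        have pme := (pm hM.1.1 e (by simp)).1 hew
        have hMe := pme.2.2 hM.2.2
        have : tot (fun a => Arc.cost (symmDiff B0 {w}) a + a.cut (D \ M)) L1 ≤
            tot (fun a => Arc.cost B0 a + a.cut M) L1 := by
          apply tot_le
          intro a ha
          have h1 := pb B0 a (by simp [ha])
          have g1 := pm hM.1.1 a (by simp [ha])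
          by_cases hi : a.inc w
          · have h2 := h1.1 hi
            have g2 := g1.1 hi
            rcases hnoB a ha hi with h | ⟨B, h, h'⟩
            · have := g2.2.2 h
              omega
            · rw [hBuniq B B0 h hB0] at h'
              omega
          · have h2 := h1.2 hi
            have g2 := g1.2 hi
            omega
        rw [tot_fadd, tot_fadd] at this
        simp only [ff, dl, tot_cons] at gb0 gm0
        omega
    · rcases hM with hM | hM
      · have h1 := hc.cutEven {w} (by simp)
        have h2 : tot (Arc.cut {w}) L1 = tot (fun _ => 0) L1 := by
          apply tot_congr
          intro a ha
          have : ¬ a.inc w := by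
            intro hi
            rcases hnoB a ha hi with h | ⟨B, h, h'⟩
            · simp [hM] at h
            · exact hB ⟨B, h⟩
          have h3 : a.cut {w} ≠ 1 := fun h => this ((Arc.cut_single w a).1 h).1
          have := a.cut_le_one {w}
          omega
        have h3 : tot (fun _ => 0) L1 = 0 := by simp [tot]
        rw [dl, tot_cons, h2, h3, hinc1 e (by simp) hew] at h1
        simp at h1
      · have gm0 := gm hM
        have pme := (pm hM.1.1 e (by simp)).1 hew
        have hMe := pme.2.2 hM.2.2
        have : tot (Arc.cut (D \ M)) L1 ≤ tot (Arc.cut M) L1 := by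
          apply tot_le
          intro a ha
          have g1 := pm hM.1.1 a (by simp [ha])
          by_cases hi : a.inc w
          · have g2 := g1.1 hi
            rcases hnoB a ha hi with h | ⟨B, h, h'⟩
            · have := g2.2.2 h
              omega
            · exact absurd ⟨B, h⟩ hB
          · exact (g1.2 hi).le
        simp only [dl, tot_cons] at gm0
        omega
  obtain ⟨f, hf, hfi, hfB, hfM⟩ := key
  obtain ⟨L2, rfl⟩ := Multiset.exists_cons_of_mem hf
  obtain ⟨g, hg⟩ := Arc.exists_comp w e f hew hfi
  refine ⟨g ::ₘ L2, by simp, core_comp hc hg hwR hfB, ?_, red_comp hg hwR, ?_⟩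
  · intro Y hY hYn hYw
    have h1 := hcut Y hY hYn hYw
    have h2 := hg.cut_add Y
    have h3 := hc.cutEven Y hY
    by_cases h4 : e.cut Y = 1 ∧ f.cut Y = 1
    · rw [if_pos h4] at h2
      have h5 : dl (e ::ₘ f ::ₘ L2) Y ≠ 2 * d := by
        intro h5
        obtain ⟨c1, c2⟩ := h4
        rw [Arc.cut_inc w e hew] at c1
        rw [Arc.cut_inc w f hfi] at c2
        have heo := hoth e (by simp) hew
        have hfo := hoth f (by simp) hfi
        by_cases hwY : w ∈ Y
        · have e1 : e.o w ∉ Y := by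
            intro h; simp [hwY, h] at c1
          have f1 : f.o w ∉ Y := by
            intro h; simp [hwY, h] at c2
          have hYeq : insert w (D \ (D \ Y)) = Y := by
            ext y
            simp only [Finset.mem_insert, Finset.mem_sdiff]
            constructor
            · rintro (rfl | ⟨a, b⟩)
              · exact hwY
              · tauto
            · intro hy
              have := hY hy
              simp only [hD, Finset.mem_insert, Finset.mem_union] at *
              tauto
          have hdQ : dangQ (D \ Y) := by
            refine ⟨⟨Finset.sdiff_subset, ⟨e.o w, Finset.mem_sdiff.2 ⟨heo.1, e1⟩⟩, ?_, ?_⟩, ?_, ?_⟩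
            · intro h
              rw [h] at hYeq
              simp at hYeq
              exact hYw hYeq.symm
            · right
              intro y hy
              refine Finset.mem_sdiff.2 ⟨by simp [hD, hy], fun h => ?_⟩
              exact Finset.disjoint_left.1 hc.disj hy (hY h)
            · rw [← hcompl _ Finset.sdiff_subset, hYeq]
              exact h5
            · exact Finset.mem_sdiff.2 ⟨heo.1, e1⟩
          exact hfM (hMmax _ hdQ (Finset.mem_sdiff.2 ⟨hfo.1, f1⟩))
        · have e1 : e.o w ∈ Y := by
            by_contra h; simp [hwY, h] at c1
          have f1 : f.o w ∈ Y := by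
            by_contra h; simp [hwY, h] at c2
          have hYT : Y ⊆ T := fun y hy => by
            rcases Finset.mem_insert.1 (hY hy) with rfl | h
            · exact absurd hy hwY
            · exact h
          have hYR : Disjoint Y R := (hc.disj.mono_right hY).symm
          by_cases hYD : Y = D
          · exfalso
            have hR : R = ∅ := by
              rw [Finset.eq_empty_iff_forall_notMem]
              intro y hy
              refine Finset.disjoint_left.1 hYR ?_ hy
              rw [hYD]
              simp [hD, hy]
            have h8 := hc.root
            have h9 : tot (Arc.rd R) (e ::ₘ f ::ₘ L2) = tot (fun _ => 0) (e ::ₘ f ::ₘ L2) := by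
              apply tot_congr
              intro a _
              simp [Arc.rd, hR]
            have h10 : tot (fun _ => 0) (e ::ₘ f ::ₘ L2) = 0 := by simp [tot]
            omega
          · have hdQ : dangQ Y := by
              refine ⟨⟨hYT.trans (by simp [hD]), hYn, hYD, Or.inl hYR⟩, h5, e1⟩
            exact hfM (hMmax _ hdQ f1)
      rw [Nat.even_iff] at h3
      simp only [dl, tot_cons] at *
      omega
    · rw [if_neg h4] at h2
      simp only [dl, tot_cons] at *
      omega
  · intro a ha
    rcases Multiset.mem_cons.1 ha with rfl | ha
    · rintro ⟨h, -⟩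
      rw [hg.u] at h
      exact (hoth e (by simp) hew).2 h
    · exact hnl a (by simp [ha])

lemma split_elim {R T : Finset V} {d : ℕ} (hd : 1 ≤ d) {w : V} (hwT : w ∉ T) (k : ℕ) :
    ∀ L : Multiset (Arc G), Multiset.card L ≤ k →
    Core R (insert w T) d L →
    (∀ Y ⊆ insert w T, Y.Nonempty → Y ≠ {w} → 2 * d ≤ dl L Y) →
    (∀ a ∈ L, ¬ (a.u = w ∧ a.w = w)) →
    ∃ L' : Multiset (Arc G), Core R (insert w T) d L' ∧
      (∀ Y ⊆ insert w T, Y.Nonempty → Y ≠ {w} → 2 * d ≤ dl L' Y) ∧ Red R L L' ∧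
      ∀ a ∈ L', ¬ a.inc w := by
  induction k with
  | zero =>
    intro L hL hc hcut _
    refine ⟨L, hc, hcut, Red.refl _ _, ?_⟩
    have : L = 0 := by simpa using hL
    subst this
    simp
  | succ k ih =>
    intro L hL hc hcut hnl
    by_cases h : ∀ a ∈ L, ¬ a.inc w
    · exact ⟨L, hc, hcut, Red.refl _ _, h⟩
    · push Not at h
      obtain ⟨L1, h1, h2, h3, h4, h5⟩ := split_step hd hwT hc hcut hnl h
      obtain ⟨L2, g1, g2, g3, g4⟩ := ih L1 (by omega) h2 h3 h5
      exact ⟨L2, g1, g2, h4.trans g3, g4⟩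

lemma tot_const (c : ℕ) (L : Multiset (Arc G)) : tot (fun _ => c) L = Multiset.card L * c := by
  simp [tot]

theorem reduce {R : Finset V} {d : ℕ} (hd : 1 ≤ d) (W : Finset V) :
    ∀ L : Multiset (Arc G), Core R W d L → (∀ Y ⊆ W, Y.Nonempty → 2 * d ≤ dl L Y) →
    ∃ L' : Multiset (Arc G), Red R L L' ∧ (∀ a ∈ L', a.u ∈ R ∧ a.w ∈ R) ∧
      Multiset.card L' = d ∧ ∀ a ∈ L', Odd a.n := by
  induction W using Finset.induction_on with
  | empty =>
    intro L hc _
    have hends : ∀ a ∈ L, a.u ∈ R ∧ a.w ∈ R := by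
      intro a ha
      simpa using hc.ends a ha
    have hcard : Multiset.card L = d := by
      have h1 := hc.root
      have h2 : tot (Arc.rd R) L = tot (fun _ => 2) L := by
        apply tot_congr
        intro a ha
        simp [Arc.rd, hends a ha]
      rw [h2, tot_const] at h1
      omega
    refine ⟨L, Red.refl _ _, hends, hcard, ?_⟩
    intro a ha
    by_contra hodd
    have h0 := hc.cost_ge ∅ (by simp)
    obtain ⟨L1, rfl⟩ := Multiset.exists_cons_of_mem ha
    have h1 : tot (Arc.cost ∅) L1 ≤ tot (fun _ => 1) L1 :=
      tot_le fun a _ => a.cost_le_one ∅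
    rw [tot_const] at h1
    have h2 : a.cost ∅ = 0 := by
      rw [Nat.not_odd_iff_even, Nat.even_iff] at hodd
      simp [Arc.cost, Arc.cut, hodd]
    simp only [ff, tot_cons, Multiset.card_cons] at *
    omega
  | insert w T hwT ih =>
    intro L hc hcut
    obtain ⟨L1, c1, k1, r1, n1⟩ := loop_elim hd (Finset.mem_insert_self w T) _ L le_rfl hc hcut
    obtain ⟨L2, c2, k2, r2, n2⟩ := split_elim hd hwT _ L1 le_rfl c1
      (fun Y h1 h2 _ => k1 Y h1 h2) n1
    have hsub : T ⊆ insert w T := Finset.subset_insert _ _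
    have c3 : Core R T d L2 := by
      refine ⟨?_, c2.disj.mono_right hsub, fun Y hY => c2.cutEven Y (hY.trans hsub),
        fun Y hY => c2.cost_ge Y (hY.trans hsub), fun Y hY => c2.cost_par Y (hY.trans hsub),
        c2.root⟩
      intro a ha
      have h1 := c2.ends a ha
      have h2 := n2 a ha
      simp only [Arc.inc, Finset.mem_insert] at *
      tauto
    obtain ⟨L', r3, h⟩ := ih L2 c3 (by
      intro Y hY hYn
      apply k2 Y (hY.trans hsub) hYn
      rintro rfl
      exact hwT (hY (by simp)))
    exact ⟨L', (r1.trans r2).trans r3, h⟩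

lemma sum_deg (Y : Finset V) (L : Multiset (Arc G)) :
    ∑ x ∈ Y, tot (Arc.deg x) L = tot (Arc.rd Y) L := by
  induction L using Multiset.induction_on with
  | empty => simp
  | cons a L ih =>
    simp only [tot_cons, Finset.sum_add_distrib, ih, Arc.deg, Arc.rd]
    simp [Finset.sum_ite_eq]

lemma tot_filter (φ : Arc G → ℕ) (p : Arc G → Prop) [DecidablePred p] (L : Multiset (Arc G)) :
    tot φ L = tot φ (L.filter p) + tot φ (L.filter fun a => ¬ p a) := by
  rw [← tot_add', Multiset.filter_add_not]

lemma tot_eq_zero {φ : Arc G → ℕ} {L : Multiset (Arc G)} (h : ∀ a ∈ L, φ a = 0) :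
    tot φ L = 0 := by
  rw [tot_congr h, tot_const]; simp

structure State (O : Finset V) (d : ℕ) (L : Multiset (Arc G)) : Prop where
  odd : Odd O.card
  ends : ∀ a ∈ L, a.u ∈ O ∧ a.w ∈ O
  oddn : ∀ a ∈ L, Odd a.n
  deg : ∀ x ∈ O, tot (Arc.deg x) L = 2 * d
  conn : ∀ Y ⊆ O, Y.Nonempty → Y ≠ O → 0 < dl L Y

lemma State.rd {O : Finset V} {d : ℕ} {L : Multiset (Arc G)} (h : State O d L)
    {Y : Finset V} (hY : Y ⊆ O) : tot (Arc.rd Y) L = 2 * (d * Y.card) := by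
  rw [← sum_deg, Finset.sum_congr rfl fun x hx => h.deg x (hY hx)]
  simp; ring

lemma State.even {O : Finset V} {d : ℕ} {L : Multiset (Arc G)} (h : State O d L)
    {Y : Finset V} (hY : Y ⊆ O) : Even (dl L Y) := by
  have h1 := h.rd hY
  have h2 : tot (Arc.rd Y) L = tot (fun a => a.cut Y +
      ((if a.u ∈ Y ∧ a.w ∈ Y then 1 else 0) + (if a.u ∈ Y ∧ a.w ∈ Y then 1 else 0))) L := by
    apply tot_congr
    intro a _
    by_cases h1 : a.u ∈ Y <;> by_cases h2 : a.w ∈ Y <;> simp [Arc.rd, Arc.cut, h1, h2]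
  rw [tot_fadd, tot_fadd] at h2
  rw [Nat.even_iff]
  simp only [dl]
  omega

lemma State.compl {O : Finset V} {d : ℕ} {L : Multiset (Arc G)} (h : State O d L)
    (Y : Finset V) : dl L (O \ Y) = dl L Y := by
  apply tot_congr
  intro a ha
  have := h.ends a ha
  simp [Arc.cut, this, not_iff_not]

lemma cut_aux1 {B Y : Finset V} (hB : B ⊆ Y) (a : Arc G) :
    a.cut B ≤ a.rd (Y \ B) + a.cut Y := by
  have g1 := @hB a.u
  have g2 := @hB a.w
  simp only [Arc.cut, Arc.rd, Finset.mem_sdiff]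
  by_cases h1 : a.u ∈ B <;> by_cases h2 : a.w ∈ B <;> by_cases h3 : a.u ∈ Y <;>
    by_cases h4 : a.w ∈ Y <;> simp [h1, h2, h3, h4] <;> tauto

lemma cut_aux2 {Z Y O : Finset V} (hZ : Z ⊆ O \ Y) (a : Arc G) (h : a.u ∈ Y ∨ a.w ∈ Y)
    (h' : a.u ∈ O ∧ a.w ∈ O) : a.cut Z + a.cut ((O \ Y) \ Z) ≤ a.cut Y := by
  have g1 : a.u ∈ Z → a.u ∉ Y := fun hh => (Finset.mem_sdiff.1 (hZ hh)).2
  have g2 : a.w ∈ Z → a.w ∉ Y := fun hh => (Finset.mem_sdiff.1 (hZ hh)).2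
  simp only [Arc.cut, Finset.mem_sdiff, h', true_and]
  by_cases h1 : a.u ∈ Z <;> by_cases h2 : a.w ∈ Z <;> by_cases h3 : a.u ∈ Y <;>
    by_cases h4 : a.w ∈ Y <;> simp [h1, h2, h3, h4] <;> tauto

set_option maxHeartbeats 4000000 in
lemma State.step {O : Finset V} {d : ℕ} {L : Multiset (Arc G)} (hd : 1 ≤ d) (h : State O d L)
    (hO : O.card ≠ 1) :
    ∃ (O' : Finset V) (L' : Multiset (Arc G)), O'.card < O.card ∧ State O' d L' ∧ (L.map Arc.E).sum = (L'.map Arc.E).sum := by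
  obtain ⟨x0, hx0⟩ : O.Nonempty := by
    rw [← Finset.card_pos]; exact h.odd.pos
  have hx0ne : ({x0} : Finset V) ≠ O := by
    rintro rfl
    simp at hO
  -- a minimum cut
  have hmin : ∃ Y ⊆ O, Y.Nonempty ∧ Y ≠ O ∧ ∀ Z ⊆ O, Z.Nonempty → Z ≠ O → dl L Y ≤ dl L Z := by
    obtain ⟨Y, hY, hYm⟩ := Finset.exists_min_image
      (O.powerset.filter fun Y => Y.Nonempty ∧ Y ≠ O) (fun Y => dl L Y)
      ⟨{x0}, by simp [hx0, hx0ne]⟩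
    simp only [Finset.mem_filter, Finset.mem_powerset] at hY hYm
    exact ⟨Y, hY.1, hY.2.1, hY.2.2, fun Z h1 h2 h3 => hYm Z ⟨h1, h2, h3⟩⟩
  have hmin' : ∃ Y ⊆ O, Y.Nonempty ∧ Y ≠ O ∧ Even Y.card ∧
      ∀ Z ⊆ O, Z.Nonempty → Z ≠ O → dl L Y ≤ dl L Z := by
    obtain ⟨Y, h1, h2, h3, h4⟩ := hmin
    by_cases hev : Even Y.card
    · exact ⟨Y, h1, h2, h3, hev, h4⟩
    · refine ⟨O \ Y, Finset.sdiff_subset, ?_, ?_, ?_, ?_⟩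
      · rw [Finset.sdiff_nonempty]
        exact fun hh => h3 (Finset.Subset.antisymm h1 hh)
      · intro hh
        obtain ⟨y, hy⟩ := h2
        have := h1 hy
        rw [← hh] at this
        exact (Finset.mem_sdiff.1 this).2 hy
      · rw [Finset.card_sdiff_of_subset h1]
        have := Finset.card_le_card h1
        have ho := h.odd
        rw [Nat.even_iff] at *
        rw [Nat.odd_iff] at ho
        omega
      · rw [h.compl]; exact h4
  obtain ⟨Y, hYO, hYn, hYne, hYev, hYmin⟩ := hmin'
  obtain ⟨m, hm⟩ := hYev
  obtain ⟨j, hj⟩ := h.even hYO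
  have hj1 : 1 ≤ j := by
    have := h.conn Y hYO hYn hYne
    omega
  have hjd : j ≤ d := by
    have h1 := hYmin {x0} (by simpa using hx0) (by simp) hx0ne
    have h2 := h.rd (Y := {x0}) (by simpa using hx0)
    have h3 : dl L {x0} ≤ tot (Arc.rd {x0}) L := by
      apply tot_le
      intro a _
      by_cases h1 : a.u = x0 <;> by_cases h2 : a.w = x0 <;> simp [Arc.rd, Arc.cut, h1, h2]
    simp only [Finset.card_singleton] at h2
    omega
  let p : Arc G → Prop := fun a => a.u ∈ Y ∨ a.w ∈ Y
  have : DecidablePred p := fun a => by unfold p; infer_instance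
  set LY := L.filter p with hLY
  set LR := L.filter (fun a => ¬ p a) with hLR
  have hLYp : ∀ a ∈ LY, a ∈ L ∧ (a.u ∈ Y ∨ a.w ∈ Y) := fun a ha => Multiset.mem_filter.1 ha
  have hLRp : ∀ a ∈ LR, a ∈ L ∧ a.u ∉ Y ∧ a.w ∉ Y := fun a ha => by
    have := Multiset.mem_filter.1 ha
    simp only [p] at this
    tauto
  have hsplit : ∀ φ : Arc G → ℕ, tot φ L = tot φ LY + tot φ LR := fun φ => tot_filter φ p L
  have hcutY : ∀ Z ⊆ Y, dl LY Z = dl L Z := by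
    intro Z hZ
    have h1 := hsplit (Arc.cut Z)
    have h2 : tot (Arc.cut Z) LR = 0 := by
      apply tot_eq_zero
      intro a ha
      have h3 := hLRp a ha
      have h4 : a.u ∉ Z := fun hh => h3.2.1 (hZ hh)
      have h5 : a.w ∉ Z := fun hh => h3.2.2 (hZ hh)
      simp [Arc.cut, h4, h5]
    simp only [dl]
    omega
  have hcardY : Multiset.card LY = d * Y.card + j := by
    have h1 := h.rd hYO
    have h2 : tot (Arc.rd Y) LR = 0 := by
      apply tot_eq_zero
      intro a ha
      have h3 := hLRp a ha
      simp [Arc.rd, h3]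
    have h3 : tot (fun a => a.rd Y + a.cut Y) LY = tot (fun _ => 2) LY := by
      apply tot_congr
      intro a ha
      have h3 := hLYp a ha
      by_cases h1 : a.u ∈ Y <;> by_cases h2 : a.w ∈ Y <;> simp [Arc.rd, Arc.cut, h1, h2]
      tauto
    rw [tot_const, tot_fadd] at h3
    have h4 := hcutY Y (Finset.Subset.refl _)
    rw [hsplit] at h1
    simp only [dl] at *
    omega
  have hff : ∀ B ⊆ Y, ff LY B + dl L B = d * Y.card + j := by
    intro B hB
    rw [← hcutY B hB, ← hcardY]
    simp only [ff, dl]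
    rw [← tot_fadd, tot_congr (ψ := fun _ => 1), tot_const, mul_one]
    intro a ha
    have h1 := h.oddn a (hLYp a ha).1
    have h2 := a.cut_le_one B
    rw [Nat.odd_iff] at h1
    simp only [Arc.cost]
    omega
  have hcore : Core (O \ Y) Y j LY := by
    refine ⟨?_, Finset.sdiff_disjoint, ?_, ?_, ?_, ?_⟩
    · intro a ha
      have h1 := h.ends a (hLYp a ha).1
      simp only [Finset.mem_sdiff]
      tauto
    · intro Z hZ
      rw [hcutY Z hZ]
      exact h.even (hZ.trans hYO)
    · intro B hB
      have h1 := hff B hB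
      have h2 := h.rd (hB.trans hYO)
      have h3 := h.rd (Y := Y \ B) (Finset.sdiff_subset.trans hYO)
      have h4 : dl L B ≤ tot (Arc.rd B) L := by
        apply tot_le
        intro a _
        by_cases h1 : a.u ∈ B <;> by_cases h2 : a.w ∈ B <;> simp [Arc.rd, Arc.cut, h1, h2]
      have h5 : dl L B ≤ tot (fun a => a.rd (Y \ B) + a.cut Y) L := by
        apply tot_le
        intro a _
        exact cut_aux1 hB a
      rw [tot_fadd] at h5
      have h6 : (Y \ B).card + B.card = Y.card := Finset.card_sdiff_add_card_eq_card hB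
      rcases Nat.lt_or_ge m B.card with hlt | hge
      · have h7 : (Y \ B).card + 1 ≤ m := by omega
        have h8 : d * ((Y \ B).card + 1) ≤ d * m := Nat.mul_le_mul_left _ h7
        rw [hm, mul_add] at h1
        rw [mul_add] at h8
        simp only [dl] at *
        omega
      · have h8 : d * B.card ≤ d * m := Nat.mul_le_mul_left _ hge
        rw [hm, mul_add] at h1
        simp only [dl] at *
        omega
    · intro B hB
      have h1 := hff B hB
      have h2 := h.even (hB.trans hYO)
      rw [Nat.even_iff] at h2
      rw [hm, mul_add] at h1
      omega
    · have h1 : tot (Arc.rd (O \ Y)) LY = tot (Arc.cut Y) LY := by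
        apply tot_congr
        intro a ha
        have h3 := hLYp a ha
        have h4 := h.ends a h3.1
        by_cases h1 : a.u ∈ Y <;> by_cases h2 : a.w ∈ Y <;> simp [Arc.rd, Arc.cut, h1, h2, h4]
        tauto
      have h2 := hcutY Y (Finset.Subset.refl _)
      simp only [dl] at *
      omega
  obtain ⟨L', hred, hends, -, hoddn⟩ := reduce hj1 Y LY hcore (by
    intro Z hZ hZn
    rw [hcutY Z hZ]
    have := hYmin Z (hZ.trans hYO) hZn (by
      rintro rfl
      exact hYne (Finset.Subset.antisymm hYO hZ))
    omega)
  refine ⟨O \ Y, LR + L', ?_, ⟨?_, ?_, ?_, ?_, ?_⟩, ?_⟩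
  · apply Finset.card_lt_card
    refine ⟨Finset.sdiff_subset, fun hh => ?_⟩
    obtain ⟨y, hy⟩ := hYn
    exact (Finset.mem_sdiff.1 (hh (hYO hy))).2 hy
  · rw [Finset.card_sdiff_of_subset hYO]
    have := Finset.card_le_card hYO
    have ho := h.odd
    rw [Nat.odd_iff] at *
    omega
  · intro a ha
    rcases Multiset.mem_add.1 ha with ha | ha
    · have h1 := hLRp a ha
      have h2 := h.ends a h1.1
      simp only [Finset.mem_sdiff]
      tauto
    · exact hends a ha
  · intro a ha
    rcases Multiset.mem_add.1 ha with ha | ha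
    · exact h.oddn a (hLRp a ha).1
    · exact hoddn a ha
  · intro x hx
    have h1 := h.deg x (Finset.mem_sdiff.1 hx).1
    have h2 := hred.deg x hx
    rw [hsplit] at h1
    rw [tot_add']
    omega
  · intro Z hZ hZn hZne
    by_contra h0
    have h1 : dl LR Z = 0 := by
      simp only [dl, tot_add'] at *
      omega
    have h2 : dl LR ((O \ Y) \ Z) = 0 := by
      rw [← h1]
      apply tot_congr
      intro a ha
      have h3 := hLRp a ha
      have h4 := h.ends a h3.1
      simp [Arc.cut, h3, h4, not_iff_not]
    have hZ2 : ((O \ Y) \ Z).Nonempty := by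
      rw [Finset.sdiff_nonempty]
      exact fun hh => hZne (Finset.Subset.antisymm hZ hh)
    obtain ⟨y, hy⟩ := hYn
    have m1 := hYmin Z (hZ.trans Finset.sdiff_subset) hZn (by
      rintro rfl
      exact (Finset.mem_sdiff.1 (hZ (hYO hy))).2 hy)
    have m2 := hYmin ((O \ Y) \ Z) (Finset.sdiff_subset.trans Finset.sdiff_subset) hZ2 (by
      intro hh
      have := hYO hy
      rw [← hh] at this
      simp only [Finset.mem_sdiff] at this
      tauto)
    have h5 : tot (fun a => a.cut Z + a.cut ((O \ Y) \ Z)) LY ≤ tot (Arc.cut Y) LY := by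
      apply tot_le
      intro a ha
      have h3 := hLYp a ha
      have h4 := h.ends a h3.1
      exact cut_aux2 hZ a h3.2 h4
    rw [tot_fadd] at h5
    have h6 := hsplit (Arc.cut Z)
    have h7 := hsplit (Arc.cut ((O \ Y) \ Z))
    have h8 := hcutY Y (Finset.Subset.refl _)
    simp only [dl] at *
    omega
  · rw [Multiset.map_add, Multiset.sum_add, ← hred.E]
    conv_lhs => rw [← Multiset.filter_add_not p L, Multiset.map_add, Multiset.sum_add]
    rw [add_comm]

theorem State.final {d : ℕ} (hd : 1 ≤ d) (k : ℕ) : ∀ (O : Finset V) (L : Multiset (Arc G)),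
    O.card ≤ k → State O d L → ∃ (v : V) (L' : Multiset (Arc G)), Multiset.card L' = d ∧
      (∀ a ∈ L', a.u = v ∧ a.w = v ∧ Odd a.n) ∧ (L.map Arc.E).sum = (L'.map Arc.E).sum := by
  induction k with
  | zero =>
    intro O L hO h
    have := h.odd.pos
    omega
  | succ k ih =>
    intro O L hO h
    by_cases h1 : O.card = 1
    · obtain ⟨v, rfl⟩ := Finset.card_eq_one.1 h1
      have hends : ∀ a ∈ L, a.u = v ∧ a.w = v := by
        intro a ha
        simpa using h.ends a ha
      refine ⟨v, L, ?_, fun a ha => ⟨(hends a ha).1, (hends a ha).2, h.oddn a ha⟩, rfl⟩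
      have h2 := h.deg v (by simp)
      have h3 : tot (Arc.deg v) L = tot (fun _ => 2) L := by
        apply tot_congr
        intro a ha
        simp [Arc.deg, hends a ha]
      rw [h3, tot_const] at h2
      omega
    · obtain ⟨O', L', g1, g2, g3⟩ := h.step hd h1
      obtain ⟨v, L'', f1, f2, f3⟩ := ih O' L' (by omega) g2
      exact ⟨v, L'', f1, f2, g3.trans f3⟩

lemma exists_arc (e : Sym2 V) (he : e ∈ G.edgeSet) :
    ∃ a : Arc G, a.E = {e} ∧ s(a.u, a.w) = e := by
  induction e using Sym2.ind with
  | _ x y =>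
    have h : G.Adj x y := he
    exact ⟨⟨x, y, h.toWalk⟩, by simp [Arc.E], rfl⟩

lemma exists_initial [Fintype V] (hconn : G.Connected)
    (hreg : ∀ v : V, (G.neighborSet v).ncard = 6) (hodd : Odd (Fintype.card V)) :
    ∃ (F : Finset (Sym2 V)) (L : Multiset (Arc G)), (∀ e, e ∈ F ↔ e ∈ G.edgeSet) ∧
      State Finset.univ 3 L ∧ (L.map Arc.E).sum = F.val := by
  classical
  choose arc hE hs using fun e : {e // e ∈ G.edgeFinset} =>
    exists_arc (G := G) e.1 (mem_edgeFinset.1 e.2)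
  have htot : ∀ φ : Arc G → ℕ, tot φ (G.edgeFinset.attach.val.map arc) =
      ∑ e ∈ G.edgeFinset.attach, φ (arc e) := by
    intro φ
    simp [tot, Finset.sum]
  refine ⟨G.edgeFinset, G.edgeFinset.attach.val.map arc, by simp, ⟨?_, ?_, ?_, ?_, ?_⟩, ?_⟩
  · simpa using hodd
  · simp
  · intro a ha
    obtain ⟨e, -, rfl⟩ := Multiset.mem_map.1 ha
    simp [Arc.n, hE]
  · intro x _
    rw [htot]
    have h1 : ∀ e ∈ G.edgeFinset.attach, Arc.deg x (arc e) =
        (fun e : Sym2 V => if x ∈ e then 1 else 0) e.1 := by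
      intro e _
      have hne : (arc e).u ≠ (arc e).w := by
        have h2 : s((arc e).u, (arc e).w) ∈ G.edgeSet := by
          rw [hs]; exact mem_edgeFinset.1 e.2
        exact G.ne_of_adj h2
      simp only
      rw [← hs e]
      simp only [Arc.deg, Sym2.mem_iff]
      by_cases h3 : (arc e).u = x <;> by_cases h4 : (arc e).w = x
      · exact absurd (h3.trans h4.symm) hne
      · simp [h3, h4]
      · simp [h3, h4]
      · simp [h3, h4, Ne.symm h3, Ne.symm h4]
    rw [Finset.sum_congr rfl h1, Finset.sum_attach G.edgeFinset
      (fun e : Sym2 V => if x ∈ e then 1 else 0), ← Finset.card_filter,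
      ← incidenceFinset_eq_filter, card_incidenceFinset_eq_degree, ← card_neighborSet_eq_degree]
    rw [← Nat.card_eq_fintype_card, Nat.card_coe_set_eq, hreg]
  · intro Y _ hYn hYne
    obtain ⟨x, hx⟩ := hYn
    obtain ⟨y, hy⟩ : ∃ y, y ∉ Y := by
      by_contra hcon
      push Not at hcon
      exact hYne (Finset.eq_univ_iff_forall.2 hcon)
    obtain ⟨p⟩ := hconn.preconnected x y
    obtain ⟨d, -, h1, h2⟩ := p.exists_boundary_dart (Y : Set V) hx hy
    have he : s(d.fst, d.snd) ∈ G.edgeFinset := mem_edgeFinset.2 d.adj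
    have hmem : arc ⟨_, he⟩ ∈ G.edgeFinset.attach.val.map arc :=
      Multiset.mem_map.2 ⟨⟨_, he⟩, Finset.mem_attach _ _, rfl⟩
    have hcut : (arc ⟨_, he⟩).cut Y = 1 := by
      have h3 := hs ⟨_, he⟩
      simp only [Sym2.eq_iff] at h3
      simp only [Finset.mem_coe] at h1 h2
      rcases h3 with ⟨h3, h4⟩ | ⟨h3, h4⟩ <;> simp [Arc.cut, h3, h4, h1, h2]
    obtain ⟨L1, hL1⟩ := Multiset.exists_cons_of_mem hmem
    rw [hL1, dl, tot_cons, hcut]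
    omega
  · rw [Multiset.map_map]
    have : (G.edgeFinset.attach.val.map (Arc.E ∘ arc)).sum =
        ∑ e ∈ G.edgeFinset.attach, (fun e : Sym2 V => ({e} : Multiset (Sym2 V))) e.1 := by
      rw [Finset.sum]
      congr 1
      apply Multiset.map_congr rfl
      intro e _
      simp [hE]
    rw [this, Finset.sum_attach G.edgeFinset (fun e : Sym2 V => ({e} : Multiset (Sym2 V))),
      Finset.sum_multiset_singleton]

lemma euler_of_trail {v : V} (q : G.Walk v v) (hq : q.edges.Nodup) :
    IsEulerianSubgraph G q.toSubgraph := by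
  refine ⟨q.toSubgraph_connected, ?_⟩
  intro x _
  have ht : q.IsTrail := ⟨hq⟩
  have h1 := (ht.even_countP_edges_iff x).2 (by simp)
  have h2 : (q.toSubgraph.neighborSet x).ncard = q.edges.countP fun e => x ∈ e := by
    have h3 : (fun y => s(x, y)) '' (q.toSubgraph.neighborSet x) =
        ((q.edges.toFinset.filter fun e => x ∈ e : Finset (Sym2 V)) : Set (Sym2 V)) := by
      ext e
      simp only [Set.mem_image, Subgraph.mem_neighborSet, Walk.adj_toSubgraph_iff_mem_edges,
        Finset.coe_filter, List.mem_toFinset, Set.mem_ofPred_eq]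
      constructor
      · rintro ⟨y, hy, rfl⟩
        exact ⟨hy, by simp⟩
      · rintro ⟨he, hx⟩
        obtain ⟨y, rfl⟩ := hx
        exact ⟨y, he, rfl⟩
    have hinj : Function.Injective fun y : V => s(x, y) := by
      intro y z h
      exact Sym2.congr_right.1 h
    rw [← Set.ncard_image_of_injective _ hinj, h3, Set.ncard_coe_finset]
    rw [List.countP_eq_length_filter, ← List.toFinset_card_of_nodup (hq.filter _),
      List.toFinset_filter]
    simp
  rw [h2]
  exact h1

lemma ncard_edges {v : V} (q : G.Walk v v) (hq : q.edges.Nodup) :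
    q.toSubgraph.edgeSet.ncard = q.edges.length := by
  have : q.toSubgraph.edgeSet = (q.edges.toFinset : Set (Sym2 V)) := by
    ext e
    simp
  rw [this, Set.ncard_coe_finset, List.toFinset_card_of_nodup hq]

lemma arc_sub {v : V} (a : Arc G) (hu : a.u = v) (hw : a.w = v) (hn : Odd a.n) (hE : a.E.Nodup) :
    ∃ H : G.Subgraph, IsEulerianSubgraph G H ∧ Odd H.edgeSet.ncard ∧
      (∀ e, e ∈ H.edgeSet ↔ e ∈ a.E) ∧ v ∈ H.verts := by
  obtain ⟨u, w, q⟩ := a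
  simp only at hu hw
  subst hu
  subst hw
  have hq : q.edges.Nodup := by simpa [Arc.E] using hE
  refine ⟨q.toSubgraph, euler_of_trail q hq, ?_, ?_, by simp⟩
  · rw [ncard_edges q hq]
    simpa [Arc.n, Arc.E] using hn
  · intro e
    simp [Arc.E]

lemma rooted_of_three {v : V} {F : Finset (Sym2 V)} (hF : ∀ e, e ∈ F ↔ e ∈ G.edgeSet)
    (a : Fin 3 → Arc G) (ha : ∀ i, (a i).u = v ∧ (a i).w = v ∧ Odd (a i).n)
    (hE : F.val = (a 0).E + ((a 1).E + (a 2).E)) :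
    ∃ D : Fin 3 → G.Subgraph, IsRootedKOddDecomposition G 3 D := by
  have hnd := F.nodup
  rw [hE, Multiset.nodup_add, Multiset.nodup_add, Multiset.disjoint_add_right] at hnd
  obtain ⟨n0, ⟨n1, n2, d12⟩, d01, d02⟩ := hnd
  have hn : ∀ i, (a i).E.Nodup := by
    intro i
    fin_cases i <;> assumption
  choose D h1 h2 h3 h4 using fun i => arc_sub (a i) (ha i).1 (ha i).2.1 (ha i).2.2 (hn i)
  have hdis : ∀ i j, i ≠ j → Disjoint (a i).E (a j).E := by
    intro i j hij
    fin_cases i <;> fin_cases j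
    · exact absurd rfl hij
    · exact d01
    · exact d02
    · exact d01.symm
    · exact absurd rfl hij
    · exact d12
    · exact d02.symm
    · exact d12.symm
    · exact absurd rfl hij
  refine ⟨D, ⟨h1, h2, ?_, ?_⟩, v, h4⟩
  · intro i j hij
    rw [Set.disjoint_left]
    intro e he he'
    exact Multiset.disjoint_left.1 (hdis i j hij) ((h3 i e).1 he) ((h3 j e).1 he')
  · ext e
    rw [← hF e, ← Finset.mem_val, hE]
    simp only [Set.mem_iUnion, h3, Multiset.mem_add]
    constructor
    · rintro ⟨i, hi⟩
      fin_cases i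
      · exact Or.inl hi
      · exact Or.inr (Or.inl hi)
      · exact Or.inr (Or.inr hi)
    · rintro (h | h | h)
      · exact ⟨0, h⟩
      · exact ⟨1, h⟩
      · exact ⟨2, h⟩

end OddDec

/-- Theorem 2: every connected 6-regular graph of odd order has a rooted
decomposition into three odd closed trails. -/
theorem sixRegular_oddOrder_rooted3OddDecomposition {V : Type*} [Fintype V]
    (G : SimpleGraph V) (hconn : G.Connected)
    (hreg : ∀ v : V, (G.neighborSet v).ncard = 6)
    (hodd : Odd (Fintype.card V)) :
    ∃ D : Fin 3 → G.Subgraph, IsRootedKOddDecomposition G 3 D := by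
  classical
  obtain ⟨F, L, hF, hst, hE⟩ := OddDec.exists_initial hconn hreg hodd
  obtain ⟨v, L', hcard, hL', hE'⟩ := hst.final (by norm_num) _ _ _ le_rfl
  obtain ⟨a, b, c, rfl⟩ := Multiset.card_eq_three.1 hcard
  refine OddDec.rooted_of_three hF ![a, b, c] (v := v) ?_ ?_
  · intro i
    fin_cases i
    · exact hL' a (by simp)
    · exact hL' b (by simp)
    · exact hL' c (by simp)
  · rw [← hE, hE']
    simp
end

section
/- Let G be a finite 6-edge-connected 6-regular simple graph equipped with a signature (each edge signed +1 or −1) such that the number of negative edges is odd and G contains two edge-disjoint unbalanced circuits. Then G admits a rooted signed 3-odd decomposition, i.e., a partition of its edge set into the edge sets of three eulerian subgraphs, each containing an odd number of negative edges, all three sharing a common vertex. -/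
open SimpleGraph

/-- A graph is `k`-edge-connected if it is connected and stays connected after
deleting any set of fewer than `k` edges. -/
def KEdgeConnected {V : Type*} (G : SimpleGraph V) (k : ℕ) : Prop :=
  G.Connected ∧ ∀ S : Set (Sym2 V), S.ncard < k → (G.deleteEdges S).Connected

/-- `G`, with signature `σ`, contains `k` pairwise edge-disjoint unbalanced circuits:
cycles carrying an odd number of negative (sign `-1`) edges. -/
def HasKEdgeDisjointUnbalancedCircuits {V : Type*} (G : SimpleGraph V)
    (σ : Sym2 V → ℤ) (k : ℕ) : Prop :=
  ∃ (u : Fin k → V) (c : (i : Fin k) → G.Walk (u i) (u i)),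
    (∀ i, (c i).IsCycle) ∧
    (∀ i, Odd ((c i).edges.countP (fun e => decide (σ e = -1)))) ∧
    (∀ i j, i ≠ j → ∀ e, e ∈ (c i).edges → e ∉ (c j).edges)

/-- A rooted signed `3`-odd decomposition of `(G, σ)`: a partition of the edge set of
`G` into the edge sets of three eulerian subgraphs, each having an odd number of
negative edges, all sharing a common vertex. -/
def IsRootedSigned3OddDecomposition {V : Type*} (G : SimpleGraph V)
    (σ : Sym2 V → ℤ) (D : Fin 3 → G.Subgraph) : Prop :=
  (∀ i, IsEulerianSubgraph G (D i)) ∧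
  (∀ i, Odd {e ∈ (D i).edgeSet | σ e = -1}.ncard) ∧
  (∀ i j, i ≠ j → Disjoint ((D i).edgeSet) ((D j).edgeSet)) ∧
  (⋃ i, (D i).edgeSet) = G.edgeSet ∧
  ∃ v : V, ∀ i, v ∈ (D i).verts


namespace SixReg

open Classical

/-- A signed multigraph: a finite set of alive edges, with two ends and a sign each. -/
structure MG (V E : Type*) where
  es : Finset E
  x : E → V
  y : E → V
  s : E → ZMod 2

variable {V E : Type*}

/-- `1` if the edge `e` crosses the vertex set `S`, else `0`. -/
noncomputable def MG.cn (M : MG V E) (S : Finset V) (e : E) : ℕ :=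
  if (M.x e ∈ S ↔ M.y e ∈ S) then 0 else 1

/-- The size of the cut of `S`. -/
noncomputable def MG.d (M : MG V E) (S : Finset V) : ℕ := ∑ e ∈ M.es, M.cn S e

/-- Split off the pair `f = aw`, `g = bw`, replacing it with `f = ab`. -/
noncomputable def MG.split (M : MG V E) (f g : E) (a b : V) : MG V E where
  es := M.es.erase g
  x := Function.update M.x f a
  y := Function.update M.y f b
  s := Function.update M.s f (M.s f + M.s g)

def MG.IsEnds (M : MG V E) (f : E) (a w : V) : Prop :=
  (M.x f = a ∧ M.y f = w) ∨ (M.x f = w ∧ M.y f = a)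

def Step (w : V) (M M' : MG V E) : Prop :=
  ∃ f g a b, f ∈ M.es ∧ g ∈ M.es ∧ f ≠ g ∧ M.IsEnds f a w ∧ M.IsEnds g b w ∧
    a ≠ b ∧ a ≠ w ∧ b ≠ w ∧ M' = M.split f g a b

/-- Switching. -/
def MG.sw (M : MG V E) (t : V → ZMod 2) : MG V E where
  es := M.es
  x := M.x
  y := M.y
  s := fun e => M.s e + (t (M.x e) + t (M.y e))

def Rooted (M : MG V E) : Prop :=
  ∃ (v : V) (c : E → Fin 3), ∀ i,
    (∀ t : V → ZMod 2, ∑ e ∈ M.es, (if c e = i then t (M.x e) + t (M.y e) else 0) = 0) ∧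
    (∑ e ∈ M.es, (if c e = i then M.s e else 0) = 1) ∧
    (∀ S : Finset V, v ∈ S → (∀ e ∈ M.es, c e = i → (M.x e ∈ S ↔ M.y e ∈ S)) →
      ∀ e ∈ M.es, c e = i → M.x e ∈ S ∧ M.y e ∈ S)

def NotSingle (M : MG V E) : Prop :=
  ∀ t : V → ZMod 2, ∀ e₀ ∈ M.es,
    ¬ ∀ e ∈ M.es, M.s e + (t (M.x e) + t (M.y e)) = if e = e₀ then 1 else 0

structure Good (A : Finset V) (M : MG V E) : Prop where
  mem : ∀ e ∈ M.es, M.x e ∈ A ∧ M.y e ∈ A ∧ M.x e ≠ M.y e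
  deg : ∀ v ∈ A, M.d {v} = 6
  cut : ∀ S ⊆ A, S.Nonempty → S ≠ A → 6 ≤ M.d S

structure Semi (A : Finset V) (w : V) (M : MG V E) (k : ℕ) : Prop where
  wA : w ∉ A
  mem : ∀ e ∈ M.es, M.x e ∈ insert w A ∧ M.y e ∈ insert w A ∧ M.x e ≠ M.y e
  deg : ∀ v ∈ A, M.d {v} = 6
  degw : M.d {w} = 2 * k
  cut : ∀ S ⊆ A, S.Nonempty → S ≠ A → 6 ≤ M.d S

lemma sum_split {R : Type*} [AddCommMonoid R] {es : Finset E} {f g : E} (F F' : E → R) (c : R)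
    (hf : f ∈ es) (hg : g ∈ es) (hne : f ≠ g) (h : F' f + c = F f + F g)
    (h' : ∀ e, e ≠ f → e ≠ g → F' e = F e) :
    ∑ e ∈ es.erase g, F' e + c = ∑ e ∈ es, F e := by
  have hf' : f ∈ es.erase g := Finset.mem_erase.2 ⟨hne, hf⟩
  rw [← Finset.add_sum_erase es F hg, ← Finset.add_sum_erase _ F hf',
    ← Finset.add_sum_erase _ F' hf']
  have : ∑ e ∈ (es.erase g).erase f, F' e = ∑ e ∈ (es.erase g).erase f, F e := by
    apply Finset.sum_congr rfl
    intro e he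
    simp only [Finset.mem_erase] at he
    exact h' e he.1 he.2.1
  rw [this, add_right_comm, h, add_comm (F f), add_assoc]

lemma sum_split0 {R : Type*} [AddCommMonoid R] {es : Finset E} {f g : E} (F F' : E → R)
    (hf : f ∈ es) (hg : g ∈ es) (hne : f ≠ g) (h : F' f = F f + F g)
    (h' : ∀ e, e ≠ f → e ≠ g → F' e = F e) :
    ∑ e ∈ es.erase g, F' e = ∑ e ∈ es, F e := by
  have := sum_split F F' 0 hf hg hne (by simpa using h) h'
  simpa using this

lemma cn_split_of_ne (M : MG V E) (f g : E) (a b : V) (S : Finset V) (e : E) (h : e ≠ f) :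
    (M.split f g a b).cn S e = M.cn S e := by
  simp [MG.cn, MG.split, h]

lemma d_split (M : MG V E) {f g : E} {a b w : V} (hf : f ∈ M.es) (hg : g ∈ M.es) (hne : f ≠ g)
    (ha : M.IsEnds f a w) (hb : M.IsEnds g b w) (S : Finset V) (hw : w ∉ S) :
    (M.split f g a b).d S + (if a ∈ S ∧ b ∈ S then 2 else 0) = M.d S := by
  unfold MG.d
  apply sum_split (M.cn S) _ _ hf hg hne _ (fun e h _ => cn_split_of_ne M f g a b S e h)
  have h1 : M.cn S f = if a ∈ S then 1 else 0 := by
    rcases ha with ⟨h1, h2⟩ | ⟨h1, h2⟩ <;> simp [MG.cn, h1, h2, hw]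
  have h2 : M.cn S g = if b ∈ S then 1 else 0 := by
    rcases hb with ⟨h1, h2⟩ | ⟨h1, h2⟩ <;> simp [MG.cn, h1, h2, hw]
  rw [h1, h2]
  simp only [MG.cn, MG.split, Function.update_self]
  by_cases p : a ∈ S <;> by_cases q : b ∈ S <;> simp [p, q]

lemma d_split_w (M : MG V E) {f g : E} {a b w : V} (hf : f ∈ M.es) (hg : g ∈ M.es) (hne : f ≠ g)
    (ha : M.IsEnds f a w) (hb : M.IsEnds g b w) (haw : a ≠ w) (hbw : b ≠ w) :
    (M.split f g a b).d {w} + 2 = M.d {w} := by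
  unfold MG.d
  apply sum_split (M.cn {w}) _ _ hf hg hne _ (fun e h _ => cn_split_of_ne M f g a b _ e h)
  have h1 : M.cn {w} f = 1 := by
    rcases ha with ⟨h1, h2⟩ | ⟨h1, h2⟩ <;> simp [MG.cn, h1, h2, haw]
  have h2 : M.cn {w} g = 1 := by
    rcases hb with ⟨h1, h2⟩ | ⟨h1, h2⟩ <;> simp [MG.cn, h1, h2, hbw]
  rw [h1, h2]
  simp [MG.cn, MG.split, haw, hbw]

lemma cn_cast (M : MG V E) (S : Finset V) (e : E) :
    (M.cn S e : ZMod 2) = (if M.x e ∈ S then 1 else 0) + (if M.y e ∈ S then 1 else 0) := by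
  unfold MG.cn
  by_cases p : M.x e ∈ S <;> by_cases q : M.y e ∈ S <;> simp [p, q]
  decide

lemma d_cast (M : MG V E) (S : Finset V) : (M.d S : ZMod 2) = ∑ v ∈ S, (M.d {v} : ZMod 2) := by
  unfold MG.d
  push_cast
  rw [Finset.sum_comm]
  apply Finset.sum_congr rfl
  intro e _
  simp only [cn_cast, Finset.mem_singleton, Finset.sum_add_distrib]
  simp

lemma Semi.even {A : Finset V} {w : V} {M : MG V E} {k : ℕ} (H : Semi A w M k) (S : Finset V)
    (hS : S ⊆ A) : Even (M.d S) := by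
  rw [← ZMod.natCast_eq_zero_iff_even, d_cast]
  apply Finset.sum_eq_zero
  intro v hv
  rw [H.deg v (hS hv)]
  decide

lemma tight_nested {A : Finset V} {w : V} {M : MG V E} {k : ℕ} (H : Semi A w M k)
    {f : E} {a : V} (hf : f ∈ M.es) (ha : M.IsEnds f a w) {X Y : Finset V}
    (hX : X ⊆ A) (hY : Y ⊆ A) (haX : a ∈ X) (haY : a ∈ Y)
    (dX : M.d X ≤ 6) (dY : M.d Y ≤ 6) : X ⊆ Y ∨ Y ⊆ X := by
  by_contra hcon
  push Not at hcon
  obtain ⟨h1, h2⟩ := hcon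
  have wX : w ∉ X := fun h => H.wA (hX h)
  have wY : w ∉ Y := fun h => H.wA (hY h)
  have n1 : (X \ Y).Nonempty := Finset.sdiff_nonempty.2 h1
  have n2 : (Y \ X).Nonempty := Finset.sdiff_nonempty.2 h2
  have c1 := H.cut (X \ Y) (Finset.sdiff_subset.trans hX) n1
    (fun h => by have := h ▸ hX haX; simp [haY] at this)
  have c2 := H.cut (Y \ X) (Finset.sdiff_subset.trans hY) n2
    (fun h => by have := h ▸ hY haY; simp [haX] at this)
  have : M.d (X \ Y) + M.d (Y \ X) < M.d X + M.d Y := by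
    unfold MG.d
    rw [← Finset.sum_add_distrib, ← Finset.sum_add_distrib]
    apply Finset.sum_lt_sum
    · intro e _
      unfold MG.cn
      simp only [Finset.mem_sdiff]
      by_cases p : M.x e ∈ X <;> by_cases q : M.y e ∈ X <;> by_cases p' : M.x e ∈ Y <;>
        by_cases q' : M.y e ∈ Y <;> simp [p, q, p', q']
    · refine ⟨f, hf, ?_⟩
      rcases ha with ⟨h1, h2⟩ | ⟨h1, h2⟩ <;>
        simp [MG.cn, h1, h2, wX, wY, haX, haY]
  omega

lemma other_end {M : MG V E} {e : E} {w : V} (h : M.cn {w} e ≠ 0) :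
    ∃ a, a ≠ w ∧ M.IsEnds e a w := by
  unfold MG.cn at h
  by_cases p : M.x e = w
  · refine ⟨M.y e, ?_, Or.inr ⟨p, rfl⟩⟩
    rintro q
    simp [p, q] at h
  · refine ⟨M.x e, p, Or.inl ⟨rfl, ?_⟩⟩
    by_contra q
    simp [p, q] at h

lemma IsEnds.cn {M : MG V E} {e : E} {a w : V} (h : M.IsEnds e a w) (ha : a ≠ w) :
    M.cn {w} e = 1 := by
  rcases h with ⟨h1, h2⟩ | ⟨h1, h2⟩ <;> simp [MG.cn, h1, h2, ha]

lemma Semi.step {A : Finset V} {w : V} {M : MG V E} {k : ℕ} (H : Semi A w M (k + 1))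
    (hA : 2 ≤ A.card) : ∃ M', Step w M M' ∧ Semi A w M' k := by
  have hd := H.degw
  -- a first edge at `w`
  obtain ⟨f, hf, hfw⟩ : ∃ f ∈ M.es, M.cn {w} f ≠ 0 := by
    apply Finset.exists_ne_zero_of_sum_ne_zero
    change M.d {w} ≠ 0
    omega
  obtain ⟨a, haw, ha⟩ := other_end hfw
  have haA : a ∈ A := by
    obtain ⟨m1, m2, _⟩ := H.mem f hf
    rcases ha with ⟨h1, h2⟩ | ⟨h1, h2⟩
    · rw [h1] at m1; simpa [haw] using m1
    · rw [h2] at m2; simpa [haw] using m2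
  -- it suffices to find an unblocked second edge
  by_cases key : ∃ g ∈ M.es, g ≠ f ∧ ∃ b, b ≠ w ∧ M.IsEnds g b w ∧
      ∀ X ⊆ A, a ∈ X → b ∈ X → X ≠ A → 8 ≤ M.d X
  · obtain ⟨g, hg, hgf, b, hbw, hb, hX⟩ := key
    have hbA : b ∈ A := by
      obtain ⟨m1, m2, _⟩ := H.mem g hg
      rcases hb with ⟨h1, h2⟩ | ⟨h1, h2⟩
      · rw [h1] at m1; simpa [hbw] using m1
      · rw [h2] at m2; simpa [hbw] using m2
    have hab : a ≠ b := by
      rintro rfl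
      have := hX {a} (by simpa using haA) (by simp) (by simp) (by
        rintro rfl
        simp at hA)
      rw [H.deg a haA] at this
      omega
    refine ⟨M.split f g a b, ⟨f, g, a, b, hf, hg, hgf.symm, ha, hb, hab, haw, hbw, rfl⟩, ?_⟩
    refine ⟨H.wA, ?_, ?_, ?_, ?_⟩
    · intro e he
      have he' : e ∈ M.es := Finset.mem_of_mem_erase he
      by_cases hef : e = f
      · subst hef
        simp [MG.split, haA, hbA, hab]
      · simpa [MG.split, hef] using H.mem e he'
    · intro v hv
      have := d_split M hf hg hgf.symm ha hb {v} (by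
        simp only [Finset.mem_singleton]; rintro rfl; exact H.wA hv)
      rw [H.deg v hv, if_neg] at this
      · simpa using this
      · simp only [Finset.mem_singleton]
        rintro ⟨h1, h2⟩
        exact hab (h1.trans h2.symm)
    · have := d_split_w M hf hg hgf.symm ha hb haw hbw
      omega
    · intro S hS hne hSA
      have := d_split M hf hg hgf.symm ha hb S (fun h => H.wA (hS h))
      split_ifs at this with hc
      · have := hX S hS hc.1 hc.2 hSA
        omega
      · have := H.cut S hS hne hSA
        omega
  · exfalso
    push Not at key
    have blocked : ∀ g ∈ M.es, g ≠ f → ∀ b, b ≠ w → M.IsEnds g b w →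
        ∃ X ⊆ A, a ∈ X ∧ b ∈ X ∧ X ≠ A ∧ M.d X ≤ 6 := by
      intro g hg hgf b hbw hb
      obtain ⟨X, hX, h1, h2, h3, h4⟩ := key g hg hgf b hbw hb
      refine ⟨X, hX, h1, h2, h3, ?_⟩
      obtain ⟨m, hm⟩ := H.even X hX
      omega
    -- the family of tight sets
    let T : Finset (Finset V) := A.powerset.filter (fun X => a ∈ X ∧ X ≠ A ∧ M.d X ≤ 6)
    have hT : T.Nonempty := by
      refine ⟨{a}, ?_⟩
      simp only [T, Finset.mem_filter, Finset.mem_powerset, Finset.singleton_subset_iff,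
        Finset.mem_singleton, true_and]
      refine ⟨haA, ?_, (H.deg a haA).le⟩
      rintro rfl
      simp at hA
    obtain ⟨X, hXT, hmax⟩ := Finset.exists_max_image T Finset.card hT
    simp only [T, Finset.mem_filter, Finset.mem_powerset] at hXT hmax
    obtain ⟨hXA, haX, hXne, hdX⟩ := hXT
    have wX : w ∉ X := fun h => H.wA (hXA h)
    have allin : ∀ g ∈ M.es, ∀ b, b ≠ w → M.IsEnds g b w → b ∈ X := by
      intro g hg b hbw hb
      by_cases hgf : g = f
      · subst hgf
        have : a = b := by
          rcases ha with ⟨h1, h2⟩ | ⟨h1, h2⟩ <;> rcases hb with ⟨h3, h4⟩ | ⟨h3, h4⟩ <;> grind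
        exact this ▸ haX
      · obtain ⟨Y, hYA, haY, hbY, hYne, hdY⟩ := blocked g hg hgf b hbw hb
        rcases tight_nested H hf ha hXA hYA haX haY hdX hdY with h | h
        · have := hmax Y ⟨hYA, haY, hYne, hdY⟩
          rw [Finset.eq_of_subset_of_card_le h this]
          exact hbY
        · exact h hbY
    have hc := H.cut (A \ X) Finset.sdiff_subset
      (Finset.sdiff_nonempty.2 (fun h => hXne (Finset.Subset.antisymm hXA h)))
      (fun h => by have := h ▸ haA; simp [haX] at this)
    have : M.d (A \ X) + M.d {w} ≤ M.d X := by
      unfold MG.d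
      rw [← Finset.sum_add_distrib]
      apply Finset.sum_le_sum
      intro e he
      by_cases hz : M.cn {w} e = 0
      · rw [hz]
        obtain ⟨m1, m2, m3⟩ := H.mem e he
        unfold MG.cn at hz ⊢
        simp only [Finset.mem_insert, Finset.mem_singleton, Finset.mem_sdiff] at *
        grind
      · obtain ⟨b, hbw, hb⟩ := other_end hz
        have hbX := allin e he b hbw hb
        rw [IsEnds.cn hb hbw]
        rcases hb with ⟨h1, h2⟩ | ⟨h1, h2⟩ <;> simp [MG.cn, h1, h2, hbX, wX, H.wA]
    omega

lemma Semi.complete {A : Finset V} {w : V} (hA : 2 ≤ A.card) : ∀ (k : ℕ) {M : MG V E},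
    Semi A w M k → ∃ M', Relation.ReflTransGen (Step w) M M' ∧ Semi A w M' 0 := by
  intro k
  induction k with
  | zero => exact fun {M} H => ⟨M, .refl, H⟩
  | succ k ih =>
    intro M H
    obtain ⟨M1, h1, H1⟩ := H.step hA
    obtain ⟨M2, h2, H2⟩ := ih H1
    exact ⟨M2, .head h1 h2, H2⟩

lemma Semi.good {A : Finset V} {w : V} {M : MG V E} (H : Semi A w M 0) : Good A M := by
  refine ⟨?_, H.deg, H.cut⟩
  intro e he
  have h0 : M.cn {w} e = 0 := by
    have := H.degw
    unfold MG.d at this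
    rw [mul_zero, Finset.sum_eq_zero_iff] at this
    exact this e he
  obtain ⟨m1, m2, m3⟩ := H.mem e he
  unfold MG.cn at h0
  simp only [Finset.mem_insert, Finset.mem_singleton] at *
  grind

lemma Good.complete {A : Finset V} {w : V} {M : MG V E} (H : Good A M) (hw : w ∈ A)
    (hA : 3 ≤ A.card) :
    ∃ M', Relation.ReflTransGen (Step w) M M' ∧ Good (A.erase w) M' := by
  have hc := Finset.card_erase_of_mem hw
  have S : Semi (A.erase w) w M 3 := by
    refine ⟨by simp, ?_, ?_, H.deg w hw, ?_⟩
    · rw [Finset.insert_erase hw]; exact H.mem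
    · exact fun v hv => H.deg v (Finset.mem_of_mem_erase hv)
    · intro S hS hne _
      refine H.cut S (hS.trans (Finset.erase_subset _ _)) hne ?_
      rintro rfl
      simpa using hS hw
  obtain ⟨M', h, h'⟩ := Semi.complete (by omega) 3 S
  exact ⟨M', h, h'.good⟩

lemma Step.rooted {w : V} {M M' : MG V E} (h : Step w M M') (hr : Rooted M') : Rooted M := by
  obtain ⟨f, g, a, b, hf, hg, hne, ha, hb, hab, haw, hbw, rfl⟩ := h
  obtain ⟨v, c, hc⟩ := hr
  have hf' : f ∈ (M.split f g a b).es := Finset.mem_erase.2 ⟨hne, hf⟩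
  refine ⟨v, Function.update c g (c f), fun i => ?_⟩
  obtain ⟨h1, h2, h3⟩ := hc i
  refine ⟨?_, ?_, ?_⟩
  · intro t
    refine Eq.trans ?_ (h1 t)
    symm
    apply sum_split0 _ _ hf hg hne
    · have e1 : t (M.x f) + t (M.y f) = t a + t w := by
        rcases ha with ⟨p, q⟩ | ⟨p, q⟩ <;> rw [p, q]
        exact add_comm _ _
      have e2 : t (M.x g) + t (M.y g) = t b + t w := by
        rcases hb with ⟨p, q⟩ | ⟨p, q⟩ <;> rw [p, q]
        exact add_comm _ _
      simp only [Function.update_self, Function.update_of_ne hne, MG.split]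
      split_ifs
      · rw [e1, e2]
        have : ∀ p q r : ZMod 2, p + q = p + r + (q + r) := by decide
        exact this _ _ _
      · simp
    · intro e hef heg
      simp [MG.split, hef, heg]
  · refine Eq.trans ?_ h2
    symm
    apply sum_split0 _ _ hf hg hne
    · simp only [Function.update_self, Function.update_of_ne hne, MG.split]
      split_ifs <;> simp
    · intro e hef heg
      simp [MG.split, hef, heg]
  · intro S hv hS
    have hS' : ∀ e ∈ (M.split f g a b).es, c e = i →
        ((M.split f g a b).x e ∈ S ↔ (M.split f g a b).y e ∈ S) := by
      intro e he hce
      by_cases hef : e = f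
      · subst hef
        have q1 := hS e hf (by simpa [Function.update_of_ne hne] using hce)
        have q2 := hS g hg (by simpa using hce)
        have q1' : a ∈ S ↔ w ∈ S := by
          rcases ha with ⟨p, q⟩ | ⟨p, q⟩ <;> rw [p, q] at q1 <;> tauto
        have q2' : b ∈ S ↔ w ∈ S := by
          rcases hb with ⟨p, q⟩ | ⟨p, q⟩ <;> rw [p, q] at q2 <;> tauto
        simp [MG.split, q1', q2']
      · have heg : e ≠ g := Finset.ne_of_mem_erase he
        have := hS e (Finset.mem_of_mem_erase he) (by simpa [heg] using hce)
        simpa [MG.split, hef] using this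
    have h4 := h3 S hv hS'
    intro e he hce
    by_cases heg : e = g
    · subst heg
      have q2 := hS e hg hce
      have := (h4 f hf' (by simpa using hce)).2
      simp only [MG.split, Function.update_self] at this
      rcases hb with ⟨p, q⟩ | ⟨p, q⟩ <;> rw [p, q] at q2 ⊢ <;> tauto
    · by_cases hef : e = f
      · subst hef
        have q1 := hS e hf hce
        have := (h4 e hf' (by simpa [heg] using hce)).1
        simp only [MG.split, Function.update_self] at this
        rcases ha with ⟨p, q⟩ | ⟨p, q⟩ <;> rw [p, q] at q1 ⊢ <;> tauto
      · have := h4 e (Finset.mem_erase.2 ⟨heg, he⟩) (by simpa [heg] using hce)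
        simpa [MG.split, hef] using this

lemma Steps.rooted {w : V} {M M' : MG V E} (h : Relation.ReflTransGen (Step w) M M')
    (hr : Rooted M') : Rooted M := by
  induction h using Relation.ReflTransGen.head_induction_on with
  | refl => exact hr
  | head h1 _ ih => exact h1.rooted ih

lemma Step.total {w : V} {M M' : MG V E} (h : Step w M M') :
    ∑ e ∈ M'.es, M'.s e = ∑ e ∈ M.es, M.s e := by
  obtain ⟨f, g, a, b, hf, hg, hne, ha, hb, hab, haw, hbw, rfl⟩ := h
  apply sum_split0 _ _ hf hg hne
  · simp [MG.split]
  · intro e hef _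
    simp [MG.split, hef]

lemma Steps.total {w : V} {M M' : MG V E} (h : Relation.ReflTransGen (Step w) M M') :
    ∑ e ∈ M'.es, M'.s e = ∑ e ∈ M.es, M.s e := by
  induction h with
  | refl => rfl
  | tail _ h1 ih => rw [h1.total, ih]

/-- After switching by `t`, all edges not at `w` except possibly `h` are positive. -/
def Form (w : V) (t : V → ZMod 2) (h : E) (M : MG V E) : Prop :=
  ∀ e ∈ M.es, e ≠ h → M.x e ≠ w → M.y e ≠ w → M.s e + (t (M.x e) + t (M.y e)) = 0

lemma Step.form {w : V} {t : V → ZMod 2} {h : E} {M M' : MG V E} (hs : Step w M M')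
    (hr : Form w t h M') : Form w t h M := by
  obtain ⟨f, g, a, b, hf, hg, hne, ha, hb, hab, haw, hbw, rfl⟩ := hs
  intro e he heh hx hy
  have hef : e ≠ f := by
    rintro rfl
    rcases ha with ⟨p, q⟩ | ⟨p, q⟩ <;> tauto
  have heg : e ≠ g := by
    rintro rfl
    rcases hb with ⟨p, q⟩ | ⟨p, q⟩ <;> tauto
  have := hr e (Finset.mem_erase.2 ⟨heg, he⟩) heh
  simp only [MG.split, Function.update_of_ne hef] at this
  exact this hx hy

lemma Steps.form {w : V} {t : V → ZMod 2} {h : E} {M M' : MG V E}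
    (hs : Relation.ReflTransGen (Step w) M M')
    (hr : Form w t h M') : Form w t h M := by
  induction hs using Relation.ReflTransGen.head_induction_on with
  | refl => exact hr
  | head h1 _ ih => exact h1.form ih

structure Form3 (w : V) (h : E) (M : MG V E) : Prop where
  hmem : h ∈ M.es
  hx : M.x h ≠ w
  hy : M.y h ≠ w
  pos : ∀ e ∈ M.es, e ≠ h → M.x e ≠ w → M.y e ≠ w → M.s e = 0
  tot : ∑ e ∈ M.es, (M.s e).val = 3

lemma Step.form3 {w z : V} {h : E} {M M' : MG V E} (hs : Step z M M')
    (hzw : z ≠ w) (hr : Form3 w h M) (hx : M.x h ≠ z) (hy : M.y h ≠ z) :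
    Form3 w h M' ∧ M'.x h ≠ z ∧ M'.y h ≠ z ∧ M'.x h = M.x h ∧ M'.y h = M.y h := by
  obtain ⟨f, g, a, b, hf, hg, hne, ha, hb, hab, haw, hbw, rfl⟩ := hs
  have hhf : h ≠ f := by
    rintro rfl
    rcases ha with ⟨p, q⟩ | ⟨p, q⟩ <;> tauto
  have hhg : h ≠ g := by
    rintro rfl
    rcases hb with ⟨p, q⟩ | ⟨p, q⟩ <;> tauto
  have sf : a ≠ w → M.s f = 0 := by
    intro h'
    apply hr.pos f hf hhf.symm <;> rcases ha with ⟨p, q⟩ | ⟨p, q⟩ <;> simp [p, q, h', hzw]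
  have sg : b ≠ w → M.s g = 0 := by
    intro h'
    apply hr.pos g hg hhg.symm <;> rcases hb with ⟨p, q⟩ | ⟨p, q⟩ <;> simp [p, q, h', hzw]
  refine ⟨⟨Finset.mem_erase.2 ⟨hhg, hr.hmem⟩, ?_, ?_, ?_, ?_⟩, ?_, ?_, ?_, ?_⟩
  · simpa [MG.split, hhf] using hr.hx
  · simpa [MG.split, hhf] using hr.hy
  · intro e he heh hex hey
    by_cases hef : e = f
    · subst hef
      simp only [MG.split, Function.update_self] at hex hey ⊢
      simp [sf hex, sg hey]
    · simp only [MG.split, Function.update_of_ne hef] at hex hey ⊢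
      exact hr.pos e (Finset.mem_of_mem_erase he) heh hex hey
  · rw [← hr.tot]
    apply sum_split0 _ _ hf hg hne
    · simp only [MG.split, Function.update_self]
      by_cases h' : a = w
      · have : b ≠ w := fun h2 => hab (h'.trans h2.symm)
        simp [sg this]
      · simp [sf h']
    · intro e hef _
      simp [MG.split, hef]
  all_goals simp [MG.split, hhf, hx, hy]

lemma Steps.form3 {w z : V} {h : E} {M M' : MG V E} (hs : Relation.ReflTransGen (Step z) M M')
    (hzw : z ≠ w) (hr : Form3 w h M) (hx : M.x h ≠ z) (hy : M.y h ≠ z) :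
    Form3 w h M' ∧ M'.x h ≠ z ∧ M'.y h ≠ z := by
  induction hs with
  | refl => exact ⟨hr, hx, hy⟩
  | tail _ h1 ih =>
    obtain ⟨p, q, r, _⟩ := h1.form3 hzw ih.1 ih.2.1 ih.2.2
    exact ⟨p, q, r⟩

lemma perm_exists : ∀ a b : Fin 3 → ZMod 2, ∀ r : ZMod 2,
    (∑ k, (a k).val) + (∑ k, (b k).val) + r.val = 3 →
    ∃ π ρ : Equiv.Perm (Fin 3), ∀ k, a (π k) + b (ρ k) + (if k = 0 then r else 0) = 1 := by
  decide

lemma enum3 {P : Finset E} (h : P.card = 3) : ∃ p : Fin 3 → E, Function.Injective p ∧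
    (∀ k, p k ∈ P) ∧ (∀ (R : Type) [AddCommMonoid R] (F : E → R), ∑ e ∈ P, F e = ∑ k, F (p k)) := by
  let φ := (P.equivFinOfCardEq h).symm
  refine ⟨fun k => (φ k : E), fun i j hij => φ.injective (Subtype.ext hij), fun k => (φ k).2, ?_⟩
  intro R _ F
  rw [← Finset.sum_coe_sort]
  exact (Equiv.sum_comp φ (fun e : P => F e)).symm

lemma base {w p q : V} {h : E} {M : MG V E} (hwp : w ≠ p) (hwq : w ≠ q) (hpq : p ≠ q)
    (H : Good {w, p, q} M) (hF : Form3 w h M) : Rooted M := by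
  let P := M.es.filter (fun e => M.IsEnds e w p)
  let Q := M.es.filter (fun e => M.IsEnds e w q)
  let R := M.es.filter (fun e => M.IsEnds e p q)
  have cases3 : ∀ e ∈ M.es, M.IsEnds e w p ∨ M.IsEnds e w q ∨ M.IsEnds e p q := by
    intro e he
    obtain ⟨m1, m2, m3⟩ := H.mem e he
    simp only [Finset.mem_insert, Finset.mem_singleton] at m1 m2
    unfold MG.IsEnds
    rcases m1 with m1 | m1 | m1 <;> rcases m2 with m2 | m2 | m2 <;> simp [m1, m2] at m3 ⊢
  have dPQ : Disjoint P Q := by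
    rw [Finset.disjoint_filter]
    rintro e _ (⟨a, b⟩ | ⟨a, b⟩) (⟨c, d⟩ | ⟨c, d⟩) <;> grind
  have dPR : Disjoint P R := by
    rw [Finset.disjoint_filter]
    rintro e _ (⟨a, b⟩ | ⟨a, b⟩) (⟨c, d⟩ | ⟨c, d⟩) <;> grind
  have dQR : Disjoint Q R := by
    rw [Finset.disjoint_filter]
    rintro e _ (⟨a, b⟩ | ⟨a, b⟩) (⟨c, d⟩ | ⟨c, d⟩) <;> grind
  have hU : M.es = (P ∪ Q) ∪ R := by
    ext e
    simp only [P, Q, R, Finset.mem_union, Finset.mem_filter]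
    have := cases3 e
    tauto
  have dU : Disjoint (P ∪ Q) R := Finset.disjoint_union_left.2 ⟨dPR, dQR⟩
  have sumU : ∀ (T : Type) [AddCommMonoid T] (F : E → T), ∑ e ∈ M.es, F e =
      ∑ e ∈ P, F e + ∑ e ∈ Q, F e + ∑ e ∈ R, F e := by
    intro T _ F
    rw [hU, Finset.sum_union dU, Finset.sum_union dPQ]
  have sumc : ∀ (S : Finset E) (F : E → ℕ) (n : ℕ), (∀ e ∈ S, F e = n) →
      ∑ e ∈ S, F e = S.card * n := by
    intro S F n hn
    rw [Finset.sum_congr rfl hn]; simp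
  have hP : ∀ e ∈ P, M.IsEnds e w p := fun e he => (Finset.mem_filter.1 he).2
  have hQ : ∀ e ∈ Q, M.IsEnds e w q := fun e he => (Finset.mem_filter.1 he).2
  have hR : ∀ e ∈ R, M.IsEnds e p q := fun e he => (Finset.mem_filter.1 he).2
  have dw := H.deg w (by simp)
  have dp := H.deg p (by simp)
  have dq := H.deg q (by simp)
  unfold MG.d at dw dp dq
  rw [sumU] at dw dp dq
  rw [sumc P _ 1, sumc Q _ 1, sumc R _ 0] at dw
  rw [sumc P _ 1, sumc Q _ 0, sumc R _ 1] at dp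
  rw [sumc P _ 0, sumc Q _ 1, sumc R _ 1] at dq
  rotate_left
  · intro e he; rcases hR e he with ⟨a, b⟩ | ⟨a, b⟩ <;> simp [MG.cn, a, b, hpq, hpq.symm]
  · intro e he; rcases hQ e he with ⟨a, b⟩ | ⟨a, b⟩ <;> simp [MG.cn, a, b, hwq, hwq.symm]
  · intro e he; rcases hP e he with ⟨a, b⟩ | ⟨a, b⟩ <;> simp [MG.cn, a, b, hwq, hpq]
  · intro e he; rcases hR e he with ⟨a, b⟩ | ⟨a, b⟩ <;> simp [MG.cn, a, b, hpq, hpq.symm]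
  · intro e he; rcases hQ e he with ⟨a, b⟩ | ⟨a, b⟩ <;> simp [MG.cn, a, b, hwp, hpq.symm]
  · intro e he; rcases hP e he with ⟨a, b⟩ | ⟨a, b⟩ <;> simp [MG.cn, a, b, hwp]
  · intro e he; rcases hR e he with ⟨a, b⟩ | ⟨a, b⟩ <;> simp [MG.cn, a, b, hwp.symm, hwq.symm]
  · intro e he; rcases hQ e he with ⟨a, b⟩ | ⟨a, b⟩ <;> simp [MG.cn, a, b, hwq.symm]
  · intro e he; rcases hP e he with ⟨a, b⟩ | ⟨a, b⟩ <;> simp [MG.cn, a, b, hwp.symm]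
  obtain ⟨ep, ip, mp, sp⟩ := enum3 (P := P) (by omega)
  obtain ⟨eq, iq, mq, sq⟩ := enum3 (P := Q) (by omega)
  obtain ⟨er0, ir0, mr0, sr0⟩ := enum3 (P := R) (by omega)
  have hhR : h ∈ R := by
    refine Finset.mem_filter.2 ⟨hF.hmem, ?_⟩
    have hx := hF.hx
    have hy := hF.hy
    rcases cases3 h hF.hmem with (⟨a, b⟩ | ⟨a, b⟩) | (⟨a, b⟩ | ⟨a, b⟩) | h' <;> tauto
  obtain ⟨er, ir, mr, sr, hr0⟩ : ∃ er : Fin 3 → E, Function.Injective er ∧ (∀ k, er k ∈ R) ∧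
      (∀ (T : Type) [AddCommMonoid T] (F : E → T), ∑ e ∈ R, F e = ∑ k, F (er k)) ∧ er 0 = h := by
    have : ∃ j, er0 j = h := by
      have := sr0 ℕ (fun e => if e = h then 1 else 0)
      rw [Finset.sum_ite_eq' R h, if_pos hhR] at this
      by_contra hcon
      push Not at hcon
      simp [hcon] at this
    obtain ⟨j, hj⟩ := this
    refine ⟨er0 ∘ Equiv.swap 0 j, ir0.comp (Equiv.injective _), fun k => mr0 _, ?_, ?_⟩
    · intro T _ F
      rw [sr0 T F]
      exact (Equiv.sum_comp (Equiv.swap 0 j) (fun k => F (er0 k))).symm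
    · simp [hj]
  have rpos : ∀ k, M.s (er k) = if k = 0 then M.s h else 0 := by
    intro k
    split_ifs with hk
    · rw [hk, hr0]
    · have hm := mr k
      have hne : er k ≠ h := by
        rw [← hr0]; exact fun h' => hk (ir h')
      apply hF.pos (er k) (Finset.mem_filter.1 hm).1 hne <;>
        rcases hR _ hm with ⟨a, b⟩ | ⟨a, b⟩ <;> simp [a, b, hwp.symm, hwq.symm]
  have tot := hF.tot
  rw [sumU, sp, sq, sr] at tot
  obtain ⟨π, ρ, hπ⟩ := perm_exists (fun k => M.s (ep k)) (fun k => M.s (eq k)) (M.s h) (by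
    refine Eq.trans ?_ tot
    congr 1
    simp [rpos, Fin.sum_univ_three])
  have key : ∃ c : E → Fin 3, ∀ k, c (ep (π k)) = k ∧ c (eq (ρ k)) = k ∧ c (er k) = k := by
    have n1 : ∀ i j, ep i ≠ eq j := fun i j => Finset.disjoint_iff_ne.1 dPQ _ (mp i) _ (mq j)
    have n2 : ∀ i j, ep i ≠ er j := fun i j => Finset.disjoint_iff_ne.1 dPR _ (mp i) _ (mr j)
    have n3 : ∀ i j, eq i ≠ er j := fun i j => Finset.disjoint_iff_ne.1 dQR _ (mq i) _ (mr j)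
    have hex : ∀ e, ∃ k : Fin 3, ∀ j, (ep (π j) = e ∨ eq (ρ j) = e ∨ er j = e) → j = k := by
      intro e
      by_cases hc : ∃ k, ep (π k) = e ∨ eq (ρ k) = e ∨ er k = e
      · obtain ⟨k, hk⟩ := hc
        refine ⟨k, fun j hj => ?_⟩
        rcases hk with rfl | rfl | rfl
        · rcases hj with hj | hj | hj
          · exact π.injective (ip hj)
          · exact absurd hj.symm (n1 _ _)
          · exact absurd hj.symm (n2 _ _)
        · rcases hj with hj | hj | hj
          · exact absurd hj (n1 _ _)
          · exact ρ.injective (iq hj)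
          · exact absurd hj.symm (n3 _ _)
        · rcases hj with hj | hj | hj
          · exact absurd hj (n2 _ _)
          · exact absurd hj (n3 _ _)
          · exact ir hj
      · exact ⟨0, fun j hj => absurd ⟨j, hj⟩ hc⟩
    choose c hc using hex
    exact ⟨c, fun k => ⟨(hc _ k (Or.inl rfl)).symm, (hc _ k (Or.inr (Or.inl rfl))).symm,
      (hc _ k (Or.inr (Or.inr rfl))).symm⟩⟩
  obtain ⟨c, hc⟩ := key
  have sum9 : ∀ (F : E → ZMod 2) i, ∑ e ∈ M.es, (if c e = i then F e else 0) =
      F (ep (π i)) + F (eq (ρ i)) + F (er i) := by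
    intro F i
    rw [sumU, sp, sq, sr, ← Equiv.sum_comp π (fun k => if c (ep k) = i then F (ep k) else 0),
      ← Equiv.sum_comp ρ (fun k => if c (eq k) = i then F (eq k) else 0)]
    simp [hc]
  refine ⟨w, c, fun i => ?_⟩
  have Ep := hP _ (mp (π i))
  have Eq := hQ _ (mq (ρ i))
  have Er := hR _ (mr i)
  have MP := (Finset.mem_filter.1 (mp (π i))).1
  have MQ := (Finset.mem_filter.1 (mq (ρ i))).1
  refine ⟨?_, ?_, ?_⟩
  · intro t
    rw [sum9 (fun e => t (M.x e) + t (M.y e))]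
    have gen : ∀ {e a b}, M.IsEnds e a b → t (M.x e) + t (M.y e) = t a + t b := by
      rintro e a b (⟨h1, h2⟩ | ⟨h1, h2⟩) <;> rw [h1, h2]
      exact add_comm _ _
    rw [gen Ep, gen Eq, gen Er]
    have : ∀ a b c : ZMod 2, a + b + (a + c) + (b + c) = 0 := by decide
    exact this _ _ _
  · rw [sum9, rpos]
    exact hπ i
  · intro S hw hS
    have gen : ∀ {e a b}, M.IsEnds e a b → e ∈ M.es → c e = i → (a ∈ S ↔ b ∈ S) := by
      rintro e a b (⟨h1, h2⟩ | ⟨h1, h2⟩) he hce <;> have := hS e he hce <;> rw [h1, h2] at this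
      · exact this
      · exact this.symm
    have pS : p ∈ S := (gen Ep MP (hc i).1).1 hw
    have qS : q ∈ S := (gen Eq MQ (hc i).2.1).1 hw
    intro e he _
    rcases cases3 e he with (⟨a, b⟩ | ⟨a, b⟩) | (⟨a, b⟩ | ⟨a, b⟩) | (⟨a, b⟩ | ⟨a, b⟩) <;>
      rw [a, b] <;> simp [pS, qS, hw]

lemma root {w : V} {h : E} : ∀ (n : ℕ) (A : Finset V) (M : MG V E), A.card = n → w ∈ A →
    Good A M → Form3 w h M → Rooted M := by
  intro n
  induction n with
  | zero =>
    intro A M hA hw _ _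
    rw [Finset.card_eq_zero] at hA
    simp [hA] at hw
  | succ n ih =>
    intro A M hA hw H hF
    obtain ⟨m1, m2, m3⟩ := H.mem h hF.hmem
    by_cases hz : ∃ z ∈ A, z ≠ w ∧ z ≠ M.x h ∧ z ≠ M.y h
    · obtain ⟨z, hzA, hzw, hzx, hzy⟩ := hz
      have hc : 3 ≤ A.card := by
        have : ({w, M.x h, M.y h} : Finset V) ⊆ A := by
          intro v hv
          simp only [Finset.mem_insert, Finset.mem_singleton] at hv
          rcases hv with rfl | rfl | rfl <;> assumption
        have h3 : ({w, M.x h, M.y h} : Finset V).card = 3 :=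
          Finset.card_eq_three.2 ⟨_, _, _, hF.hx.symm, hF.hy.symm, m3, rfl⟩
        rw [← h3]
        exact Finset.card_le_card this
      obtain ⟨M', hs, H'⟩ := H.complete hzA hc
      obtain ⟨hF', _, _⟩ := Steps.form3 hs hzw hF hzx.symm hzy.symm
      refine Steps.rooted hs (ih (A.erase z) M' ?_ ?_ H' hF')
      · rw [Finset.card_erase_of_mem hzA, hA]; rfl
      · exact Finset.mem_erase.2 ⟨hzw.symm, hw⟩
    · push Not at hz
      have : A = {w, M.x h, M.y h} := by
        ext v
        simp only [Finset.mem_insert, Finset.mem_singleton]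
        constructor
        · intro hv
          have := hz v hv
          tauto
        · rintro (rfl | rfl | rfl) <;> assumption
      subst this
      exact base hF.hx.symm hF.hy.symm m3 H hF

lemma rooted_of_sw {M : MG V E} {t : V → ZMod 2} (h : Rooted (M.sw t)) : Rooted M := by
  obtain ⟨v, c, hc⟩ := h
  refine ⟨v, c, fun i => ?_⟩
  obtain ⟨h1, h2, h3⟩ := hc i
  refine ⟨h1, ?_, h3⟩
  have h1t := h1 t
  simp only [MG.sw] at h1t h2
  have : ∀ e, (if c e = i then M.s e + (t (M.x e) + t (M.y e)) else 0) =
      (if c e = i then M.s e else 0) + (if c e = i then t (M.x e) + t (M.y e) else 0) := by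
    intro e; split_ifs <;> simp
  simp only [this, Finset.sum_add_distrib] at h2
  rwa [h1t, add_zero] at h2

lemma notSingle_sw {M : MG V E} (h : NotSingle M) (t : V → ZMod 2) : NotSingle (M.sw t) := by
  intro t' e₀ he₀ hcon
  refine h (t + t') e₀ he₀ fun e he => ?_
  rw [← hcon e he]
  simp only [MG.sw, Pi.add_apply]
  ring

lemma good_sw {A : Finset V} {M : MG V E} (h : Good A M) (t : V → ZMod 2) : Good A (M.sw t) :=
  ⟨h.mem, h.deg, h.cut⟩

lemma total_sw {A : Finset V} {M : MG V E} (h : Good A M) (t : V → ZMod 2) :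
    ∑ e ∈ (M.sw t).es, (M.sw t).s e = ∑ e ∈ M.es, M.s e := by
  simp only [MG.sw, Finset.sum_add_distrib]
  rw [add_eq_left, ← Finset.sum_add_distrib]
  have : ∀ e ∈ M.es, t (M.x e) + t (M.y e) = ∑ v ∈ A, t v * (M.cn {v} e : ZMod 2) := by
    intro e he
    obtain ⟨m1, m2, m3⟩ := h.mem e he
    simp only [cn_cast, mul_add, Finset.sum_add_distrib, Finset.mem_singleton]
    simp [m1, m2]
  rw [Finset.sum_congr rfl this, Finset.sum_comm]
  apply Finset.sum_eq_zero
  intro v hv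
  rw [← Finset.mul_sum]
  have h6 := h.deg v hv
  unfold MG.d at h6
  rw [← Nat.cast_sum, h6]
  have : ((6 : ℕ) : ZMod 2) = 0 := by decide
  rw [this, mul_zero]

lemma single_of_val {M : MG V E} (h : ∑ e ∈ M.es, (M.s e).val = 1) : ¬ NotSingle M := by
  intro hN
  obtain ⟨e₀, he₀, hne⟩ := Finset.exists_ne_zero_of_sum_ne_zero (by rw [h]; exact one_ne_zero)
  refine hN 0 e₀ he₀ fun e he => ?_
  have v1 : ∀ a : ZMod 2, a.val ≠ 0 → a = 1 := by decide
  simp only [Pi.zero_apply, add_zero]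
  split_ifs with hee
  · rw [hee]; exact v1 _ hne
  · rw [← Finset.add_sum_erase _ _ he₀] at h
    have : ∑ e ∈ M.es.erase e₀, (M.s e).val = 0 := by omega
    rw [Finset.sum_eq_zero_iff] at this
    exact (ZMod.val_eq_zero _).1 (this e (Finset.mem_erase.2 ⟨hee, he⟩))

lemma off_exists {A : Finset V} {w : V} {M : MG V E} (H : Good A M) (hA : 3 ≤ A.card)
    (hw : w ∈ A) : ∃ h ∈ M.es, M.x h ≠ w ∧ M.y h ≠ w := by
  by_contra hcon
  push Not at hcon
  obtain ⟨p, hp⟩ : (A.erase w).Nonempty := by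
    rw [← Finset.card_pos, Finset.card_erase_of_mem hw]; omega
  obtain ⟨hpw, hpA⟩ := Finset.mem_erase.1 hp
  have c1 := H.cut {w, p} (by
    intro v hv
    simp only [Finset.mem_insert, Finset.mem_singleton] at hv
    rcases hv with rfl | rfl <;> assumption) (by simp) (by
    rintro rfl
    have := Finset.card_le_two (a := w) (b := p)
    omega)
  have c2 := H.deg p hpA
  have c3 := H.deg w hw
  have : M.d {w, p} + M.d {p} ≤ M.d {w} := by
    unfold MG.d
    rw [← Finset.sum_add_distrib]
    apply Finset.sum_le_sum
    intro e he
    obtain ⟨m1, m2, m3⟩ := H.mem e he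
    have := hcon e he
    unfold MG.cn
    simp only [Finset.mem_insert, Finset.mem_singleton]
    grind
  omega

lemma finish {A : Finset V} {w : V} {M : MG V E} (H : Good A M) (hA : 3 ≤ A.card)
    (hw : w ∈ A) (ht : ∑ e ∈ M.es, M.s e = 1) (hN : NotSingle M) {t : V → ZMod 2} {h : E}
    (hF : Form w t h M) : Rooted M := by
  -- normalise `h`
  obtain ⟨h, hh, hx, hy, hF⟩ : ∃ h, h ∈ M.es ∧ M.x h ≠ w ∧ M.y h ≠ w ∧ Form w t h M := by
    by_cases hc : h ∈ M.es ∧ M.x h ≠ w ∧ M.y h ≠ w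
    · exact ⟨h, hc.1, hc.2.1, hc.2.2, hF⟩
    · obtain ⟨h0, q1, q2, q3⟩ := off_exists H hA hw
      refine ⟨h0, q1, q2, q3, fun e he _ hx hy => hF e he ?_ hx hy⟩
      rintro rfl
      exact hc ⟨he, hx, hy⟩
  apply rooted_of_sw (t := t)
  replace hN := notSingle_sw hN t
  replace ht : ∑ e ∈ (M.sw t).es, (M.sw t).s e = 1 := by rw [total_sw H, ht]
  replace H := good_sw H t
  replace hF : ∀ e ∈ (M.sw t).es, e ≠ h → (M.sw t).x e ≠ w → (M.sw t).y e ≠ w →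
    (M.sw t).s e = 0 := hF
  replace hh : h ∈ (M.sw t).es := hh
  replace hx : (M.sw t).x h ≠ w := hx
  replace hy : (M.sw t).y h ≠ w := hy
  generalize M.sw t = M at *
  let t' : V → ZMod 2 := fun v => if v = w then 1 else 0
  have r1 : ∑ e ∈ M.es, (M.s e).val = 3 → Rooted M := fun h3 =>
    root _ A M rfl hw H ⟨hh, hx, hy, hF, h3⟩
  have r2 : ∑ e ∈ M.es, ((M.sw t').s e).val = 3 → Rooted M := by
    intro h3
    apply rooted_of_sw (t := t')
    refine root _ A (M.sw t') rfl hw (good_sw H _) ⟨hh, hx, hy, ?_, h3⟩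
    intro e he heh hex hey
    have := hF e he heh hex hey
    simp only [MG.sw] at hex hey ⊢
    simp [this, t', hex, hey]
  have n1 : ∑ e ∈ M.es, (M.s e).val ≠ 1 := fun h1 => single_of_val h1 hN
  have n2 : ∑ e ∈ M.es, ((M.sw t').s e).val ≠ 1 := fun h1 =>
    single_of_val (M := M.sw t') h1 (notSingle_sw hN _)
  have hodd : (∑ e ∈ M.es, (M.s e).val) % 2 = 1 := by
    have : ((∑ e ∈ M.es, (M.s e).val : ℕ) : ZMod 2) = 1 := by
      rw [← ht]
      push_cast
      simp
    rw [← Nat.odd_iff, ← ZMod.natCast_eq_one_iff_odd]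
    exact this
  -- count
  have hval : (M.s h).val ≤ 1 := by
    have : ∀ a : ZMod 2, a.val ≤ 1 := by decide
    exact this _
  have hsum : ∑ e ∈ M.es, (M.s e).val + ∑ e ∈ M.es, ((M.sw t').s e).val =
      6 + 2 * (M.s h).val := by
    rw [← Finset.sum_add_distrib]
    have h6 := H.deg w hw
    unfold MG.d at h6
    rw [← h6]
    have : 2 * (M.s h).val = ∑ e ∈ M.es, if e = h then 2 * (M.s h).val else 0 := by
      rw [Finset.sum_ite_eq' M.es h, if_pos hh]
    rw [this, ← Finset.sum_add_distrib]
    apply Finset.sum_congr rfl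
    intro e he
    obtain ⟨m1, m2, m3⟩ := H.mem e he
    have flip : ∀ a : ZMod 2, a.val + (a + 1).val = 1 := by decide
    by_cases heh : e = h
    · subst heh
      simp [MG.sw, t', hx, hy, MG.cn, two_mul]
    · by_cases hex : M.x e = w
      · have hey : M.y e ≠ w := fun h' => m3 (hex.trans h'.symm)
        simp [MG.sw, t', hex, hey, MG.cn, heh, flip]
      · by_cases hey : M.y e = w
        · simp [MG.sw, t', hex, hey, MG.cn, heh, flip]
        · simp [MG.sw, t', hex, hey, MG.cn, heh, hF e he heh hex hey]
  have hle : ∑ e ∈ M.es, (M.s e).val ≤ 6 + (M.s h).val := by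
    have h6 := H.deg w hw
    unfold MG.d at h6
    rw [← h6]
    have : (M.s h).val = ∑ e ∈ M.es, if e = h then (M.s h).val else 0 := by
      rw [Finset.sum_ite_eq' M.es h, if_pos hh]
    rw [this, ← Finset.sum_add_distrib]
    apply Finset.sum_le_sum
    intro e he
    obtain ⟨m1, m2, m3⟩ := H.mem e he
    have le1 : ∀ a : ZMod 2, a.val ≤ 1 := by decide
    by_cases heh : e = h
    · subst heh
      simp
    · by_cases hex : M.x e = w
      · have hey : M.y e ≠ w := fun h' => m3 (hex.trans h'.symm)
        simp [hex, hey, MG.cn, heh, le1]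
      · by_cases hey : M.y e = w
        · simp [hex, hey, MG.cn, heh, le1]
        · simp [heh, hF e he heh hex hey]
  by_cases h3 : ∑ e ∈ M.es, (M.s e).val = 3
  · exact r1 h3
  · apply r2
    omega

lemma form_three {A : Finset V} {w : V} {M : MG V E} (H : Good A M) (hA : A.card = 3)
    (hw : w ∈ A) : ∃ (t : V → ZMod 2) (h : E), Form w t h M := by
  obtain ⟨h0, hh0, -, -⟩ := off_exists H hA.ge hw
  have : Nonempty E := ⟨h0⟩
  obtain ⟨p, q, hpq, hpqe⟩ := Finset.card_eq_two.1
    (show (A.erase w).card = 2 by rw [Finset.card_erase_of_mem hw, hA])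
  have hpA : p ∈ A.erase w := by rw [hpqe]; simp
  have hqA : q ∈ A.erase w := by rw [hpqe]; simp
  obtain ⟨hpw, hpA⟩ := Finset.mem_erase.1 hpA
  obtain ⟨hqw, hqA⟩ := Finset.mem_erase.1 hqA
  let R := M.es.filter (fun e => M.x e ≠ w ∧ M.y e ≠ w)
  have ends : ∀ e ∈ R, M.IsEnds e p q := by
    intro e he
    obtain ⟨he, hx, hy⟩ := Finset.mem_filter.1 he
    obtain ⟨m1, m2, m3⟩ := H.mem e he
    have h1 : M.x e ∈ A.erase w := Finset.mem_erase.2 ⟨hx, m1⟩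
    have h2 : M.y e ∈ A.erase w := Finset.mem_erase.2 ⟨hy, m2⟩
    rw [hpqe] at h1 h2
    simp only [Finset.mem_insert, Finset.mem_singleton] at h1 h2
    unfold MG.IsEnds
    grind
  have hR : R.card ≤ 3 := by
    have hsum : 2 * R.card + M.d {w} = M.d {p} + M.d {q} := by
      unfold MG.d
      rw [← Finset.sum_add_distrib, Finset.card_filter, Finset.mul_sum, ← Finset.sum_add_distrib]
      apply Finset.sum_congr rfl
      intro e he
      obtain ⟨m1, m2, m3⟩ := H.mem e he
      have h1 : M.x e ≠ w → M.x e ∈ A.erase w := fun hx => Finset.mem_erase.2 ⟨hx, m1⟩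
      have h2 : M.y e ≠ w → M.y e ∈ A.erase w := fun hy => Finset.mem_erase.2 ⟨hy, m2⟩
      rw [hpqe] at h1 h2
      simp only [Finset.mem_insert, Finset.mem_singleton] at h1 h2
      unfold MG.cn
      simp only [Finset.mem_singleton]
      grind
    rw [H.deg w hw, H.deg p hpA, H.deg q hqA] at hsum
    omega
  have v01 : ∀ a : ZMod 2, a ≠ 0 → a ≠ 1 → False := by decide
  have hsplit : (R.filter (fun e => M.s e ≠ 0)).card + (R.filter (fun e => ¬ M.s e ≠ 0)).card
      = R.card := Finset.card_filter_add_card_filter_not _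
  rcases (by omega : (R.filter (fun e => M.s e ≠ 0)).card ≤ 1 ∨
      (R.filter (fun e => ¬ M.s e ≠ 0)).card ≤ 1) with hc | hc
  · rw [Finset.card_le_one_iff_subset_singleton (α := E)] at hc
    obtain ⟨h, hc⟩ := hc
    refine ⟨0, h, fun e he heh hx hy => ?_⟩
    by_contra hne
    have : e ∈ ({h} : Finset E) := hc (Finset.mem_filter.2
      ⟨Finset.mem_filter.2 ⟨he, hx, hy⟩, by simpa using hne⟩)
    exact heh (by simpa using this)
  · rw [Finset.card_le_one_iff_subset_singleton (α := E)] at hc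
    obtain ⟨h, hc⟩ := hc
    refine ⟨fun v => if v = p then 1 else 0, h, fun e he heh hx hy => ?_⟩
    have he' : e ∈ R := Finset.mem_filter.2 ⟨he, hx, hy⟩
    have h1 : M.s e = 1 := by
      by_contra hne
      have : e ∈ ({h} : Finset E) := hc (Finset.mem_filter.2
        ⟨he', fun h0 => v01 _ h0 hne⟩)
      exact heh (by simpa using this)
    rcases ends e he' with ⟨a, b⟩ | ⟨a, b⟩ <;> simp [a, b, h1, hpq.symm] <;> decide

theorem main : ∀ (n : ℕ) (A : Finset V) (M : MG V E), A.card = n + 3 → Good A M →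
    ∑ e ∈ M.es, M.s e = 1 → NotSingle M → Rooted M := by
  intro n
  induction n with
  | zero =>
    intro A M hA H ht hN
    obtain ⟨w, hw⟩ : A.Nonempty := by rw [← Finset.card_pos]; omega
    obtain ⟨t, h, hF⟩ := form_three H hA hw
    exact finish H hA.ge hw ht hN hF
  | succ n ih =>
    intro A M hA H ht hN
    obtain ⟨w, hw⟩ : A.Nonempty := by rw [← Finset.card_pos]; omega
    obtain ⟨M', hs, H'⟩ := H.complete hw (by omega)
    by_cases hN' : NotSingle M'
    · refine Steps.rooted hs (ih (A.erase w) M' ?_ H' ?_ hN')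
      · rw [Finset.card_erase_of_mem hw]; omega
      · rw [Steps.total hs, ht]
    · unfold NotSingle at hN'
      push Not at hN'
      obtain ⟨t, e₀, _, hall⟩ := hN'
      have hF : Form w t e₀ M' := by
        intro e he hne _ _
        rw [hall e he, if_neg hne]
      exact finish H (by omega) hw ht hN (Steps.form hs hF)

section final

variable [Fintype V]

/-- The signed multigraph of a signed simple graph. -/
noncomputable def ofGraph (G : SimpleGraph V) (σ : Sym2 V → ℤ) : MG V (Sym2 V) where
  es := G.edgeFinset
  x := fun e => (Quot.out e).1
  y := fun e => (Quot.out e).2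
  s := fun e => if σ e = -1 then 1 else 0

variable (G : SimpleGraph V) (σ : Sym2 V → ℤ)

lemma of_mk (e : Sym2 V) : s((ofGraph G σ).x e, (ofGraph G σ).y e) = e := by
  simp only [ofGraph]
  exact Quot.out_eq e

lemma of_ends (a b : V) : (ofGraph G σ).IsEnds s(a, b) a b := by
  have := of_mk G σ s(a, b)
  rw [Sym2.eq_iff] at this
  exact this

lemma of_cn (a b : V) (S : Finset V) :
    (ofGraph G σ).cn S s(a, b) = if (a ∈ S ↔ b ∈ S) then 0 else 1 := by
  unfold MG.cn
  rcases of_ends G σ a b with ⟨h1, h2⟩ | ⟨h1, h2⟩ <;> rw [h1, h2]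
  simp only [iff_comm]

lemma of_t (a b : V) (t : V → ZMod 2) :
    t ((ofGraph G σ).x s(a, b)) + t ((ofGraph G σ).y s(a, b)) = t a + t b := by
  rcases of_ends G σ a b with ⟨h1, h2⟩ | ⟨h1, h2⟩ <;> rw [h1, h2]
  exact add_comm _ _

lemma of_deg (p : Sym2 V → Prop) (u : V) :
    ∑ e ∈ (ofGraph G σ).es, (if p e then (ofGraph G σ).cn {u} e else 0) =
      {b | G.Adj u b ∧ p s(u, b)}.ncard := by
  have himg : ((G.edgeFinset.filter (fun e => p e ∧ u ∈ e)) : Set (Sym2 V)) =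
      (fun b => s(u, b)) '' {b | G.Adj u b ∧ p s(u, b)} := by
    ext e
    simp only [Finset.coe_filter, Set.mem_ofPred_eq, Set.mem_image, SimpleGraph.mem_edgeFinset]
    constructor
    · rintro ⟨he, hp, hu⟩
      obtain ⟨b, rfl⟩ := hu
      exact ⟨b, ⟨he, hp⟩, rfl⟩
    · rintro ⟨b, ⟨hb, hp⟩, rfl⟩
      exact ⟨hb, hp, by simp⟩
  rw [← Set.ncard_image_of_injective (f := fun b => s(u, b)) _ (fun a b h => Sym2.congr_right.1 h),
    ← himg, Set.ncard_coe_finset, Finset.card_filter]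
  apply Finset.sum_congr rfl
  intro e he
  replace he : e ∈ G.edgeSet := SimpleGraph.mem_edgeFinset.1 he
  induction e using Sym2.ind with
  | _ a b =>
    have hab : a ≠ b := G.ne_of_adj he
    rw [of_cn]
    simp only [Finset.mem_singleton, Sym2.mem_iff]
    grind

lemma of_good (hconn : KEdgeConnected G 6) (hreg : ∀ v : V, (G.neighborSet v).ncard = 6) :
    Good Finset.univ (ofGraph G σ) := by
  refine ⟨?_, ?_, ?_⟩
  · intro e he
    replace he : e ∈ G.edgeSet := SimpleGraph.mem_edgeFinset.1 he
    refine ⟨Finset.mem_univ _, Finset.mem_univ _, ?_⟩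
    rw [← of_mk G σ e] at he
    exact G.ne_of_adj he
  · intro v _
    have := of_deg G σ (fun _ => True) v
    simp only [if_true, and_true] at this
    rw [MG.d, this]
    exact hreg v
  · intro S _ hne hSA
    by_contra hlt
    push Not at hlt
    let C := G.edgeFinset.filter (fun e => (ofGraph G σ).cn S e = 1)
    have hC : C.card = (ofGraph G σ).d S := by
      rw [Finset.card_filter]
      apply Finset.sum_congr rfl
      intro e _
      unfold MG.cn
      split_ifs <;> simp_all
    have hcon := hconn.2 (C : Set (Sym2 V)) (by rw [Set.ncard_coe_finset, hC]; exact hlt)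
    obtain ⟨a, ha⟩ := hne
    obtain ⟨b, hb⟩ : ∃ b, b ∉ S := by
      by_contra h
      push Not at h
      exact hSA (Finset.eq_univ_iff_forall.2 h)
    obtain ⟨W⟩ := hcon.preconnected a b
    have : ∀ {a b : V}, (G.deleteEdges (C : Set (Sym2 V))).Walk a b → a ∈ S → b ∈ S := by
      intro a b W
      induction W with
      | nil => exact id
      | cons h _ ih =>
        intro hu
        apply ih
        by_contra hv
        rw [SimpleGraph.deleteEdges_adj] at h
        apply h.2
        simp only [C, Finset.coe_filter, Set.mem_ofPred_eq, SimpleGraph.mem_edgeFinset]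
        refine ⟨h.1, ?_⟩
        rw [of_cn]
        simp [hu, hv]
    exact hb (this W ha)

lemma of_notSingle (h2 : HasKEdgeDisjointUnbalancedCircuits G σ 2) :
    NotSingle (ofGraph G σ) := by
  obtain ⟨u, c, _, hodd, hdis⟩ := h2
  intro t e₀ _ hall
  have walk : ∀ {a b : V} (W : G.Walk a b),
      (W.edges.map (fun e => t ((ofGraph G σ).x e) + t ((ofGraph G σ).y e))).sum = t a + t b := by
    intro a b W
    induction W with
    | nil =>
      have : ∀ a : ZMod 2, 0 = a + a := by decide
      simpa using this _
    | cons h _ ih =>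
      rw [SimpleGraph.Walk.edges_cons, List.map_cons, List.sum_cons, ih, of_t]
      have : ∀ a b c : ZMod 2, a + b + (b + c) = a + c := by decide
      exact this _ _ _
  have cnt : ∀ L : List (Sym2 V), (L.map (ofGraph G σ).s).sum =
      ((L.countP (fun e => decide (σ e = -1)) : ℕ) : ZMod 2) := by
    intro L
    induction L with
    | nil => simp
    | cons e L ih =>
      rw [List.map_cons, List.sum_cons, ih, List.countP_cons]
      by_cases h : σ e = -1 <;> simp [ofGraph, h, add_comm]
  have key : ∀ i, e₀ ∈ (c i).edges := by
    intro i
    by_contra hni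
    have h1 := walk (c i)
    have h3 := cnt (c i).edges
    rw [ZMod.natCast_eq_one_iff_odd.2 (hodd i)] at h3
    have : ((c i).edges.map (fun e => (ofGraph G σ).s e +
        (t ((ofGraph G σ).x e) + t ((ofGraph G σ).y e)))).sum = 0 := by
      apply List.sum_eq_zero
      intro z hz
      obtain ⟨e, he, rfl⟩ := List.mem_map.1 hz
      have hee : e ≠ e₀ := by rintro rfl; exact hni he
      rw [hall e (SimpleGraph.mem_edgeFinset.2 ((c i).edges_subset_edgeSet he)), if_neg hee]
    rw [List.sum_map_add, h1, h3] at this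
    have h0 : ∀ a : ZMod 2, 1 + (a + a) ≠ 0 := by decide
    exact h0 _ this
  exact hdis 0 1 (by decide) e₀ (key 0) (key 1)

lemma of_total (hneg : Odd {e ∈ G.edgeSet | σ e = -1}.ncard) :
    ∑ e ∈ (ofGraph G σ).es, (ofGraph G σ).s e = 1 := by
  have : {e ∈ G.edgeSet | σ e = -1} = (G.edgeFinset.filter (fun e => σ e = -1) : Set _) := by
    ext e; simp
  rw [this, Set.ncard_coe_finset, Finset.card_filter] at hneg
  rw [← ZMod.natCast_eq_one_iff_odd] at hneg
  rw [← hneg]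
  push_cast
  rfl

/-- The subgraph of edges of colour `i`. -/
def colSub (c : Sym2 V → Fin 3) (i : Fin 3) : G.Subgraph where
  verts := {u | ∃ b, G.Adj u b ∧ c s(u, b) = i}
  Adj := fun a b => G.Adj a b ∧ c s(a, b) = i
  adj_sub := fun h => h.1
  edge_vert := fun h => ⟨_, h⟩
  symm := ⟨fun a b h => ⟨h.1.symm, by rw [Sym2.eq_swap]; exact h.2⟩⟩

lemma colSub_edge (c : Sym2 V → Fin 3) (i : Fin 3) (e : Sym2 V) :
    e ∈ (colSub G c i).edgeSet ↔ e ∈ G.edgeSet ∧ c e = i := by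
  induction e using Sym2.ind with
  | _ a b => rfl

lemma of_rooted (h : Rooted (ofGraph G σ)) :
    ∃ D : Fin 3 → G.Subgraph, IsRootedSigned3OddDecomposition G σ D := by
  obtain ⟨v, c, hc⟩ := h
  have hv : ∀ i, v ∈ (colSub G c i).verts := by
    intro i
    obtain ⟨h1, h2, h3⟩ := hc i
    by_contra hcon
    have hcon' : ∀ b, G.Adj v b → c s(v, b) ≠ i := fun b hb hb' => hcon ⟨b, hb, hb'⟩
    obtain ⟨e, he, hne⟩ := Finset.exists_ne_zero_of_sum_ne_zero (by rw [h2]; exact one_ne_zero)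
    have hce : c e = i := by
      by_contra h; simp [h] at hne
    have noend : ∀ e ∈ (ofGraph G σ).es, c e = i →
        (ofGraph G σ).x e ≠ v ∧ (ofGraph G σ).y e ≠ v := by
      intro e he hce
      replace he : e ∈ G.edgeSet := SimpleGraph.mem_edgeFinset.1 he
      rw [← of_mk G σ e] at he
      have hce' : c s((ofGraph G σ).x e, (ofGraph G σ).y e) = i := by rw [of_mk]; exact hce
      constructor
      · intro hx
        rw [hx] at he hce'
        exact hcon' _ he hce'
      · intro hy
        rw [hy] at he hce'
        rw [Sym2.eq_swap] at hce'
        exact hcon' _ (SimpleGraph.Adj.symm he) hce'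
    have := h3 {v} (by simp) (fun e he hce => by
      obtain ⟨p, q⟩ := noend e he hce
      simp [p, q]) e he hce
    exact (noend e he hce).1 (by simpa using this.1)
  refine ⟨colSub G c, ?_, ?_, ?_, ?_, v, hv⟩
  · intro i
    obtain ⟨h1, h2, h3⟩ := hc i
    constructor
    · rw [SimpleGraph.Subgraph.connected_iff']
      let S : Finset V := Finset.univ.filter (fun u => ∃ h : u ∈ (colSub G c i).verts,
        (colSub G c i).coe.Reachable ⟨v, hv i⟩ ⟨u, h⟩)
      have adjS : ∀ a b, (colSub G c i).Adj a b → a ∈ S → b ∈ S := by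
        intro a b hab ha
        obtain ⟨h, hr⟩ := (Finset.mem_filter.1 ha).2
        refine Finset.mem_filter.2 ⟨Finset.mem_univ _, (colSub G c i).edge_vert hab.symm, ?_⟩
        refine hr.trans (SimpleGraph.Adj.reachable ?_)
        exact hab
      have hvS : v ∈ S := Finset.mem_filter.2 ⟨Finset.mem_univ _, hv i, SimpleGraph.Reachable.refl _⟩
      have := h3 S hvS (by
        intro e he hce
        replace he : e ∈ G.edgeSet := SimpleGraph.mem_edgeFinset.1 he
        rw [← of_mk G σ e] at he
        rw [← of_mk G σ e] at hce
        have hadj : (colSub G c i).Adj ((ofGraph G σ).x e) ((ofGraph G σ).y e) := ⟨he, by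
          simpa only [of_mk] using hce⟩
        exact ⟨adjS _ _ hadj, adjS _ _ hadj.symm⟩)
      have hall : ∀ u (hu : u ∈ (colSub G c i).verts),
          (colSub G c i).coe.Reachable ⟨v, hv i⟩ ⟨u, hu⟩ := by
        intro u hu
        obtain ⟨b, hb, hb'⟩ := hu
        have hq := this s(u, b) (SimpleGraph.mem_edgeFinset.2 hb) hb'
        have huS : u ∈ S := by
          rcases of_ends G σ u b with ⟨p, q⟩ | ⟨p, q⟩
          · rw [p] at hq; exact hq.1
          · rw [q] at hq; exact hq.2
        obtain ⟨_, hr⟩ := (Finset.mem_filter.1 huS).2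
        exact hr
      have : Nonempty (colSub G c i).verts := ⟨⟨v, hv i⟩⟩
      exact ⟨fun a b => (hall a.1 a.2).symm.trans (hall b.1 b.2)⟩
    · intro u _
      have hd := of_deg G σ (fun e => c e = i) u
      change Even {b | G.Adj u b ∧ c s(u, b) = i}.ncard
      rw [← hd, ← ZMod.natCast_eq_zero_iff_even]
      rw [← h1 (fun z => if z = u then 1 else 0)]
      push_cast
      apply Finset.sum_congr rfl
      intro e _
      simp [cn_cast]
  · intro i
    obtain ⟨h1, h2, h3⟩ := hc i
    have : {e ∈ (colSub G c i).edgeSet | σ e = -1} =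
        (G.edgeFinset.filter (fun e => c e = i ∧ σ e = -1) : Set _) := by
      ext e; simp [colSub_edge, and_assoc]
    rw [this, Set.ncard_coe_finset, Finset.card_filter, ← ZMod.natCast_eq_one_iff_odd]
    rw [← h2]
    push_cast
    apply Finset.sum_congr rfl
    intro e _
    by_cases p : c e = i <;> simp [p, ofGraph]
  · intro i j hij
    rw [Set.disjoint_left]
    intro e he he'
    rw [colSub_edge] at he he'
    exact hij (he.2.symm.trans he'.2)
  · ext e
    simp [colSub_edge]

end final

end SixReg

/-- A 6-edge-connected 6-regular signed graph with an odd number of negative edges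
containing two edge-disjoint unbalanced circuits has a rooted signed 3-odd
decomposition. -/
theorem signed_sixRegular_rooted3OddDecomposition {V : Type*} [Fintype V]
    (G : SimpleGraph V) (σ : Sym2 V → ℤ)
    (hσ : ∀ e ∈ G.edgeSet, σ e = 1 ∨ σ e = -1)
    (hconn : KEdgeConnected G 6)
    (hreg : ∀ v : V, (G.neighborSet v).ncard = 6)
    (hneg : Odd {e ∈ G.edgeSet | σ e = -1}.ncard)
    (h2 : HasKEdgeDisjointUnbalancedCircuits G σ 2) :
    ∃ D : Fin 3 → G.Subgraph, IsRootedSigned3OddDecomposition G σ D := by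
  have hcard : 3 ≤ (Finset.univ : Finset V).card := by
    obtain ⟨v⟩ := hconn.1.nonempty
    have h6 := hreg v
    have h7 := Set.ncard_le_ncard (Set.subset_univ (G.neighborSet v)) Set.finite_univ
    rw [Set.ncard_univ, Nat.card_eq_fintype_card] at h7
    rw [Finset.card_univ]
    omega
  exact SixReg.of_rooted G σ (SixReg.main (Finset.univ.card - 3) Finset.univ
    (SixReg.ofGraph G σ) (by omega) (SixReg.of_good G σ hconn hreg)
    (SixReg.of_total G σ hneg) (SixReg.of_notSingle G σ h2))
end

section
/- Every finite 6-edge-connected 6-regular simple graph with an odd number of vertices admits a rooted 3-odd decomposition. -/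
open SimpleGraph

set_option linter.unusedSectionVars false

namespace OddDec

variable {V E : Type*}

/-- indicator that the edge `e` crosses the cut `X`. -/
def cr (s t : E → V) (X : V → Bool) (e : E) : ℕ := (xor (X (s e)) (X (t e))).toNat

/-- size of the cut `X`. -/
def cut (A : Finset E) (s t : E → V) (X : V → Bool) : ℕ := ∑ e ∈ A, cr s t X e

/-- odd indicator after switching at `Y`. -/
def ng (s t : E → V) (p : E → Bool) (Y : V → Bool) (e : E) : ℕ :=
  (xor (p e) (xor (Y (s e)) (Y (t e)))).toNat

/-- number of odd edges after switching at `Y`. -/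
def neg (A : Finset E) (s t : E → V) (p : E → Bool) (Y : V → Bool) : ℕ :=
  ∑ e ∈ A, ng s t p Y e

lemma cut_submod (A : Finset E) (s t : E → V) (X Y : V → Bool) :
    cut A s t (fun w => X w && Y w) + cut A s t (fun w => X w || Y w)
      ≤ cut A s t X + cut A s t Y := by
  unfold cut
  rw [← Finset.sum_add_distrib, ← Finset.sum_add_distrib]
  apply Finset.sum_le_sum
  intro e _
  simp only [cr]
  cases X (s e) <;> cases X (t e) <;> cases Y (s e) <;> cases Y (t e) <;> decide

lemma cut_posimod (A : Finset E) (s t : E → V) (X Y : V → Bool) (e : E) (he : e ∈ A)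
    (h : (X (s e) = true ∧ Y (s e) = true ∧ X (t e) = false ∧ Y (t e) = false) ∨
      (X (t e) = true ∧ Y (t e) = true ∧ X (s e) = false ∧ Y (s e) = false)) :
    cut A s t (fun w => X w && !Y w) + cut A s t (fun w => Y w && !X w)
      < cut A s t X + cut A s t Y := by
  unfold cut
  rw [← Finset.sum_add_distrib, ← Finset.sum_add_distrib]
  apply Finset.sum_lt_sum
  · intro e _
    simp only [cr]
    cases X (s e) <;> cases X (t e) <;> cases Y (s e) <;> cases Y (t e) <;> decide
  · refine ⟨e, he, ?_⟩
    unfold cr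
    rcases h with ⟨h1, h2, h3, h4⟩ | ⟨h1, h2, h3, h4⟩ <;> simp [h1, h2, h3, h4]

lemma cut_compl (A : Finset E) (s t : E → V) (X : V → Bool) :
    cut A s t (fun w => !X w) = cut A s t X := by
  unfold cut
  apply Finset.sum_congr rfl
  intro e _
  simp only [cr]
  cases X (s e) <;> cases X (t e) <;> decide

lemma neg_switch (A : Finset E) (s t : E → V) (p : E → Bool) (X Y : V → Bool) :
    neg A s t p (fun w => xor (Y w) (X w)) + 2 * (∑ e ∈ A, ng s t p Y e * cr s t X e)
      = neg A s t p Y + cut A s t X := by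
  unfold neg cut
  rw [Finset.mul_sum, ← Finset.sum_add_distrib, ← Finset.sum_add_distrib]
  apply Finset.sum_congr rfl
  intro e _
  simp only [cr, ng]
  cases X (s e) <;> cases X (t e) <;> cases Y (s e) <;> cases Y (t e) <;> cases p e <;> decide

variable [DecidableEq V] [DecidableEq E]

/-- singleton cut -/
def sing (w : V) : V → Bool := fun x => decide (x = w)

structure Inv (A : Finset E) (s t : E → V) (F : Finset V) (u : V) : Prop where
  uF : u ∉ F
  ends : ∀ e ∈ A, (s e ∈ F ∨ s e = u) ∧ (t e ∈ F ∨ t e = u)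
  noloop : ∀ e ∈ A, s e ≠ t e
  even : ∀ X, Even (cut A s t X)
  conn : ∀ X : V → Bool, ∀ a ∈ F, ∀ b ∈ F, X a = true → X b = false → 6 ≤ cut A s t X
  deg : ∀ w ∈ F, cut A s t (sing w) ≤ 6

/-- the other end -/
def oth (s t : E → V) (u : V) (e : E) : V := if s e = u then t e else s e

/-- new source after splitting -/
def ns (s t : E → V) (u : V) (e : E) : E → V := Function.update s e (oth s t u e)
/-- new target after splitting -/
def nt (s t : E → V) (u : V) (e f : E) : E → V := Function.update t e (oth s t u f)
/-- new sign after splitting -/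
def np (p : E → Bool) (e f : E) : E → Bool := Function.update p e (xor (p e) (p f))

lemma sum_split (B : Finset E) (g g' : E → ℕ) (e f : E) (he : e ∈ B) (hf : f ∈ B) (hef : e ≠ f)
    (h : ∀ x, x ≠ e → g' x = g x) :
    (∑ x ∈ B, g x) + g' e = (∑ x ∈ B.erase f, g' x) + g e + g f := by
  rw [← Finset.add_sum_erase B g hf]
  have he' : e ∈ B.erase f := Finset.mem_erase.2 ⟨hef, he⟩
  rw [← Finset.add_sum_erase _ g he', ← Finset.add_sum_erase _ g' he']
  have : ∑ x ∈ (B.erase f).erase e, g x = ∑ x ∈ (B.erase f).erase e, g' x := by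
    apply Finset.sum_congr rfl
    intro x hx
    exact (h x (Finset.ne_of_mem_erase hx)).symm
  omega

lemma cr_oth (s t : E → V) (u : V) (e : E) (he : s e = u ∨ t e = u) (X : V → Bool) :
    cr s t X e = (xor (X u) (X (oth s t u e))).toNat := by
  unfold cr oth
  by_cases h : s e = u
  · simp [h]
  · have h2 : t e = u := by tauto
    simp [h, h2, Bool.xor_comm]

lemma cr_new (s t : E → V) (u : V) (e f : E) (X : V → Bool) :
    cr (ns s t u e) (nt s t u e f) X e = (xor (X (oth s t u e)) (X (oth s t u f))).toNat := by
  simp [cr, ns, nt]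

lemma cr_new_ne (s t : E → V) (u : V) (e f x : E) (hx : x ≠ e) (X : V → Bool) :
    cr (ns s t u e) (nt s t u e f) X x = cr s t X x := by
  simp [cr, ns, nt, hx]

lemma cut_split (B : Finset E) (s t : E → V) (u : V) (e f : E) (he : e ∈ B) (hf : f ∈ B)
    (hef : e ≠ f) (hue : s e = u ∨ t e = u) (huf : s f = u ∨ t f = u) (X : V → Bool) :
    cut B s t X = cut (B.erase f) (ns s t u e) (nt s t u e f) X +
      (if X (oth s t u e) = X (oth s t u f) ∧ X u ≠ X (oth s t u e) then 2 else 0) := by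
  have := sum_split B (cr s t X) (cr (ns s t u e) (nt s t u e f) X) e f he hf hef
    (fun x hx => cr_new_ne s t u e f x hx X)
  rw [cr_new, cr_oth s t u e hue, cr_oth s t u f huf] at this
  unfold cut
  revert this
  cases X u <;> cases X (oth s t u e) <;> cases X (oth s t u f) <;> simp

lemma cut_split_not (B : Finset E) (s t : E → V) (u : V) (e f : E) (he : e ∉ B) (hf : f ∉ B)
    (X : V → Bool) :
    cut (B.erase f) (ns s t u e) (nt s t u e f) X = cut B s t X := by
  rw [Finset.erase_eq_of_notMem hf]
  apply Finset.sum_congr rfl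
  intro x hx
  apply cr_new_ne
  rintro rfl
  exact he hx

lemma neg_split (B : Finset E) (s t : E → V) (p : E → Bool) (u : V) (e f : E) (he : e ∈ B)
    (hf : f ∈ B)
    (hef : e ≠ f) (hue : s e = u ∨ t e = u) (huf : s f = u ∨ t f = u) (X : V → Bool) :
    neg B s t p X = neg (B.erase f) (ns s t u e) (nt s t u e f) (np p e f) X ∨
    neg B s t p X = neg (B.erase f) (ns s t u e) (nt s t u e f) (np p e f) X + 2 := by
  have := sum_split B (ng s t p X) (ng (ns s t u e) (nt s t u e f) (np p e f) X) e f he hf hef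
    (fun x hx => by simp [ng, ns, nt, np, hx])
  have h1 : ng (ns s t u e) (nt s t u e f) (np p e f) X e =
    (xor (xor (p e) (p f)) (xor (X (oth s t u e)) (X (oth s t u f)))).toNat := by
    simp [ng, ns, nt, np]
  have h2 : ∀ x, (s x = u ∨ t x = u) →
      ng s t p X x = (xor (p x) (xor (X u) (X (oth s t u x)))).toNat := by
    intro x hx
    unfold ng oth
    by_cases h : s x = u
    · simp [h]
    · have h2 : t x = u := by tauto
      simp [h, h2, Bool.xor_comm]
  rw [h1, h2 e hue, h2 f huf] at this
  unfold neg
  revert this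
  cases X u <;> cases X (oth s t u e) <;> cases X (oth s t u f) <;> cases p e <;> cases p f <;>
    simp <;> omega

lemma neg_split_not (B : Finset E) (s t : E → V) (p : E → Bool) (u : V) (e f : E) (he : e ∉ B)
    (hf : f ∉ B) (X : V → Bool) :
    neg (B.erase f) (ns s t u e) (nt s t u e f) (np p e f) X = neg B s t p X := by
  rw [Finset.erase_eq_of_notMem hf]
  apply Finset.sum_congr rfl
  intro x hx
  have : x ≠ e := by rintro rfl; exact he hx
  simp [ng, ns, nt, np, this]

lemma oth_ne (s t : E → V) (u : V) (e : E) (h : s e ≠ t e) : oth s t u e ≠ u := by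
  unfold oth
  split_ifs with h1
  · rw [h1] at h; exact h.symm
  · exact h1

lemma oth_mem {A : Finset E} {s t : E → V} {F : Finset V} {u : V} (I : Inv A s t F u)
    {e : E} (he : e ∈ A) : oth s t u e ∈ F := by
  have h1 := oth_ne s t u e (I.noloop e he)
  have h2 := I.ends e he
  have h3 : oth s t u e = s e ∨ oth s t u e = t e := by
    unfold oth; split_ifs <;> simp
  rcases h3 with h3 | h3 <;> rw [h3] at h1 ⊢ <;> tauto

/-- The splitting lemma. -/
lemma exists_split [Fintype V] {A : Finset E} {s t : E → V} {F : Finset V} {u : V}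
    (I : Inv A s t F u) (hF : 2 ≤ F.card) {e : E} (he : e ∈ A) (hue : s e = u ∨ t e = u) :
    ∃ f ∈ A, e ≠ f ∧ (s f = u ∨ t f = u) ∧
      Inv (A.erase f) (ns s t u e) (nt s t u e f) F u := by
  classical
  by_contra hcon
  push Not at hcon
  set a := oth s t u e with ha
  have haF : a ∈ F := oth_mem I he
  have hau : a ≠ u := oth_ne s t u e (I.noloop e he)
  let P : (V → Bool) → Prop := fun X =>
    X a = true ∧ X u = false ∧ (∃ b ∈ F, X b = false) ∧ cut A s t X ≤ 6
  -- each f yields a tight set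
  have key : ∀ f ∈ A, e ≠ f → (s f = u ∨ t f = u) → ∃ X, P X ∧ X (oth s t u f) = true := by
    intro f hf hef huf
    by_contra hno
    have hfF := oth_mem I hf
    have hcut := cut_split A s t u e f he hf hef hue huf
    have hconn : ∀ X : V → Bool, ∀ a ∈ F, ∀ b ∈ F, X a = true → X b = false →
        6 ≤ cut (A.erase f) (ns s t u e) (nt s t u e f) X := by
      intro X x hx y hy hXx hXy
      by_contra hlt
      have h6 := I.conn X x hx y hy hXx hXy
      have hc := hcut X
      split_ifs at hc with hcond
      · obtain ⟨h1, h2⟩ := hcond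
        have hev := I.even X
        obtain ⟨k, hk⟩ := hev
        cases hXu : X u
        · rw [hXu] at h2
          apply hno
          refine ⟨X, ⟨by simpa using h2.symm, hXu, ⟨y, hy, hXy⟩, by omega⟩, ?_⟩
          rw [← h1]; simpa using h2.symm
        · rw [hXu] at h2
          apply hno
          refine ⟨fun w => !X w, ⟨by simpa using h2.symm, by simp [hXu], ⟨x, hx, by simp [hXx]⟩, ?_⟩, ?_⟩
          · rw [cut_compl]; omega
          · simp only [← h1]; simpa using h2.symm
      · omega
    have hdeg : ∀ w ∈ F, cut (A.erase f) (ns s t u e) (nt s t u e f) (sing w) ≤ 6 := by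
      intro w hw
      have := I.deg w hw
      have h2 := hcut (sing w)
      omega
    refine hcon f hf hef huf ⟨I.uF, ?_, ?_, ?_, hconn, hdeg⟩
    · intro x hx
      have hx' := Finset.mem_of_mem_erase hx
      by_cases hxe : x = e
      · subst hxe
        simp [ns, nt, hfF, ← ha, haF]
      · simp only [ns, nt, Function.update_of_ne hxe]
        exact I.ends x hx'
    · intro x hx
      have hx' := Finset.mem_of_mem_erase hx
      by_cases hxe : x = e
      · subst hxe
        simp only [ns, nt, Function.update_self]
        intro hab
        obtain ⟨b, hb, hba⟩ := Finset.exists_mem_ne (by omega : 1 < F.card) a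
        have h1 := hconn (sing a) a haF b hb (by simp [sing]) (by simp [sing, hba])
        have h2 := hcut (sing a)
        have h3 := I.deg a haF
        rw [← hab, if_pos] at h2
        · omega
        · refine ⟨rfl, ?_⟩
          simp [sing, ← ha, hau.symm]
      · simp only [ns, nt, Function.update_of_ne hxe]
        exact I.noloop x hx'
    · intro X
      have h1 := I.even X
      have h2 := hcut X
      rw [h2] at h1
      split_ifs at h1
      · exact (Nat.even_add.1 h1).2 (by decide)
      · simpa using h1
  -- union closed
  have uni : ∀ X Y, P X → P Y → P (fun w => X w || Y w) := by
    rintro X Y ⟨hXa, hXu, ⟨x, hx, hXx⟩, hX⟩ ⟨hYa, hYu, ⟨y, hy, hYy⟩, hY⟩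
    by_cases hb : ∃ b ∈ F, (X b || Y b) = false
    · refine ⟨by simp [hXa], by simp [hXu, hYu], hb, ?_⟩
      obtain ⟨b, hb, hb'⟩ := hb
      have h1 := cut_submod A s t X Y
      have h2 := I.conn (fun w => X w && Y w) a haF x hx (by simp [hXa, hYa]) (by simp [hXx])
      omega
    · exfalso
      push Not at hb
      have hx2 : Y x = true := by have := hb x hx; simpa [hXx] using this
      have hy2 : X y = true := by have := hb y hy; simpa [hYy] using this
      have h1 := I.conn (fun w => X w && !Y w) y hy a haF (by simp [hYy, hy2]) (by simp [hYa])
      have h2 := I.conn (fun w => Y w && !X w) x hx a haF (by simp [hXx, hx2]) (by simp [hXa])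
      have h3 := cut_posimod A s t X Y e he (by
        by_cases h : s e = u
        · have : a = t e := by simp [ha, oth, h]
          right; rw [← this, h]; exact ⟨hXa, hYa, hXu, hYu⟩
        · have h' : t e = u := by tauto
          have : a = s e := by simp [ha, oth, h]
          left; rw [← this, h']; exact ⟨hXa, hYa, hXu, hYu⟩)
      omega
  -- there is some other edge
  have hex : ∃ f ∈ A, e ≠ f ∧ (s f = u ∨ t f = u) := by
    by_contra hno
    push Not at hno
    have h1 := I.even (sing u)
    have : cut A s t (sing u) = 1 := by
      unfold cut
      rw [Finset.sum_eq_single e]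
      · rw [cr_oth s t u e hue]; simp [sing, ← ha, hau]
      · intro x hx hxe
        have := hno x hx (Ne.symm hxe)
        simp [cr, sing, this]
      · intro h; exact absurd he h
    rw [this] at h1
    exact absurd h1 (by decide)
  obtain ⟨f0, hf0, hef0, huf0⟩ := hex
  obtain ⟨X0, hX0, -⟩ := key f0 hf0 hef0 huf0
  obtain ⟨M, hM⟩ := (Set.toFinite {X | P X}).exists_maximal ⟨X0, hX0⟩
  have hMP : P M := hM.1
  have hle : ∀ X, P X → ∀ w, X w = true → M w = true := by
    intro X hX w hw
    have h1 := uni M X hMP hX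
    have h2 := hM.2 (show (fun w => M w || X w) ∈ {X | P X} from h1)
      (fun w hh => by simp [hh]) w
    simp only [hw, Bool.or_true] at h2
    exact h2 rfl
  obtain ⟨hMa, hMu, ⟨b, hb, hMb⟩, hM6⟩ := hMP
  have hnb : ∀ f ∈ A, (s f = u ∨ t f = u) → M (oth s t u f) = true := by
    intro f hf huf
    by_cases hef : e = f
    · rw [← hef]; exact hMa
    · obtain ⟨X, hX, hX2⟩ := key f hf hef huf
      exact hle X hX _ hX2
  have h1 := I.conn (fun w => M w || decide (w = u)) a haF b hb (by simp [hMa])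
    (by simp only [hMb, Bool.false_or, decide_eq_false_iff_not]; rintro rfl; exact I.uF hb)
  have h2 : cut A s t (fun w => M w || decide (w = u)) < cut A s t M := by
    unfold cut
    apply Finset.sum_lt_sum
    · intro x hx
      by_cases hxu : s x = u ∨ t x = u
      · rw [cr_oth s t u x hxu, cr_oth s t u x hxu]
        simp [hnb x hx hxu]
      · push Not at hxu
        simp [cr, hxu]
    · refine ⟨e, he, ?_⟩
      rw [cr_oth s t u e hue, cr_oth s t u e hue]
      simp [hnb e he hue, hMu]
  omega

end OddDec

namespace OddDec
variable {V E : Type*} [DecidableEq V] [DecidableEq E]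

/-- colour class -/
def col {K : Type*} [DecidableEq K] (A : Finset E) (c : E → K) (i : K) : Finset E :=
  A.filter (fun e => c e = i)

/-- every edge of colour `i` is connected to `v` within the colour class, phrased by cuts -/
def Conn {K : Type*} (A : Finset E) (s t : E → V) (c : E → K) (v : V) (i : K) : Prop :=
  ∀ X : V → Bool, X v = true → (∀ e ∈ A, c e = i → X (s e) = X (t e)) →
    ∀ e ∈ A, c e = i → X (s e) = true

lemma mem_col {K : Type*} [DecidableEq K] {A : Finset E} {c : E → K} {i : K} {x : E} :
    x ∈ col A c i ↔ x ∈ A ∧ c x = i := Finset.mem_filter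

section lift
variable {K : Type*} [DecidableEq K] (A : Finset E) (s t : E → V) (u : V) (e f : E)

/-- lifted colouring -/
def lc (c : E → K) (e f : E) : E → K := Function.update c f (c e)

lemma col_lc (c : E → K) (i : K) : col (A.erase f) c i = (col A (lc c e f) i).erase f := by
  ext x
  simp only [mem_col, Finset.mem_erase, lc]
  by_cases hx : x = f
  · simp [hx]
  · simp [hx]

lemma mem_col_lc (c : E → K) (i : K) (he : e ∈ A) (hf : f ∈ A) (hef : e ≠ f) :
    (e ∈ col A (lc c e f) i ∧ f ∈ col A (lc c e f) i) ∨
    (e ∉ col A (lc c e f) i ∧ f ∉ col A (lc c e f) i) := by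
  simp only [mem_col, lc, he, hf, Function.update_self, Function.update_of_ne hef,
    true_and]
  tauto

lemma lift_cut (he : e ∈ A)
    (hf : f ∈ A) (hef : e ≠ f) (hue : s e = u ∨ t e = u) (huf : s f = u ∨ t f = u) (c : E → K) (i : K) (X : V → Bool) :
    cut (col A (lc c e f) i) s t X % 2 =
      cut (col (A.erase f) c i) (ns s t u e) (nt s t u e f) X % 2 := by
  rw [col_lc A e f]
  rcases mem_col_lc A e f c i he hf hef with ⟨h1, h2⟩ | ⟨h1, h2⟩
  · rw [cut_split _ s t u e f h1 h2 hef hue huf]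
    split_ifs <;> omega
  · rw [cut_split_not _ s t u e f h1 h2]

lemma lift_neg (he : e ∈ A)
    (hf : f ∈ A) (hef : e ≠ f) (hue : s e = u ∨ t e = u) (huf : s f = u ∨ t f = u) (c : E → K) 
    (p : E → Bool) (i : K) (X : V → Bool) :
    neg (col A (lc c e f) i) s t p X % 2 =
      neg (col (A.erase f) c i) (ns s t u e) (nt s t u e f) (np p e f) X % 2 := by
  rw [col_lc A e f]
  rcases mem_col_lc A e f c i he hf hef with ⟨h1, h2⟩ | ⟨h1, h2⟩
  · rcases neg_split _ s t p u e f h1 h2 hef hue huf X with h | h <;> omega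
  · rw [neg_split_not _ s t p u e f h1 h2]

lemma lift_conn (he : e ∈ A)
    (hf : f ∈ A) (hef : e ≠ f) (hue : s e = u ∨ t e = u) (huf : s f = u ∨ t f = u) (c : E → K) 
    (v : V) (i : K)
    (h : Conn (A.erase f) (ns s t u e) (nt s t u e f) c v i) : Conn A s t (lc c e f) v i := by
  intro X hv hX
  have hoth : ∀ x, (s x = u ∨ t x = u) → X (s x) = X (t x) →
      X (oth s t u x) = X (s x) ∧ X u = X (s x) := by
    intro x hx hxx
    unfold oth
    by_cases h : s x = u
    · simp only [h, if_true]; rw [h] at hxx; exact ⟨hxx.symm, trivial⟩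
    · have h2 : t x = u := by tauto
      simp only [h, if_false]; rw [h2] at hxx; exact ⟨trivial, hxx.symm⟩
  have hlce : lc c e f e = c e := by simp [lc, hef]
  have hlcf : lc c e f f = c e := by simp [lc]
  have hlcx : ∀ x, x ≠ f → lc c e f x = c x := by intro x hx; simp [lc, hx]
  have key := h X hv (by
    intro x hx hxi
    have hx' := Finset.mem_erase.1 hx
    by_cases hxe : x = e
    · subst hxe
      simp only [ns, nt, Function.update_self]
      have h1 := hoth x hue (hX x he (by rw [hlce, hxi]))
      have h2 := hoth f huf (hX f hf (by rw [hlcf, hxi]))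
      rw [h1.1, h2.1, ← h1.2, h2.2]
    · simp only [ns, nt, Function.update_of_ne hxe]
      exact hX x hx'.2 (by rw [hlcx x hx'.1, hxi]))
  have hee : c e = i → X (s e) = true := by
    intro hi
    have h1 := key e (Finset.mem_erase.2 ⟨hef, he⟩) hi
    simp only [ns, Function.update_self] at h1
    rw [← (hoth e hue (hX e he (by rw [hlce, hi]))).1, h1]
  intro x hx hxi
  by_cases hxf : x = f
  · subst hxf
    rw [hlcf] at hxi
    have h1 := hoth e hue (hX e he (by rw [hlce, hxi]))
    have h2 := hoth x huf (hX x hf (by rw [hlcf, hxi]))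
    rw [← h2.2, h1.2]; exact hee hxi
  · rw [hlcx x hxf] at hxi
    by_cases hxe : x = e
    · subst hxe; exact hee hxi
    · have h1 := key x (Finset.mem_erase.2 ⟨hxf, hx⟩) hxi
      simpa only [ns, Function.update_of_ne hxe] using h1

end lift

lemma Inv.next {A : Finset E} {s t : E → V} {F : Finset V} {u : V}
    (I : Inv A s t F u) (hu : ¬ ∃ e ∈ A, s e = u ∨ t e = u) {w : V} (_hw : w ∈ F) :
    Inv A s t (F.erase w) w := by
  push Not at hu
  refine ⟨by simp, ?_, I.noloop, I.even, ?_, ?_⟩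
  · intro e he
    have h1 := I.ends e he
    have h2 := hu e he
    simp only [Finset.mem_erase]
    tauto
  · intro X a ha b hb
    exact I.conn X a (Finset.mem_of_mem_erase ha) b (Finset.mem_of_mem_erase hb)
  · intro x hx
    exact I.deg x (Finset.mem_of_mem_erase hx)

/-- base situation: all edges between `v` and `z`. -/
lemma base_ends {A : Finset E} {s t : E → V} {F : Finset V} {u : V}
    (I : Inv A s t F u) (hu : ¬ ∃ e ∈ A, s e = u ∨ t e = u) {v z : V}
    (hF : ∀ w ∈ F, w = v ∨ w = z) :
    ∀ e ∈ A, (s e = v ∧ t e = z) ∨ (s e = z ∧ t e = v) := by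
  push Not at hu
  intro e he
  have h1 := I.ends e he
  have h2 := hu e he
  have h3 := I.noloop e he
  have h4 := hF (s e)
  have h5 := hF (t e)
  have h6 : s e = v ∨ s e = z := by tauto
  have h7 : t e = v ∨ t e = z := by tauto
  rcases h6 with h6 | h6 <;> rcases h7 with h7 | h7
  · exact absurd (h6.trans h7.symm) h3
  · exact Or.inl ⟨h6, h7⟩
  · exact Or.inr ⟨h6, h7⟩
  · exact absurd (h6.trans h7.symm) h3

lemma base_card {A : Finset E} {s t : E → V} {F : Finset V} {u : V}
    (I : Inv A s t F u) (hu : ¬ ∃ e ∈ A, s e = u ∨ t e = u) {v z : V} (hv : v ∈ F) (hz : z ∈ F)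
    (hvz : v ≠ z) (hF : ∀ w ∈ F, w = v ∨ w = z) : A.card = 6 := by
  have h := base_ends I hu hF
  have h1 : cut A s t (sing v) = A.card := by
    unfold cut
    rw [Finset.card_eq_sum_ones]
    apply Finset.sum_congr rfl
    intro e he
    rcases h e he with ⟨h1, h2⟩ | ⟨h1, h2⟩ <;> simp [cr, sing, h1, h2, hvz.symm]
  have h2 := I.deg v hv
  have h3 := I.conn (sing v) v hv z hz (by simp [sing]) (by simp [sing, hvz.symm])
  omega

theorem menger6 [Fintype V] : ∀ n, ∀ (A : Finset E) (s t : E → V) (F : Finset V) (u v z : V),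
    A.card + F.card ≤ n → Inv A s t F u → v ∈ F → z ∈ F → v ≠ z →
    ∃ c : E → Fin 6, ∀ i, (∀ X, cut (col A c i) s t X % 2 = (xor (X v) (X z)).toNat) ∧
      Conn A s t c v i := by
  intro n
  induction n with
  | zero =>
    intro A s t F u v z hn I hv
    have : F.card = 0 := by omega
    rw [Finset.card_eq_zero] at this
    simp [this] at hv
  | succ n ih =>
    intro A s t F u v z hn I hv hz hvz
    have hF2 : 2 ≤ F.card := Finset.one_lt_card.2 ⟨v, hv, z, hz, hvz⟩
    by_cases hu : ∃ e ∈ A, s e = u ∨ t e = u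
    · obtain ⟨e, he, hue⟩ := hu
      obtain ⟨f, hf, hef, huf, I'⟩ := exists_split I hF2 he hue
      have hcard := Finset.card_erase_add_one hf
      obtain ⟨c, hc⟩ := ih _ _ _ F u v z (by omega) I' hv hz hvz
      refine ⟨lc c e f, fun i => ⟨fun X => ?_, ?_⟩⟩
      · rw [lift_cut A s t u e f he hf hef hue huf]
        exact (hc i).1 X
      · exact lift_conn A s t u e f he hf hef hue huf c v i (hc i).2
    · by_cases hw : ∃ w ∈ F, w ≠ v ∧ w ≠ z
      · obtain ⟨w, hw, hwv, hwz⟩ := hw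
        have hcard := Finset.card_erase_add_one hw
        exact ih A s t (F.erase w) w v z (by omega) (I.next hu hw)
          (Finset.mem_erase.2 ⟨hwv.symm, hv⟩) (Finset.mem_erase.2 ⟨hwz.symm, hz⟩) hvz
      · have hF : ∀ w ∈ F, w = v ∨ w = z := by
          intro w hw'
          by_contra hcon
          exact hw ⟨w, hw', by tauto, by tauto⟩
        have hends := base_ends I hu hF
        have hcard := base_card I hu hv hz hvz hF
        let φ := Finset.equivFinOfCardEq hcard
        let c : E → Fin 6 := fun e => if h : e ∈ A then φ ⟨e, h⟩ else 0
        have hcol : ∀ i, col A c i = {(φ.symm i : E)} := by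
          intro i
          ext x
          simp only [mem_col, Finset.mem_singleton]
          constructor
          · rintro ⟨hx, hxi⟩
            simp only [c, hx, dif_pos] at hxi
            rw [← hxi]; simp
          · rintro rfl
            have hm : (φ.symm i : E) ∈ A := (φ.symm i).2
            refine ⟨hm, ?_⟩
            simp only [c, hm, dif_pos]
            simp
        refine ⟨c, fun i => ⟨fun X => ?_, ?_⟩⟩
        · rw [hcol, cut, Finset.sum_singleton, cr]
          rcases hends _ (φ.symm i).2 with ⟨h1, h2⟩ | ⟨h1, h2⟩ <;> rw [h1, h2] <;>
            cases X v <;> cases X z <;> rfl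
        · intro X hXv hX e he hei
          rcases hends e he with ⟨h1, h2⟩ | ⟨h1, h2⟩
          · rw [h1, hXv]
          · rw [hX e he hei, h2, hXv]

end OddDec

namespace OddDec
variable {V E : Type*} [DecidableEq V] [DecidableEq E]

/-- sources of the graph where odd edges are subdivided at the common vertex `none` -/
def s2 (s t : E → V) : E ⊕ E → Option V := Sum.elim (fun e => some (s e)) (fun e => some (t e))
/-- targets -/
def t2 (t : E → V) (q : E → Bool) : E ⊕ E → Option V :=
  Sum.elim (fun e => if q e = true then none else some (t e)) (fun _ => none)
/-- edges -/
def A2 (A : Finset E) (q : E → Bool) : Finset (E ⊕ E) :=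
  A.disjSum (A.filter (fun e => q e = true))

lemma inl_mem_A2 {A : Finset E} {q : E → Bool} {e : E} : Sum.inl e ∈ A2 A q ↔ e ∈ A := by
  simp [A2]

lemma inr_mem_A2 {A : Finset E} {q : E → Bool} {e : E} :
    Sum.inr e ∈ A2 A q ↔ e ∈ A ∧ q e = true := by
  simp [A2]

lemma cut2 (A : Finset E) (s t : E → V) (q : E → Bool) (X : Option V → Bool)
    (hX : X none = false) :
    cut (A2 A q) (s2 s t) (t2 t q) X = cut A s t (fun w => X (some w)) +
      2 * ∑ e ∈ A, (q e).toNat * (X (some (s e)) && X (some (t e))).toNat := by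
  unfold cut A2
  rw [Finset.sum_disjSum, Finset.sum_filter, Finset.mul_sum, ← Finset.sum_add_distrib,
    ← Finset.sum_add_distrib]
  apply Finset.sum_congr rfl
  intro e _
  simp only [cr, s2, t2, Sum.elim_inl, Sum.elim_inr, hX]
  cases q e <;> cases h1 : X (some (s e)) <;> cases h2 : X (some (t e)) <;> simp [hX, h2]

lemma inv2 {A : Finset E} {s t : E → V} {F : Finset V} {u : V} (I : Inv A s t F u)
    (p : E → Bool) (Y : V → Bool) (hneg : ∀ Z, 3 ≤ neg A s t p Z) (h3 : neg A s t p Y = 3)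
    (q : E → Bool) (hq : ∀ e, q e = xor (p e) (xor (Y (s e)) (Y (t e)))) :
    Inv (A2 A q) (s2 s t) (t2 t q) (Finset.insertNone F) (some u) := by
  have hng : ∀ e, (q e).toNat = ng s t p Y e := by intro e; rw [hq]; rfl
  have hsum : ∑ e ∈ A, (q e).toNat = 3 := by
    rw [← h3]; exact Finset.sum_congr rfl (fun e _ => hng e)
  have hev0 : ∀ X : Option V → Bool, X none = false →
      Even (cut (A2 A q) (s2 s t) (t2 t q) X) := by
    intro X hX
    rw [cut2 A s t q X hX]
    exact (I.even _).add (even_two_mul _)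
  have hconn0 : ∀ X : Option V → Bool, X none = false → ∀ a ∈ F, X (some a) = true →
      6 ≤ cut (A2 A q) (s2 s t) (t2 t q) X := by
    intro X hX a ha hXa
    rw [cut2 A s t q X hX]
    by_cases hb : ∃ b ∈ F, X (some b) = false
    · obtain ⟨b, hb, hXb⟩ := hb
      have := I.conn (fun w => X (some w)) a ha b hb hXa hXb
      omega
    · push Not at hb
      have h1 := neg_switch A s t p (fun w => X (some w)) Y
      have h2 := hneg (fun w => xor (Y w) (X (some w)))
      have h4 : ∑ e ∈ A, ng s t p Y e * cr s t (fun w => X (some w)) e +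
        ∑ e ∈ A, (q e).toNat * (X (some (s e)) && X (some (t e))).toNat = 3 := by
        rw [← hsum, ← Finset.sum_add_distrib]
        apply Finset.sum_congr rfl
        intro e he
        rw [← hng, ← mul_add]
        have h5 : X (some (s e)) = true ∨ X (some (t e)) = true := by
          by_contra hno
          push Not at hno
          have h6 := I.ends e he
          have h7 : s e = u := by
            rcases h6.1 with h | h
            · exact absurd (by simpa using hb _ h) hno.1
            · exact h
          have h8 : t e = u := by
            rcases h6.2 with h | h
            · exact absurd (by simpa using hb _ h) hno.2
            · exact h
          exact I.noloop e he (h7.trans h8.symm)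
        have h9 : cr s t (fun w => X (some w)) e +
            (X (some (s e)) && X (some (t e))).toNat = 1 := by
          simp only [cr]
          revert h5
          cases X (some (s e)) <;> cases X (some (t e)) <;> simp
        rw [h9, mul_one]
      omega
  refine ⟨?_, ?_, ?_, ?_, ?_, ?_⟩
  · simpa using I.uF
  · rintro (e | e) he
    · rw [inl_mem_A2] at he
      have := I.ends e he
      simp only [s2, t2, Sum.elim_inl]
      split_ifs <;> simp [this]
    · rw [inr_mem_A2] at he
      have := I.ends e he.1
      simp [s2, t2, this]
  · rintro (e | e) he
    · rw [inl_mem_A2] at he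
      have := I.noloop e he
      simp only [s2, t2, Sum.elim_inl]
      split_ifs <;> simp [this]
    · simp [s2, t2]
  · intro X
    cases hX : X none
    · exact hev0 X hX
    · rw [← cut_compl]
      exact hev0 _ (by simp [hX])
  · intro X a ha b hb hXa hXb
    cases hX : X none
    · cases a with
      | none => rw [hX] at hXa; cases hXa
      | some a => exact hconn0 X hX a (by simpa using ha) hXa
    · rw [← cut_compl]
      cases b with
      | none => rw [hX] at hXb; cases hXb
      | some b => exact hconn0 _ (by simp [hX]) b (by simpa using hb) (by simp [hXb])
  · intro w hw
    cases w with
    | none =>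
      rw [← cut_compl, cut2 A s t q _ (by simp [sing])]
      have : cut A s t (fun w => !sing none (some w)) = 0 := by
        simp [cut, cr, sing]
      rw [this]
      simp only [sing]
      simp [hsum]
    | some w =>
      have hw : w ∈ F := by simpa using hw
      rw [cut2 A s t q _ (by simp [sing])]
      have h1 : (fun x => sing (some w) (some x)) = sing w := by
        funext x; simp [sing]
      have h2 : ∑ e ∈ A, (q e).toNat * (sing (some w) (some (s e)) &&
          sing (some w) (some (t e))).toNat = 0 := by
        apply Finset.sum_eq_zero
        intro e he
        have := I.noloop e he
        have h : (sing (some w) (some (s e)) && sing (some w) (some (t e))) = false := by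
          by_contra hh
          simp [sing] at hh
          exact this (hh.1.trans hh.2.symm)
        rw [h]; simp
      rw [h1, h2]
      have := I.deg w hw
      omega

/-- Case of exactly three odd edges after switching. -/
lemma three [Fintype V] {A : Finset E} {s t : E → V} {F : Finset V} {u v : V} (I : Inv A s t F u)
    (hv : v ∈ F)
    (p : E → Bool) (Y : V → Bool) (hneg : ∀ Z, 3 ≤ neg A s t p Z) (h3 : neg A s t p Y = 3) :
    ∃ c : E → Fin 3, ∀ i, (∀ X, Even (cut (col A c i) s t X)) ∧ Conn A s t c v i ∧
      Odd (neg (col A c i) s t p (fun _ => false)) := by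
  classical
  let q : E → Bool := fun e => xor (p e) (xor (Y (s e)) (Y (t e)))
  have I2 := inv2 I p Y hneg h3 q (fun _ => rfl)
  obtain ⟨c6, hc6⟩ := menger6 _ _ _ _ _ _ (some v) none le_rfl I2 (by simpa using hv) (by simp)
    (by simp)
  set N := A.filter (fun e => q e = true) with hN
  have hNcard : N.card = 3 := by
    rw [← h3, hN, Finset.card_filter]
    unfold neg
    apply Finset.sum_congr rfl
    intro e _
    change (if q e = true then 1 else 0) = (q e).toNat
    cases h : q e <;> simp
  let φ : N ⊕ N → Fin 6 := Sum.elim (fun e => c6 (Sum.inl e.1)) (fun e => c6 (Sum.inr e.1))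
  have hsurj : Function.Surjective φ := by
    intro j
    have h1 := (hc6 j).1 (sing none)
    have h2 : cut (col (A2 A q) c6 j) (s2 s t) (t2 t q) (sing none) ≠ 0 := by
      intro h; rw [h] at h1; simp [sing] at h1
    obtain ⟨x, hx, hx0⟩ := Finset.exists_ne_zero_of_sum_ne_zero h2
    rw [mem_col] at hx
    obtain ⟨hxA, hxj⟩ := hx
    rcases x with e | e
    · rw [inl_mem_A2] at hxA
      have hqe : q e = true := by
        by_contra hqe
        apply hx0
        simp [cr, s2, t2, hqe, sing]
      exact ⟨Sum.inl ⟨e, Finset.mem_filter.2 ⟨hxA, hqe⟩⟩, hxj⟩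
    · rw [inr_mem_A2] at hxA
      exact ⟨Sum.inr ⟨e, Finset.mem_filter.2 hxA⟩, hxj⟩
  have hbij : Function.Bijective φ := by
    rw [Fintype.bijective_iff_surjective_and_card]
    refine ⟨hsurj, ?_⟩
    simp [hNcard]
  let Φ := Equiv.ofBijective φ hbij
  let own : Fin 6 → N := fun j => Sum.elim id id (Φ.symm j)
  have hown1 : ∀ n : N, own (c6 (Sum.inl n.1)) = n := by
    intro n
    have : Φ.symm (c6 (Sum.inl n.1)) = Sum.inl n := by
      rw [Equiv.symm_apply_eq]; rfl
    simp [own, this]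
  have hown2 : ∀ n : N, own (c6 (Sum.inr n.1)) = n := by
    intro n
    have : Φ.symm (c6 (Sum.inr n.1)) = Sum.inr n := by
      rw [Equiv.symm_apply_eq]; rfl
    simp [own, this]
  have hown : ∀ j (n : N), own j = n ↔ j = c6 (Sum.inl n.1) ∨ j = c6 (Sum.inr n.1) := by
    intro j n
    constructor
    · intro h
      obtain ⟨x, rfl⟩ := hsurj j
      rcases x with x | x
      · left
        have h1 := hown1 x
        have : x = n := h1.symm.trans h
        rw [← this]; rfl
      · right
        have h1 := hown2 x
        have : x = n := h1.symm.trans h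
        rw [← this]; rfl
    · rintro (rfl | rfl)
      · exact hown1 n
      · exact hown2 n
  have hne : ∀ n : N, c6 (Sum.inl n.1) ≠ c6 (Sum.inr n.1) := by
    intro n h
    have : (Sum.inl n : N ⊕ N) = Sum.inr n := hbij.1 h
    cases this
  let κ := Finset.equivFinOfCardEq hNcard
  let c : E → Fin 3 := fun e => κ (own (c6 (Sum.inl e)))
  refine ⟨c, fun i => ?_⟩
  obtain ⟨n, rfl⟩ := κ.surjective i
  obtain ⟨n, hnN⟩ := n
  set n' : N := ⟨n, hnN⟩ with hn'
  set α := c6 (Sum.inl n) with hα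
  set β := c6 (Sum.inr n) with hβ
  have hnA : n ∈ A := (Finset.mem_filter.1 hnN).1
  have hnq : q n = true := (Finset.mem_filter.1 hnN).2
  have hci : ∀ e, c e = κ n' ↔ c6 (Sum.inl e) = α ∨ c6 (Sum.inl e) = β := by
    intro e
    simp only [c, EmbeddingLike.apply_eq_iff_eq]
    exact hown _ n'
  have hcn : c n = κ n' := by rw [hci]; exact Or.inl rfl
  have hNc : ∀ e ∈ A, q e = true → c e = κ n' → e = n := by
    intro e he hqe hce
    have h1 := hown1 ⟨e, Finset.mem_filter.2 ⟨he, hqe⟩⟩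
    simp only [c, EmbeddingLike.apply_eq_iff_eq] at hce
    rw [h1] at hce
    exact congrArg Subtype.val hce
  have hNr : ∀ e ∈ A, q e = true → (c6 (Sum.inr e) = α ∨ c6 (Sum.inr e) = β) → e = n := by
    intro e he hqe hce
    have h1 := hown2 ⟨e, Finset.mem_filter.2 ⟨he, hqe⟩⟩
    have h2 := (hown _ n').2 hce
    rw [h1] at h2
    exact congrArg Subtype.val h2
  have hncol : n ∈ col A c (κ n') := mem_col.2 ⟨hnA, hcn⟩
  have heven : ∀ X, Even (cut (col A c (κ n')) s t X) := by
    intro X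
    let X' : Option V → Bool := fun o => o.elim false X
    have hun : col (A2 A q) c6 α ∪ col (A2 A q) c6 β = (col A c (κ n')).disjSum {n} := by
      ext x
      rcases x with e | e
      · simp only [Finset.mem_union, mem_col, inl_mem_A2, Finset.inl_mem_disjSum, hci]
        tauto
      · simp only [Finset.mem_union, mem_col, inr_mem_A2, Finset.inr_mem_disjSum,
          Finset.mem_singleton]
        constructor
        · intro h
          exact hNr e (by tauto) (by tauto) (by tauto)
        · rintro rfl
          exact Or.inr ⟨⟨hnA, hnq⟩, rfl⟩
    have hdis : Disjoint (col (A2 A q) c6 α) (col (A2 A q) c6 β) := by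
      rw [Finset.disjoint_left]
      intro x hx hx'
      rw [mem_col] at hx hx'
      exact hne n' (hx.2.symm.trans hx'.2)
    have h1 : cut (col (A2 A q) c6 α) (s2 s t) (t2 t q) X' +
        cut (col (A2 A q) c6 β) (s2 s t) (t2 t q) X' =
        ∑ e ∈ col A c (κ n'), cr (s2 s t) (t2 t q) X' (Sum.inl e) + (X (t n)).toNat := by
      unfold cut
      rw [← Finset.sum_union hdis, hun, Finset.sum_disjSum, Finset.sum_singleton]
      simp [cr, s2, t2, X']
    rw [← Finset.add_sum_erase _ _ hncol] at h1
    have h2 : cr (s2 s t) (t2 t q) X' (Sum.inl n) = (X (s n)).toNat := by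
      simp [cr, s2, t2, X', hnq]
    have h3 : ∑ e ∈ (col A c (κ n')).erase n, cr (s2 s t) (t2 t q) X' (Sum.inl e) =
        ∑ e ∈ (col A c (κ n')).erase n, cr s t X e := by
      apply Finset.sum_congr rfl
      intro e he
      rw [Finset.mem_erase, mem_col] at he
      have : ¬ q e = true := fun hqe => he.1 (hNc e he.2.1 hqe he.2.2)
      simp [cr, s2, t2, X', this]
    rw [h2, h3] at h1
    have h4 : cut (col A c (κ n')) s t X = cr s t X n +
        ∑ e ∈ (col A c (κ n')).erase n, cr s t X e := (Finset.add_sum_erase _ _ hncol).symm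
    have h5 := (hc6 α).1 X'
    have h6 := (hc6 β).1 X'
    rw [Nat.even_iff, h4]
    have h7 : cr s t X n = (xor (X (s n)) (X (t n))).toNat := rfl
    rw [h7]
    rw [← h6] at h5
    revert h1
    cases X (s n) <;> cases X (t n) <;> simp only [Bool.xor_self, Bool.xor_true, Bool.xor_false,
      Bool.toNat_true, Bool.toNat_false, Bool.not_false] <;> intro h1 <;> omega
  refine ⟨heven, ?_, ?_⟩
  · intro X hXv hX
    let X' : Option V → Bool := fun o => o.elim (X (s n)) X
    have hnn := hX n hnA hcn
    have key : ∀ j, j = α ∨ j = β → ∀ e ∈ A, c6 (Sum.inl e) = j → X (s e) = true := by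
      intro j hj e he hej
      refine (hc6 j).2 X' hXv ?_ (Sum.inl e) (inl_mem_A2.2 he) hej
      rintro (x | x) hx hxj
      · rw [inl_mem_A2] at hx
        have hcx : c x = κ n' := by rw [hci, hxj]; exact hj
        by_cases hqx : q x = true
        · have := hNc x hx hqx hcx
          subst this
          simp [s2, t2, X', hqx]
        · simp [s2, t2, X', hqx, hX x hx hcx]
      · rw [inr_mem_A2] at hx
        have := hNr x hx.1 hx.2 (by rw [hxj]; exact hj)
        subst this
        simp [s2, t2, X', hnn]
    intro e he hei
    exact key _ ((hci e).1 hei) e he rfl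
  · have h1 := neg_switch (col A c (κ n')) s t p Y (fun _ => false)
    have h2 : neg (col A c (κ n')) s t p Y = 1 := by
      unfold neg
      rw [Finset.sum_eq_single n]
      · change (q n).toNat = 1
        rw [hnq]; rfl
      · intro e he hen
        rw [mem_col] at he
        have : ¬ q e = true := fun hqe => hen (hNc e he.1 hqe he.2)
        change (q e).toNat = 0
        simp [this]
      · intro h; exact absurd hncol h
    simp only [Bool.false_xor] at h1
    change neg (col A c (κ n')) s t p Y + _ = _ at h1
    rw [h2] at h1
    obtain ⟨k, hk⟩ := heven Y
    rw [Nat.odd_iff]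
    omega

theorem main3 [Fintype V] : ∀ n, ∀ (A : Finset E) (s t : E → V) (p : E → Bool) (F : Finset V)
    (u v : V),
    A.card + F.card ≤ n → Inv A s t F u → v ∈ F → 2 ≤ F.card → (∀ Y, 3 ≤ neg A s t p Y) →
    Odd (neg A s t p (fun _ => false)) →
    ∃ c : E → Fin 3, ∀ i, (∀ X, Even (cut (col A c i) s t X)) ∧ Conn A s t c v i ∧
      Odd (neg (col A c i) s t p (fun _ => false)) := by
  intro n
  induction n with
  | zero =>
    intro A s t p F u v hn I hv
    have : F.card = 0 := by omega
    rw [Finset.card_eq_zero] at this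
    simp [this] at hv
  | succ n ih =>
    intro A s t p F u v hn I hv hF2 hneg hodd
    by_cases hY : ∃ Y, neg A s t p Y = 3
    · obtain ⟨Y, hY⟩ := hY
      exact three I hv p Y hneg hY
    push Not at hY
    have h5 : ∀ Y, 5 ≤ neg A s t p Y := by
      intro Y
      have h1 := neg_switch A s t p Y (fun _ => false)
      simp only [Bool.false_xor] at h1
      change neg A s t p Y + _ = _ at h1
      obtain ⟨k, hk⟩ := I.even Y
      have h2 := hneg Y
      have h3 := hY Y
      rw [Nat.odd_iff] at hodd
      omega
    by_cases hu : ∃ e ∈ A, s e = u ∨ t e = u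
    · obtain ⟨e, he, hue⟩ := hu
      obtain ⟨f, hf, hef, huf, I'⟩ := exists_split I hF2 he hue
      have hcard := Finset.card_erase_add_one hf
      obtain ⟨c, hc⟩ := ih _ _ _ (np p e f) F u v (by omega) I' hv hF2 (by
        intro Y
        have h1 := h5 Y
        rcases neg_split A s t p u e f he hf hef hue huf Y with h | h <;> omega) (by
        rw [Nat.odd_iff] at hodd ⊢
        rcases neg_split A s t p u e f he hf hef hue huf (fun _ => false) with h | h <;> omega)
      refine ⟨lc c e f, fun i => ⟨fun X => ?_, ?_, ?_⟩⟩
      · rw [Nat.even_iff, lift_cut A s t u e f he hf hef hue huf, ← Nat.even_iff]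
        exact (hc i).1 X
      · exact lift_conn A s t u e f he hf hef hue huf c v i (hc i).2.1
      · rw [Nat.odd_iff, lift_neg A s t u e f he hf hef hue huf, ← Nat.odd_iff]
        exact (hc i).2.2
    · obtain ⟨z, hz, hzv⟩ := Finset.exists_mem_ne (by omega : 1 < F.card) v
      by_cases hw : ∃ w ∈ F, w ≠ v ∧ w ≠ z
      · obtain ⟨w, hw, hwv, hwz⟩ := hw
        have hcard := Finset.card_erase_add_one hw
        have hv' : v ∈ F.erase w := Finset.mem_erase.2 ⟨hwv.symm, hv⟩
        have hz' : z ∈ F.erase w := Finset.mem_erase.2 ⟨hwz.symm, hz⟩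
        exact ih A s t p (F.erase w) w v (by omega) (I.next hu hw) hv'
          (Finset.one_lt_card.2 ⟨v, hv', z, hz', hzv.symm⟩) hneg hodd
      · exfalso
        have hF : ∀ w ∈ F, w = v ∨ w = z := by
          intro w hw'
          by_contra hcon
          exact hw ⟨w, hw', by tauto, by tauto⟩
        have hends := base_ends I hu hF
        have hcard := base_card I hu hv hz hzv.symm hF
        have h1 := h5 (fun _ => false)
        have h2 := h5 (sing v)
        have h3 : neg A s t p (fun _ => false) + neg A s t p (sing v) = A.card := by
          unfold neg
          rw [← Finset.sum_add_distrib, Finset.card_eq_sum_ones]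
          apply Finset.sum_congr rfl
          intro e he
          rcases hends e he with ⟨h1, h2⟩ | ⟨h1, h2⟩ <;> simp only [ng, h1, h2] <;>
            cases p e <;> simp [sing, hzv]
        omega

end OddDec

namespace OddDec
variable {V : Type*} [DecidableEq V]

/-- a chosen source of an unordered pair -/
noncomputable def es (e : Sym2 V) : V := (Quot.out e).1
/-- a chosen target of an unordered pair -/
noncomputable def et (e : Sym2 V) : V := (Quot.out e).2

lemma mk_es_et (e : Sym2 V) : s(es e, et e) = e := Quot.out_eq e

lemma es_et (x y : V) : (es s(x, y) = x ∧ et s(x, y) = y) ∨ (es s(x, y) = y ∧ et s(x, y) = x) :=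
  Sym2.eq_iff.1 (mk_es_et s(x, y))

lemma es_ne_et {G : SimpleGraph V} {e : Sym2 V} (he : e ∈ G.edgeSet) : es e ≠ et e := by
  rw [← mk_es_et e, SimpleGraph.mem_edgeSet] at he
  exact he.ne

lemma cut_eq_card (B : Finset (Sym2 V)) (X : V → Bool) :
    cut B es et X = (B.filter (fun e => xor (X (es e)) (X (et e)) = true)).card := by
  rw [Finset.card_filter]
  unfold cut
  apply Finset.sum_congr rfl
  intro e _
  unfold cr
  cases h : xor (X (es e)) (X (et e)) <;> simp

lemma cut_sing (G : SimpleGraph V) (B : Finset (Sym2 V)) (hB : ∀ e ∈ B, e ∈ G.edgeSet) (w : V) :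
    cut B es et (sing w) = {y | s(w, y) ∈ B}.ncard := by
  rw [cut_eq_card, ← Set.ncard_coe_finset, ← Set.ncard_image_of_injective {y | s(w, y) ∈ B}
    (f := fun y => s(w, y)) (fun a b h => Sym2.congr_right.1 h)]
  congr 1
  ext e
  simp only [Finset.coe_filter, Set.mem_ofPred_eq, Set.mem_image]
  constructor
  · rintro ⟨he, hx⟩
    by_cases h : es e = w
    · refine ⟨et e, ?_, ?_⟩
      · rw [← h, mk_es_et]; exact he
      · rw [← h, mk_es_et]
    · have h2 : et e = w := by
        by_contra h2
        simp [sing, h, h2] at hx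
      refine ⟨es e, ?_, ?_⟩
      · rw [← h2, Sym2.eq_swap, mk_es_et]; exact he
      · rw [← h2, Sym2.eq_swap, mk_es_et]
  · rintro ⟨y, hy, rfl⟩
    refine ⟨hy, ?_⟩
    have hne : w ≠ y := by
      have := hB _ hy
      rw [SimpleGraph.mem_edgeSet] at this
      exact this.ne
    rcases es_et w y with ⟨h1, h2⟩ | ⟨h1, h2⟩ <;> rw [h1, h2] <;> simp [sing, hne.symm]

lemma handshake [Fintype V] (G : SimpleGraph V) (B : Finset (Sym2 V))
    (hB : ∀ e ∈ B, e ∈ G.edgeSet) (Z : V → Bool) :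
    ∑ w ∈ Finset.univ.filter (fun w => Z w = true), cut B es et (sing w) =
      cut B es et Z + 2 * ∑ e ∈ B, (Z (es e) && Z (et e)).toNat := by
  unfold cut
  rw [Finset.sum_comm, Finset.mul_sum, ← Finset.sum_add_distrib]
  apply Finset.sum_congr rfl
  intro e he
  have hne := es_ne_et (hB e he)
  have h1 : ∀ w, cr es et (sing w) e = (if es e = w then 1 else 0) + (if et e = w then 1 else 0) := by
    intro w
    simp only [cr, sing]
    by_cases h1 : es e = w <;> by_cases h2 : et e = w
    · exact absurd (h1.trans h2.symm) hne
    · simp [h1, h2]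
    · simp [h1, h2]
    · simp [h1, h2]
  simp only [h1, Finset.sum_add_distrib, Finset.sum_ite_eq, Finset.mem_filter, Finset.mem_univ,
    true_and]
  simp only [cr]
  cases Z (es e) <;> cases Z (et e) <;> simp

lemma conn_cut [Fintype V] (G : SimpleGraph V) (hconn : KEdgeConnected G 6)
    (A : Finset (Sym2 V)) (hA : ∀ e, e ∈ A ↔ e ∈ G.edgeSet) (X : V → Bool) (a b : V)
    (ha : X a = true) (hb : X b = false) : 6 ≤ cut A es et X := by
  by_contra hlt
  rw [cut_eq_card] at hlt
  have h := hconn.2 (↑(A.filter (fun e => xor (X (es e)) (X (et e)) = true)))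
    (by rw [Set.ncard_coe_finset]; omega)
  obtain ⟨w⟩ := h.preconnected a b
  have key : ∀ (x y : V) (w : (G.deleteEdges
      (↑(A.filter (fun e => xor (X (es e)) (X (et e)) = true)))).Walk x y), X x = X y := by
    intro x y w
    induction w with
    | nil => rfl
    | @cons x y z hxy _ ih =>
      rw [← ih]
      rw [SimpleGraph.deleteEdges_adj] at hxy
      obtain ⟨h1, h2⟩ := hxy
      by_contra hne
      apply h2
      simp only [Finset.coe_filter, Set.mem_ofPred_eq]
      refine ⟨(hA _).2 h1, ?_⟩
      rcases es_et x y with ⟨h3, h4⟩ | ⟨h3, h4⟩ <;> rw [h3, h4] <;> revert hne <;>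
        cases X x <;> cases X y <;> simp
  have := key a b w
  rw [ha, hb] at this
  cases this

/-- the subgraph formed by colour `i` -/
def cls (G : SimpleGraph V) (c : Sym2 V → Fin 3) (i : Fin 3) : G.Subgraph where
  verts := {x | ∃ y, G.Adj x y ∧ c s(x, y) = i}
  Adj x y := G.Adj x y ∧ c s(x, y) = i
  adj_sub := fun h => h.1
  edge_vert := fun {x y} h => ⟨y, h⟩
  symm := ⟨fun x y h => ⟨h.1.symm, by rw [Sym2.eq_swap]; exact h.2⟩⟩

lemma mem_cls_edgeSet (G : SimpleGraph V) (c : Sym2 V → Fin 3) (i : Fin 3) (e : Sym2 V) :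
    e ∈ (cls G c i).edgeSet ↔ e ∈ G.edgeSet ∧ c e = i := by
  induction e using Sym2.ind with
  | _ x y => rfl

lemma cls_spec [Fintype V] (G : SimpleGraph V) (A : Finset (Sym2 V))
    (hA : ∀ e, e ∈ A ↔ e ∈ G.edgeSet) (c : Sym2 V → Fin 3) (i : Fin 3) (v : V)
    (hev : ∀ X, Even (cut (col A c i) es et X)) (hC : Conn A es et c v i)
    (hodd : Odd (col A c i).card) :
    IsEulerianSubgraph G (cls G c i) ∧ Odd (cls G c i).edgeSet.ncard ∧ v ∈ (cls G c i).verts := by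
  classical
  have hadj : ∀ e ∈ A, c e = i → (cls G c i).Adj (es e) (et e) := by
    intro e he hei
    refine ⟨?_, ?_⟩
    · rw [← SimpleGraph.mem_edgeSet, mk_es_et, ← hA]; exact he
    · rw [mk_es_et]; exact hei
  have hv : v ∈ (cls G c i).verts := by
    by_contra hv
    have hne : (col A c i).Nonempty := by
      rw [← Finset.card_pos]; exact hodd.pos
    obtain ⟨e, he⟩ := hne
    rw [mem_col] at he
    have h1 : ∀ e ∈ A, c e = i → es e ≠ v ∧ et e ≠ v := by
      intro e he hei
      have := hadj e he hei
      refine ⟨?_, ?_⟩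
      · intro h; apply hv; rw [← h]; exact this.fst_mem
      · intro h; apply hv; rw [← h]; exact this.snd_mem
    have h2 := hC (sing v) (by simp [sing]) (by
      intro e he hei
      have := h1 e he hei
      simp [sing, this]) e he.1 he.2
    have h3 := h1 e he.1 he.2
    simp [sing, h3] at h2
  refine ⟨⟨?_, ?_⟩, ?_, hv⟩
  · rw [SimpleGraph.Subgraph.connected_iff]
    refine ⟨?_, ⟨v, hv⟩⟩
    let X : V → Bool := fun w =>
      decide (∃ h : w ∈ (cls G c i).verts, (cls G c i).coe.Reachable ⟨v, hv⟩ ⟨w, h⟩)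
    have step : ∀ x y, (cls G c i).Adj x y → X x = true → X y = true := by
      intro x y hxy hx
      simp only [X, decide_eq_true_eq] at hx ⊢
      obtain ⟨h, hr⟩ := hx
      refine ⟨hxy.snd_mem, hr.trans ?_⟩
      apply SimpleGraph.Adj.reachable
      exact hxy
    have h1 := hC X (by simp only [X, decide_eq_true_eq]; exact ⟨hv, SimpleGraph.Reachable.refl _⟩)
      (by
        intro e he hei
        have h := hadj e he hei
        have h1 := step _ _ h
        have h2 := step _ _ h.symm
        cases hx : X (es e) <;> cases hy : X (et e) <;> simp_all)
    have h2 : ∀ x : (cls G c i).verts, (cls G c i).coe.Reachable ⟨v, hv⟩ x := by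
      rintro ⟨x, hx⟩
      obtain ⟨y, hxy, hcy⟩ := hx
      have hm : s(x, y) ∈ A := (hA _).2 hxy
      have h3 := h1 _ hm hcy
      have h4 := step _ _ (hadj _ hm hcy) h3
      have h5 : X x = true := by
        rcases es_et x y with ⟨h, h'⟩ | ⟨h, h'⟩
        · rw [h] at h3; exact h3
        · rw [h'] at h4; exact h4
      simp only [X, decide_eq_true_eq] at h5
      exact h5.2
    exact ⟨fun x y => (h2 x).symm.trans (h2 y)⟩
  · intro w _
    have h1 := hev (sing w)
    rw [cut_sing G _ (fun e he => (hA e).1 (mem_col.1 he).1)] at h1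
    convert h1 using 2
    ext y
    simp only [Set.mem_ofPred_eq, mem_col, hA]
    rfl
  · have : (cls G c i).edgeSet = ↑(col A c i) := by
      ext e
      rw [mem_cls_edgeSet, Finset.mem_coe, mem_col, hA]
    rw [this, Set.ncard_coe_finset]
    exact hodd

end OddDec

open OddDec

/-- Every 6-edge-connected 6-regular graph of odd order has a rooted 3-odd
decomposition. -/
theorem sixEdgeConnected_sixRegular_rooted3OddDecomposition {V : Type*} [Fintype V]
    (G : SimpleGraph V) (hconn : KEdgeConnected G 6)
    (hreg : ∀ v : V, (G.neighborSet v).ncard = 6)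
    (hodd : Odd (Fintype.card V)) :
    ∃ D : Fin 3 → G.Subgraph, IsRootedKOddDecomposition G 3 D := by
  classical

  set A : Finset (Sym2 V) := G.edgeFinset with hAdef
  have hA : ∀ e, e ∈ A ↔ e ∈ G.edgeSet := fun e => by simp [hAdef]
  have hA' : ∀ e ∈ A, e ∈ G.edgeSet := fun e he => (hA e).1 he
  have hdeg : ∀ w, cut A es et (sing w) = 6 := by
    intro w
    rw [cut_sing G A hA', ← hreg w]
    congr 1
    ext y
    simp only [Set.mem_ofPred_eq, hA]
    rfl
  have hhs : ∀ Z : V → Bool, 6 * (Finset.univ.filter (fun w => Z w = true)).card =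
      cut A es et Z + 2 * ∑ e ∈ A, (Z (es e) && Z (et e)).toNat := by
    intro Z
    rw [← handshake G A hA' Z]
    simp [hdeg, mul_comm]
  obtain ⟨v⟩ := hconn.1.nonempty
  have hcard : 6 ≤ Fintype.card V := by
    rw [← hreg v, ← Nat.card_eq_fintype_card]
    exact Set.ncard_le_card _
  obtain ⟨u, huv⟩ := Fintype.exists_ne_of_one_lt_card (by omega : 1 < Fintype.card V) v
  have I : Inv A es et (Finset.univ.erase u) u := by
    refine ⟨by simp, ?_, ?_, ?_, ?_, ?_⟩
    · intro e _
      simp only [Finset.mem_erase, Finset.mem_univ, and_true]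
      tauto
    · intro e he
      exact es_ne_et (hA' e he)
    · intro X
      have := hhs X
      rw [Nat.even_iff]
      omega
    · intro X a _ b _ ha hb
      exact conn_cut G hconn A hA X a b ha hb
    · intro w _
      exact (hdeg w).le
  have hneg : ∀ Y, 3 ≤ neg A es et (fun _ => true) Y := by
    intro Y
    have h1 := hhs Y
    have h2 := hhs (fun w => !Y w)
    rw [cut_compl] at h2
    have h3 := Finset.card_filter_add_card_filter_not (s := (Finset.univ : Finset V))
      (fun w => Y w = true)
    have h4 : (Finset.univ.filter (fun w => (!Y w) = true)).card =
        (Finset.univ.filter (fun w => ¬ Y w = true)).card := by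
      congr 1; ext w; simp
    have h5 : neg A es et (fun _ => true) Y = ∑ e ∈ A, (Y (es e) && Y (et e)).toNat +
        ∑ e ∈ A, (!Y (es e) && !Y (et e)).toNat := by
      unfold neg
      rw [← Finset.sum_add_distrib]
      apply Finset.sum_congr rfl
      intro e _
      unfold ng
      cases Y (es e) <;> cases Y (et e) <;> rfl
    rw [Finset.card_univ] at h3
    rw [Nat.odd_iff] at hodd
    omega
  have hnegc : ∀ B : Finset (Sym2 V), neg B es et (fun _ => true) (fun _ => false) = B.card := by
    intro B
    simp [neg, ng]
  have hno : Odd (neg A es et (fun _ => true) (fun _ => false)) := by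
    have h1 := hhs (fun _ => true)
    have h2 : cut A es et (fun _ => true) = 0 := by simp [cut, cr]
    rw [h2] at h1
    simp at h1
    rw [hnegc]
    rw [Nat.odd_iff] at hodd ⊢
    omega
  obtain ⟨c, hc⟩ := main3 _ A es et (fun _ => true) (Finset.univ.erase u) u v le_rfl I
    (by simp [huv.symm]) (by rw [Finset.card_erase_of_mem (Finset.mem_univ _), Finset.card_univ]; omega)
    hneg hno
  have hs := fun i => cls_spec G A hA c i v (hc i).1 (hc i).2.1 (by rw [← hnegc]; exact (hc i).2.2)
  refine ⟨cls G c, ⟨fun i => (hs i).1, fun i => (hs i).2.1, ?_, ?_⟩, v, fun i => (hs i).2.2⟩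
  · intro i j hij
    rw [Set.disjoint_left]
    intro e he he'
    rw [mem_cls_edgeSet] at he he'
    exact hij (he.2.symm.trans he'.2)
  · ext e
    simp only [Set.mem_iUnion, mem_cls_edgeSet]
    constructor
    · rintro ⟨_, h, _⟩; exact h
    · intro h; exact ⟨c e, h, rfl⟩
end
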